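/- arXiv:2404.00609 — 2 statements merged into one kernel-verified Lean document; each statement's English description precedes it below -/
import Mathlib

section
/- Let Ω ⊆ ℝⁿ be a connected open set, let f : Ω → ℝ be measurable with 0 < λ ≤ f ≤ Λ, and let F, G : ℝⁿ × ℝ → ℝ satisfy 0 < λ ≤ F ≤ Λ, 0 < λ ≤ G ≤ Λ and be locally Lipschitz. Let u ≥ v be convex functions on Ω that are C¹ on Ω and strictly convex (every point of Ω is a strictly convex point of u and of v), and assume that Mu(E) ≤ ∫_E f(x)·F(x,u(x))/G(∇u(x), u*(∇u(x))) dx and Mv(E) ≥ ∫_E f(x)·F(x,v(x))/G(∇v(x), v*(∇v(x))) dx for every Borel set E ⊆ Ω. Then either u(x) > v(x) for all x ∈ Ω, or u ≡ v on Ω. -/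
open MeasureTheory Set
open scoped RealInnerProductSpace ENNReal

noncomputable section

abbrev En (n : ℕ) := EuclideanSpace ℝ (Fin n)

/-- The subgradient of `u` (as a convex function on `Ω`) at `x`. -/
def subgrad {n : ℕ} (Ω : Set (En n)) (u : En n → ℝ) (x : En n) : Set (En n) :=
  {p | ∀ y ∈ Ω, u x + ⟪p, y - x⟫ ≤ u y}

/-- The Monge–Ampère measure of `u` on a set `s`. -/
def MAm {n : ℕ} (Ω : Set (En n)) (u : En n → ℝ) (s : Set (En n)) : ℝ≥0∞ :=
  volume (⋃ x ∈ s, subgrad Ω u x)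

/-- `x₀` is a strictly convex point of `u` on `Ω`. -/
def IsStrictConvexPt {n : ℕ} (Ω : Set (En n)) (u : En n → ℝ) (x₀ : En n) : Prop :=
  ∀ x ∈ Ω, x ≠ x₀ → u ((1/2 : ℝ) • (x + x₀)) < (u x + u x₀) / 2

/-- `Σ_u`: the set of non-strictly convex points of `u` in `Ω`. -/
def SigmaSet {n : ℕ} (Ω : Set (En n)) (u : En n → ℝ) : Set (En n) :=
  {x ∈ Ω | ¬ IsStrictConvexPt Ω u x}

/-- The Legendre transform of `u` (as a function on `Ω`). -/
def legendreT {n : ℕ} (Ω : Set (En n)) (u : En n → ℝ) (p : En n) : ℝ :=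
  sSup ((fun x => ⟪x, p⟫ - u x) '' Ω)

/-- `w` is a generalized (Aleksandrov) solution of
`det D²w = f(x) · F(x, w) / G(∇w, w* ∘ ∇w)` on `Ω`. -/
def IsGenSol {n : ℕ} (Ω : Set (En n)) (f : En n → ℝ) (F G : En n × ℝ → ℝ)
    (w : En n → ℝ) : Prop :=
  ∀ s : Set (En n), s ⊆ Ω → MeasurableSet s →
    MAm Ω w s = ∫⁻ x in s, ENNReal.ofReal
      (f x * F (x, w x) / G (gradient w x, legendreT Ω w (gradient w x)))

open Module in
theorem det_rpow_le_trace_div {n : ℕ} (hn : 0 < n) {T : En n →ₗ[ℝ] En n} (hT : T.IsSymmetric)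
    (hpos : ∀ x, 0 ≤ ⟪x, T x⟫) :
    0 ≤ LinearMap.det T ∧
      (LinearMap.det T) ^ ((n : ℝ)⁻¹) ≤ (n : ℝ)⁻¹ * LinearMap.trace ℝ (En n) T := by
  have hfin : finrank ℝ (En n) = n := by simp
  have hev : ∀ i, 0 ≤ hT.eigenvalues hfin i := by
    intro i
    have h := hpos (hT.eigenvectorBasis hfin i)
    rw [hT.apply_eigenvectorBasis hfin i, inner_smul_right, real_inner_self_eq_norm_sq] at h
    simpa using h
  have hdet : LinearMap.det T = ∏ i, hT.eigenvalues hfin i := by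
    simpa using hT.det_eq_prod_eigenvalues hfin
  have htr : LinearMap.trace ℝ (En n) T = ∑ i, hT.eigenvalues hfin i := by
    simpa using hT.trace_eq_sum_eigenvalues hfin
  rw [hdet, htr]
  refine ⟨Finset.prod_nonneg fun i _ => hev i, ?_⟩
  have hn' : (n : ℝ) ≠ 0 := by positivity
  have := Real.geom_mean_le_arith_mean_weighted Finset.univ (fun _ : Fin n => (n : ℝ)⁻¹)
    (hT.eigenvalues hfin) (fun _ _ => by positivity) (by simp [hn']) (fun i _ => hev i)
  rwa [Real.finsetProd_rpow _ _ (fun i _ => hev i), ← Finset.mul_sum] at this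

theorem det_adjoint_real {n : ℕ} (L : En n →ₗ[ℝ] En n) :
    LinearMap.det (LinearMap.adjoint L) = LinearMap.det L := by
  have b := EuclideanSpace.basisFun (Fin n) ℝ
  rw [← LinearMap.det_toMatrix b.toBasis, LinearMap.toMatrix_adjoint, ← LinearMap.det_toMatrix b.toBasis L]
  simp

theorem det_concavity_bound {n : ℕ} (hn : 0 < n) {P L : En n →ₗ[ℝ] En n} (hP : P.IsSymmetric)
    {ε g g₁ N : ℝ} (hε : 0 < ε) (hε1 : ε < 1) (hg : 0 < g) (hgg : g ≤ g₁) (hN : 0 ≤ N)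
    (hPL : ∀ ξ, ε * ‖L (P ξ)‖ ^ 2 ≤ ⟪ξ, P ξ⟫)
    (hL : g₁ * (N + 1) ^ n ≤ LinearMap.det L ^ 2)
    (hdet : g * |LinearMap.det P| ≤
      |LinearMap.det ((1 - ε)⁻¹ • (LinearMap.id - ε • (LinearMap.adjoint L ∘ₗ L ∘ₗ P)))|) :
    |LinearMap.det P| * g * (1 + ε * N) ≤ 1 := by
  set A := LinearMap.adjoint L with hA
  have hn' : (n : ℝ) ≠ 0 := by positivity
  have hdL : LinearMap.det L ≠ 0 := by
    intro h
    rw [h] at hL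
    have : 0 < g₁ * (N + 1) ^ n := mul_pos (hg.trans_le hgg) (by positivity)
    simp at hL; linarith
  have hdA : LinearMap.det A = LinearMap.det L := det_adjoint_real L
  set S : En n →ₗ[ℝ] En n := ε • (L ∘ₗ P ∘ₗ A) with hS
  have hSsym : S.IsSymmetric := by
    intro x y
    simp only [hS, LinearMap.smul_apply, LinearMap.comp_apply, inner_smul_left, inner_smul_right]
    rw [← LinearMap.adjoint_inner_right, hP, hA, LinearMap.adjoint_inner_left]
    simp
  have hSq : ∀ ζ, ‖S ζ‖ ^ 2 ≤ ⟪ζ, S ζ⟫ := by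
    intro ζ
    have h := hPL (A ζ)
    simp only [hS, LinearMap.smul_apply, LinearMap.comp_apply, inner_smul_right, norm_smul]
    rw [hA, LinearMap.adjoint_inner_left] at h
    rw [mul_pow, Real.norm_eq_abs, sq_abs]
    nlinarith
  have hSpos : ∀ ζ, 0 ≤ ⟪ζ, S ζ⟫ := fun ζ => (sq_nonneg _).trans (hSq ζ)
  have hIsym : (LinearMap.id - S : En n →ₗ[ℝ] En n).IsSymmetric := by
    intro x y
    simp only [LinearMap.sub_apply, LinearMap.id_apply, inner_sub_left, inner_sub_right, hSsym x y]
  have hIpos : ∀ ζ, 0 ≤ ⟪ζ, (LinearMap.id - S : En n →ₗ[ℝ] En n) ζ⟫ := by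
    intro ζ
    simp only [LinearMap.sub_apply, LinearMap.id_apply, inner_sub_right,
      real_inner_self_eq_norm_sq]
    have h1 := hSq ζ
    have h2 := real_inner_le_norm ζ (S ζ)
    nlinarith [sq_nonneg (‖ζ‖ - ‖S ζ‖)]
  obtain ⟨hS0, hS1⟩ := det_rpow_le_trace_div hn hSsym hSpos
  obtain ⟨hI0, hI1⟩ := det_rpow_le_trace_div hn hIsym hIpos
  have hswap : LinearMap.det (LinearMap.id - ε • (A ∘ₗ L ∘ₗ P)) =
      LinearMap.det (LinearMap.id - S : En n →ₗ[ℝ] En n) := by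
    have h : (LinearMap.id - ε • (A ∘ₗ L ∘ₗ P)) ∘ₗ A = A ∘ₗ (LinearMap.id - S : En n →ₗ[ℝ] En n) := by
      ext1 x
      simp [hS]
    have h2 := congrArg LinearMap.det h
    rw [LinearMap.det_comp, LinearMap.det_comp, mul_comm] at h2
    exact mul_left_cancel₀ (hdA ▸ hdL) h2
  have hdetS : LinearMap.det S = ε ^ n * (LinearMap.det L ^ 2 * LinearMap.det P) := by
    rw [hS, LinearMap.det_smul, LinearMap.det_comp, LinearMap.det_comp, hdA]
    simp only [finrank_euclideanSpace, Fintype.card_fin]; ring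
  have hε1' : 0 < 1 - ε := by linarith
  rw [LinearMap.det_smul, hswap, abs_mul, abs_of_nonneg hI0] at hdet
  have hP0 : 0 ≤ LinearMap.det P := by
    rw [hdetS] at hS0
    have : 0 < LinearMap.det L ^ 2 := by positivity
    by_contra hneg
    push Not at hneg
    have : ε ^ n * (LinearMap.det L ^ 2 * LinearMap.det P) < 0 :=
      mul_neg_of_pos_of_neg (by positivity) (mul_neg_of_pos_of_neg this hneg)
    linarith
  rw [abs_of_nonneg hP0] at hdet ⊢
  set d := LinearMap.det P
  have hfin : Module.finrank ℝ (En n) = n := by simp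
  rw [hfin, abs_of_nonneg (by positivity)] at hdet
  have hdI : (1 - ε) ^ n * (g * d) ≤ LinearMap.det (LinearMap.id - S : En n →ₗ[ℝ] En n) := by
    calc (1 - ε) ^ n * (g * d) ≤ (1 - ε) ^ n * (((1 - ε)⁻¹) ^ n * LinearMap.det (LinearMap.id - S : En n →ₗ[ℝ] En n)) :=
          mul_le_mul_of_nonneg_left hdet (by positivity)
      _ = _ := by rw [inv_pow, ← mul_assoc, mul_inv_cancel₀ (by positivity), one_mul]
  have hdS : ε ^ n * ((N + 1) ^ n * (g * d)) ≤ LinearMap.det S := by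
    rw [hdetS]
    refine mul_le_mul_of_nonneg_left ?_ (by positivity)
    calc (N + 1) ^ n * (g * d) ≤ (N + 1) ^ n * (g₁ * d) := by gcongr
      _ = (g₁ * (N + 1) ^ n) * d := by ring
      _ ≤ _ := by gcongr
  have hroot : ∀ a b : ℝ, 0 ≤ a → 0 ≤ b → (a ^ n * b) ^ ((n : ℝ)⁻¹) = a * b ^ ((n : ℝ)⁻¹) := by
    intro a b ha hb
    rw [Real.mul_rpow (by positivity) hb, Real.pow_rpow_inv_natCast ha (by omega)]
  have hgd : 0 ≤ g * d := by positivity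
  have e1 : (1 - ε) * (g * d) ^ ((n : ℝ)⁻¹) ≤ (n : ℝ)⁻¹ * LinearMap.trace ℝ (En n) (LinearMap.id - S : En n →ₗ[ℝ] En n) := by
    rw [← hroot _ _ hε1'.le hgd]
    exact (Real.rpow_le_rpow (by positivity) hdI (by positivity)).trans hI1
  have e2 : ε * ((N + 1) * (g * d) ^ ((n : ℝ)⁻¹)) ≤ (n : ℝ)⁻¹ * LinearMap.trace ℝ (En n) S := by
    rw [← hroot _ _ (by positivity : 0 ≤ N + 1) hgd, ← hroot _ _ hε.le (by positivity)]
    exact (Real.rpow_le_rpow (by positivity) hdS (by positivity)).trans hS1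
  have e3 : (n : ℝ)⁻¹ * LinearMap.trace ℝ (En n) (LinearMap.id - S : En n →ₗ[ℝ] En n) +
      (n : ℝ)⁻¹ * LinearMap.trace ℝ (En n) S = 1 := by
    rw [map_sub, LinearMap.trace_id, hfin]
    field_simp; ring
  have e4 : (1 + ε * N) * (g * d) ^ ((n : ℝ)⁻¹) ≤ 1 := by nlinarith
  have e5 : (1 + ε * N) ^ n * (g * d) ≤ 1 := by
    have h0 : 0 ≤ (1 + ε * N) * (g * d) ^ ((n : ℝ)⁻¹) := by positivity
    have := pow_le_one₀ h0 e4 (n := n)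
    rwa [mul_pow, Real.rpow_inv_natCast_pow hgd (by omega)] at this
  have e6 : 1 + ε * N ≤ (1 + ε * N) ^ n := le_self_pow₀ (by nlinarith) (by omega)
  nlinarith

theorem LipschitzWith.volume_image_null {n : ℕ} {K : NNReal} {Ψ : En n → En n}
    (hΨ : LipschitzWith K Ψ) {Z : Set (En n)} (hZ : volume Z = 0) : volume (Ψ '' Z) = 0 := by
  have h1 : (Measure.hausdorffMeasure (n : ℝ) : Measure (En n)) ≪ volume := by
    rw [Measure.isAddLeftInvariant_eq_smul (Measure.hausdorffMeasure (n : ℝ) : Measure (En n)) volume]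
    exact Measure.smul_absolutelyContinuous
  have h2 : volume ≪ (Measure.hausdorffMeasure (n : ℝ) : Measure (En n)) := by
    rw [Measure.isAddLeftInvariant_eq_smul (volume : Measure (En n)) (Measure.hausdorffMeasure (n : ℝ))]
    exact Measure.smul_absolutelyContinuous
  apply h2
  have h3 := hΨ.hausdorffMeasure_image_le (d := (n : ℝ)) (by positivity) Z
  rw [h1 hZ, mul_zero] at h3
  exact le_antisymm h3 (zero_le)

theorem lintegral_image_invFunOn_le {n : ℕ} {O : Set (En n)} (hO : MeasurableSet O)
    {e : En n → En n} (he : ContinuousOn e O) (hinj : InjOn e O) {g : En n → ℝ≥0∞}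
    (hg : Measurable g)
    (h : ∀ s ⊆ O, MeasurableSet s → volume (e '' s) ≤ ∫⁻ x in s, g x) (φ : En n → ℝ≥0∞) :
    ∫⁻ p in e '' O, φ p ≤ ∫⁻ x in O, g x * φ (e x) := by
  have hemb := he.measurableEmbedding hO hinj
  have hsub := MeasurableEmbedding.subtype_coe hO
  have hle : (volume : Measure (En n)).comap (O.domRestrict e) ≤
      ((volume : Measure (En n)).comap (Subtype.val : O → En n)).withDensity (fun x => g x) := by
    rw [Measure.le_iff]
    intro s hs
    rw [hemb.comap_apply, withDensity_apply _ hs]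
    have h1 : O.domRestrict e '' s = e '' (Subtype.val '' s) := by
      rw [image_image]; rfl
    rw [h1]
    refine (h _ (by simp) (hsub.measurableSet_image' hs)).trans (le_of_eq ?_)
    rw [← hsub.lintegral_map (μ := (Measure.comap Subtype.val volume).restrict s)]
    rw [hsub.restrict_comap]
    rw [hsub.map_comap, Measure.restrict_restrict hsub.measurableSet_range,
      inter_eq_right.2 (image_subset_range _ _)]
  calc ∫⁻ p in e '' O, φ p = ∫⁻ x, φ (e x) ∂((volume : Measure (En n)).comap (O.domRestrict e)) := by
        have h1 : e '' O = range (O.domRestrict e) := (range_domRestrict e O).symm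
        rw [h1, ← hemb.map_comap, hemb.lintegral_map]
        rfl
    _ ≤ ∫⁻ x : O, φ (e x) ∂(((volume : Measure (En n)).comap (Subtype.val : O → En n)).withDensity (fun x => g x)) :=
        lintegral_mono' hle le_rfl
    _ ≤ ∫⁻ x : O, g x * φ (e x) ∂((volume : Measure (En n)).comap (Subtype.val : O → En n)) :=
        lintegral_withDensity_le_lintegral_mul _ (hg.comp measurable_subtype_coe) _
    _ = _ := by
        rw [← map_comap_subtype_coe hO volume, hsub.lintegral_map]

theorem ConvexOn.subgradient_ineq {n : ℕ} {Ω : Set (En n)} {u : En n → ℝ} (hu : ConvexOn ℝ Ω u)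
    {x y g : En n} (hx : x ∈ Ω) (hy : y ∈ Ω) (hg : HasGradientAt u g x) :
    u x + ⟪g, y - x⟫ ≤ u y := by
  have hline : HasDerivAt (fun t : ℝ => x + t • (y - x)) (y - x) 0 := by
    simpa using ((hasDerivAt_id (0 : ℝ)).smul_const (y - x)).const_add x
  have hd : HasDerivAt (fun t : ℝ => u (x + t • (y - x))) ⟪g, y - x⟫ 0 := by
    have hg' : HasFDerivAt u (InnerProductSpace.toDual ℝ (En n) g) (x + (0 : ℝ) • (y - x)) := by
      simpa using hg.hasFDerivAt
    simpa [Function.comp_def] using hg'.comp_hasDerivAt (0 : ℝ) hline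
  have hlim := hd.tendsto_slope_zero_right
  have hev : ∀ᶠ t : ℝ in nhdsWithin 0 (Ioi 0),
      t⁻¹ • (u (x + (0 + t) • (y - x)) - u (x + (0 : ℝ) • (y - x))) ≤ u y - u x := by
    filter_upwards [Ioc_mem_nhdsGT (zero_lt_one' ℝ)] with t ht
    have hc := hu.2 hx hy (sub_nonneg.2 ht.2) ht.1.le (by ring)
    have he : x + (0 + t) • (y - x) = (1 - t) • x + t • y := by module
    simp only [smul_eq_mul] at hc ⊢
    rw [he, zero_smul, add_zero, inv_mul_le_iff₀ ht.1]
    linarith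
  have := le_of_tendsto hlim hev
  linarith

theorem IsStrictConvexPt.subgradient_ineq_lt {n : ℕ} {Ω : Set (En n)} {u : En n → ℝ}
    (hu : ConvexOn ℝ Ω u) {x y g : En n} (hs : IsStrictConvexPt Ω u x)
    (hx : x ∈ Ω) (hy : y ∈ Ω) (hxy : y ≠ x)
    (hg : HasGradientAt u g x) : u x + ⟪g, y - x⟫ < u y := by
  have h1 := hs y hy hxy
  have hm : (1 / 2 : ℝ) • (y + x) ∈ Ω := by
    have := hu.1 hy hx (by norm_num : (0 : ℝ) ≤ 1 / 2) (by norm_num : (0 : ℝ) ≤ 1 / 2) (by norm_num)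
    rwa [← smul_add] at this
  have h2 := hu.subgradient_ineq hx hm hg
  have h3 : (1 / 2 : ℝ) • (y + x) - x = (1 / 2 : ℝ) • (y - x) := by module
  rw [h3, inner_smul_right] at h2
  linarith

theorem ConvexOn.subgrad_eq_singleton {n : ℕ} {Ω : Set (En n)} (hΩ : IsOpen Ω) {u : En n → ℝ}
    (hu : ConvexOn ℝ Ω u) {x g : En n} (hx : x ∈ Ω) (hg : HasGradientAt u g x) :
    subgrad Ω u x = {g} := by
  ext p
  simp only [subgrad, mem_ofPred_eq, mem_singleton_iff]
  constructor
  · intro hp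
    have hmin : IsLocalMin (fun y => u y - ⟪p, y⟫) x := by
      filter_upwards [hΩ.mem_nhds hx] with y hy
      have := hp y hy
      rw [inner_sub_right] at this
      linarith
    have hd : HasFDerivAt (fun y => u y - ⟪p, y⟫)
        (InnerProductSpace.toDual ℝ (En n) g - innerSL ℝ p) x :=
      hg.hasFDerivAt.sub (innerSL ℝ p).hasFDerivAt
    have h0 := hmin.hasFDerivAt_eq_zero hd
    have h1 := congrArg (fun l => l (g - p)) h0
    simp only [sub_apply, InnerProductSpace.toDual_apply_apply, innerSL_apply_apply,
      zero_apply, ← inner_sub_left] at h1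
    exact (sub_eq_zero.1 (inner_self_eq_zero.1 h1)).symm
  · rintro rfl y hy
    exact hu.subgradient_ineq hx hy hg

theorem ConvexOn.MAm_eq_volume_image {n : ℕ} {Ω : Set (En n)} (hΩ : IsOpen Ω) {u : En n → ℝ}
    (hu : ConvexOn ℝ Ω u) {du : En n → En n} (hdu : ∀ x ∈ Ω, HasGradientAt u (du x) x)
    {s : Set (En n)} (hs : s ⊆ Ω) : MAm Ω u s = volume (du '' s) := by
  unfold MAm
  congr 1
  rw [← biUnion_of_singleton (du '' s), biUnion_image]
  exact iUnion₂_congr fun x hx => hu.subgrad_eq_singleton hΩ (hs hx) (hdu x (hs hx))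

theorem ConvexOn.legendreT_gradient {n : ℕ} {Ω : Set (En n)} {u : En n → ℝ}
    (hu : ConvexOn ℝ Ω u) {x g : En n} (hx : x ∈ Ω) (hg : HasGradientAt u g x) :
    legendreT Ω u g = ⟪x, g⟫ - u x := by
  refine IsGreatest.csSup_eq ⟨⟨x, hx, rfl⟩, ?_⟩
  rintro _ ⟨y, hy, rfl⟩
  have := hu.subgradient_ineq hx hy hg
  rw [inner_sub_right, real_inner_comm, real_inner_comm x] at this
  simp only
  linarith

theorem exists_inverse_gradient {n : ℕ} {D : Set (En n)} (hD : IsCompact D) (hne : D.Nonempty)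
    (hconv : Convex ℝ D) {w : En n → ℝ} {dw : En n → En n}
    (hw : ∀ x ∈ D, HasGradientAt w (dw x) x) {c : ℝ} (hc : 0 < c)
    (hmono : ∀ x ∈ D, ∀ y ∈ D, c * ‖x - y‖ ^ 2 ≤ ⟪dw x - dw y, x - y⟫) :
    ∃ (Ψ : En n → En n) (K : NNReal), LipschitzWith K Ψ ∧ (∀ p, Ψ p ∈ D) ∧
      (∀ p, Ψ p ∈ interior D → dw (Ψ p) = p) ∧ (∀ x ∈ D, Ψ (dw x) = x) ∧
      (∀ p q, ⟪dw (Ψ p) - dw (Ψ q), Ψ p - Ψ q⟫ ≤ ⟪p - q, Ψ p - Ψ q⟫) ∧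
      (∀ p (P : En n →L[ℝ] En n), HasFDerivAt Ψ P p → (P : En n →ₗ[ℝ] En n).IsSymmetric) := by
  have hcont : ContinuousOn w D := fun x hx => (hw x hx).continuousAt.continuousWithinAt
  have hex : ∀ p : En n, ∃ x ∈ D, IsMinOn (fun y => w y - ⟪p, y⟫) D x := fun p =>
    hD.exists_isMinOn hne (hcont.sub (by fun_prop))
  choose Ψ hΨD hΨmin using hex
  have hgrad : ∀ p, HasGradientAt (fun y => w y - ⟪p, y⟫) (dw (Ψ p) - p) (Ψ p) := by
    intro p
    rw [hasGradientAt_iff_hasFDerivAt, map_sub]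
    exact (hw _ (hΨD p)).hasFDerivAt.sub (innerSL ℝ p).hasFDerivAt
  have hvar : ∀ p, ∀ y ∈ D, 0 ≤ ⟪dw (Ψ p) - p, y - Ψ p⟫ := by
    intro p y hy
    have hline : HasDerivAt (fun t : ℝ => Ψ p + t • (y - Ψ p)) (y - Ψ p) 0 := by
      simpa using ((hasDerivAt_id (0 : ℝ)).smul_const (y - Ψ p)).const_add (Ψ p)
    have hd : HasDerivAt (fun t : ℝ => w (Ψ p + t • (y - Ψ p)) - ⟪p, Ψ p + t • (y - Ψ p)⟫)
        ⟪dw (Ψ p) - p, y - Ψ p⟫ 0 := by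
      have hg' : HasFDerivAt (fun y => w y - ⟪p, y⟫)
          (InnerProductSpace.toDual ℝ (En n) (dw (Ψ p) - p)) (Ψ p + (0 : ℝ) • (y - Ψ p)) := by
        simpa using (hgrad p).hasFDerivAt
      simpa [Function.comp_def, inner_sub_left] using hg'.comp_hasDerivAt (0 : ℝ) hline
    refine ge_of_tendsto hd.tendsto_slope_zero_right ?_
    filter_upwards [Ioc_mem_nhdsGT (zero_lt_one' ℝ)] with t ht
    have hmem : Ψ p + t • (y - Ψ p) ∈ D := by
      have := hconv (hΨD p) hy (sub_nonneg.2 ht.2) ht.1.le (by ring)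
      convert this using 1
      module
    have := hΨmin p hmem
    simp only [mem_ofPred_eq] at this
    simp only [smul_eq_mul, zero_smul, add_zero, zero_add]
    exact mul_nonneg (inv_nonneg.2 ht.1.le) (by linarith)
  have hpq : ∀ p q, ⟪dw (Ψ p) - dw (Ψ q), Ψ p - Ψ q⟫ ≤ ⟪p - q, Ψ p - Ψ q⟫ := by
    intro p q
    have h1 := hvar p _ (hΨD q)
    have h2 := hvar q _ (hΨD p)
    simp only [inner_sub_left, inner_sub_right] at h1 h2 ⊢
    linarith
  have hlip : ∀ p q, ‖Ψ p - Ψ q‖ ≤ c⁻¹ * ‖p - q‖ := by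
    intro p q
    have h1 := (hmono _ (hΨD p) _ (hΨD q)).trans (hpq p q)
    have h2 := h1.trans (real_inner_le_norm _ _)
    rw [← div_eq_inv_mul, le_div_iff₀ hc]
    rcases (norm_nonneg (Ψ p - Ψ q)).eq_or_lt with h0 | h0
    · rw [← h0]; simp
    · nlinarith
  have hLip : LipschitzWith (Real.toNNReal c⁻¹) Ψ :=
    LipschitzWith.of_dist_le_mul fun p q => by
      rw [dist_eq_norm, dist_eq_norm, Real.coe_toNNReal _ (inv_nonneg.2 hc.le)]
      exact hlip p q
  refine ⟨Ψ, _, hLip, hΨD, ?_, ?_, hpq, ?_⟩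
  · intro p hp
    have hmin : IsLocalMin (fun y => w y - ⟪p, y⟫) (Ψ p) :=
      (hΨmin p).isLocalMin (mem_interior_iff_mem_nhds.1 hp)
    have h0 := hmin.hasFDerivAt_eq_zero (hgrad p).hasFDerivAt
    simpa [sub_eq_zero] using h0
  · intro x hx
    have h1 := hvar (dw x) x hx
    have h2 := hmono _ (hΨD (dw x)) x hx
    have h3 : ⟪dw (Ψ (dw x)) - dw x, Ψ (dw x) - x⟫ ≤ 0 := by
      rw [← neg_sub x, inner_neg_right]; linarith
    have h4 : ‖Ψ (dw x) - x‖ ^ 2 ≤ 0 := by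
      by_contra hcon
      push Not at hcon
      nlinarith
    have h5 : ‖Ψ (dw x) - x‖ = 0 := by
      have := sq_nonneg ‖Ψ (dw x) - x‖
      exact pow_eq_zero_iff (two_ne_zero) |>.1 (le_antisymm h4 this)
    exact sub_eq_zero.1 (norm_eq_zero.1 h5)
  · intro p P hP
    set φ : En n → ℝ := fun q => ⟪q, Ψ q⟫ - w (Ψ q) with hφ
    have hsup : ∀ q r, ⟪q, Ψ r⟫ - w (Ψ r) ≤ φ q := by
      intro q r
      have := hΨmin q (hΨD r)
      simp only [mem_ofPred_eq] at this
      simp only [hφ]; linarith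
    have hφd : ∀ q, HasFDerivAt φ (innerSL ℝ (Ψ q)) q := by
      intro q
      rw [hasFDerivAt_iff_isLittleO]
      have hO : (fun r => φ r - φ q - innerSL ℝ (Ψ q) (r - q)) =O[nhds q] fun r => ‖r - q‖ ^ 2 := by
        refine Asymptotics.IsBigO.of_bound c⁻¹ (Filter.Eventually.of_forall fun r => ?_)
        have h1 := hsup r q
        have h2 := hsup q r
        have h3 : ⟪Ψ r - Ψ q, r - q⟫ ≤ c⁻¹ * ‖r - q‖ * ‖r - q‖ :=
          (real_inner_le_norm _ _).trans (mul_le_mul_of_nonneg_right (hlip r q) (norm_nonneg _))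
        simp only [innerSL_apply_apply, Real.norm_eq_abs, abs_pow, abs_norm]
        simp only [hφ] at h1 h2 ⊢
        simp only [inner_sub_left, inner_sub_right] at h3 ⊢
        rw [real_inner_comm r (Ψ r), real_inner_comm q (Ψ r), real_inner_comm r (Ψ q),
          real_inner_comm q (Ψ q)] at h3
        rw [real_inner_comm r (Ψ q), real_inner_comm q (Ψ q), abs_of_nonneg (by linarith)]
        nlinarith
      refine hO.trans_isLittleO ?_
      have : (fun r : En n => ‖r - q‖ ^ 2) = fun r => ‖(r - q)‖ * ‖r - q‖ := by
        ext r; ring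
      rw [this]
      have ht : Filter.Tendsto (fun r : En n => ‖r - q‖) (nhds q) (nhds 0) := by
        have : Continuous fun r : En n => ‖r - q‖ := by fun_prop
        simpa using this.tendsto q
      have := ((Asymptotics.isLittleO_one_iff ℝ).2 ht).mul_isBigO
        (Asymptotics.isBigO_refl (fun r : En n => ‖r - q‖) (nhds q))
      simpa using this
    have hφ2 : HasFDerivAt (fun q => innerSL ℝ (Ψ q)) ((innerSL ℝ (E := En n)).comp P) p :=
      (innerSL ℝ (E := En n)).hasFDerivAt.comp p hP
    intro x y
    have := second_derivative_symmetric hφd hφ2 x y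
    simp only [ContinuousLinearMap.comp_apply, innerSL_apply_apply] at this
    rw [ContinuousLinearMap.coe_coe, this, real_inner_comm]

theorem HasFDerivAt.mul_norm_sq_le_inner {n : ℕ} {Ψ : En n → En n} {P : En n →L[ℝ] En n}
    {p : En n} (hP : HasFDerivAt Ψ P p) {L : En n →ₗ[ℝ] En n} {ε : ℝ}
    (h : ∀ q, ε * ‖L (Ψ q - Ψ p)‖ ^ 2 ≤ ⟪q - p, Ψ q - Ψ p⟫) (ξ : En n) :
    ε * ‖L (P ξ)‖ ^ 2 ≤ ⟪ξ, P ξ⟫ := by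
  have hline : HasDerivAt (fun t : ℝ => p + t • ξ) ξ 0 := by
    simpa using ((hasDerivAt_id (0 : ℝ)).smul_const ξ).const_add p
  have hd : HasDerivAt (fun t : ℝ => Ψ (p + t • ξ)) (P ξ) 0 := by
    have hg' : HasFDerivAt Ψ P (p + (0 : ℝ) • ξ) := by simpa using hP
    simpa [Function.comp_def] using hg'.comp_hasDerivAt (0 : ℝ) hline
  have hlim := hd.tendsto_slope_zero_right
  have hLc : Continuous L := L.continuous_of_finiteDimensional
  have hF : Continuous fun z : En n => ⟪ξ, z⟫ - ε * ‖L z‖ ^ 2 := by fun_prop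
  have hlim2 := (hF.tendsto (P ξ)).comp hlim
  refine sub_nonneg.1 (ge_of_tendsto hlim2 ?_)
  filter_upwards [self_mem_nhdsWithin] with t ht
  have ht0 : (0 : ℝ) < t := ht
  have h1 := h (p + t • ξ)
  simp only [Function.comp, zero_add, zero_smul, add_zero, map_smul, norm_smul, inner_smul_right,
    Real.norm_eq_abs, mul_pow, abs_inv]
  rw [add_sub_cancel_left, inner_smul_left] at h1
  simp only [conj_trivial] at h1
  have h2 : t⁻¹ * ⟪ξ, Ψ (p + t • ξ) - Ψ p⟫ - ε * (t⁻¹ ^ 2 * ‖L (Ψ (p + t • ξ) - Ψ p)‖ ^ 2) =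
      t⁻¹ ^ 2 * (t * ⟪ξ, Ψ (p + t • ξ) - Ψ p⟫ - ε * ‖L (Ψ (p + t • ξ) - Ψ p)‖ ^ 2) := by
    field_simp
  have h3 : |t| = t := _root_.abs_of_pos ht0
  rw [h3, h2]
  exact mul_nonneg (by positivity) (by linarith)

theorem mem_image_gradient_of_touching {n : ℕ} {Dc Do : Set (En n)} (hDc : IsCompact Dc)
    (hDo : IsOpen Do) (hDoc : Do ⊆ Dc)
    {u w : En n → ℝ} {du dw : En n → En n} (hu : ∀ x ∈ Dc, HasGradientAt u (du x) x)
    (hwc : ∀ x ∈ Dc, ∀ y ∈ Dc, w x + ⟪dw x, y - x⟫ ≤ w y)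
    (hbdry : ∀ x ∈ Dc, x ∉ Do → w x < u x) {x : En n} (hx : x ∈ Do) (hxw : u x < w x) :
    ∃ y ∈ Do, u y < w y ∧ du y = dw x := by
  have hcont : ContinuousOn (fun y => u y - ⟪dw x, y⟫) Dc :=
    ContinuousOn.sub (fun y hy => (hu y hy).continuousAt.continuousWithinAt) (by fun_prop)
  obtain ⟨y, hy, hmin⟩ := hDc.exists_isMinOn ⟨x, hDoc hx⟩ hcont
  have h1 := hmin (hDoc hx)
  simp only [mem_ofPred_eq] at h1
  have h2 := hwc x (hDoc hx) y hy
  rw [inner_sub_right] at h2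
  have h3 : u y < w y := by linarith
  have hyo : y ∈ Do := by
    by_contra hcon
    exact absurd (hbdry y hy hcon) (not_lt.2 h3.le)
  refine ⟨y, hyo, h3, ?_⟩
  have hloc : IsLocalMin (fun y => u y - ⟪dw x, y⟫) y :=
    hmin.isLocalMin (Filter.mem_of_superset (hDo.mem_nhds hyo) hDoc)
  have hg : HasFDerivAt (fun y => u y - ⟪dw x, y⟫)
      (InnerProductSpace.toDual ℝ (En n) (du y - dw x)) y := by
    rw [map_sub]
    exact (hu y hy).hasFDerivAt.sub (innerSL ℝ (dw x)).hasFDerivAt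
  have h0 := hloc.hasFDerivAt_eq_zero hg
  simpa [sub_eq_zero] using h0

theorem not_exists_touching_of_strict {n : ℕ} (hn : 0 < n) {Dc Do : Set (En n)}
    (hDc : IsCompact Dc) (hDconv : Convex ℝ Dc) (hDo : IsOpen Do) (hDoc : Do ⊆ Dc)
    {u w : En n → ℝ} {du dv dw : En n → En n}
    (hu : ∀ x ∈ Dc, HasGradientAt u (du x) x) (hw : ∀ x ∈ Dc, HasGradientAt w (dw x) x)
    (hduc : ContinuousOn du Dc) (hdui : InjOn du Dc) (hdvi : InjOn dv Dc)
    (hdvm : ∀ x ∈ Dc, ∀ y ∈ Dc, 0 ≤ ⟪dv x - dv y, x - y⟫)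
    {L : En n →ₗ[ℝ] En n} {ε N g₁ δ a₀ a₁ : ℝ} {b : En n} (hε : 0 < ε) (hε1 : ε < 1)
    (hN : 0 ≤ N) (hδ : 0 < δ) (ha₀ : 0 < a₀)
    (hdw : ∀ x ∈ Dc, dw x = (1 - ε) • dv x + ε • (b + LinearMap.adjoint L (L x)))
    (hwc : ∀ x ∈ Dc, ∀ y ∈ Dc, w x + ⟪dw x, y - x⟫ ≤ w y)
    (hbdry : ∀ x ∈ Dc, x ∉ Do → w x < u x)
    {A Γ gv : En n → ℝ} (hAΓ : Measurable fun x => A x / Γ x) (hgvm : Measurable gv)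
    (hΓ : ∀ x ∈ Do, 0 < Γ x) (hA₀ : ∀ x ∈ Do, a₀ ≤ A x) (hA₁ : ∀ x ∈ Do, A x ≤ a₁)
    (hgv : ∀ x ∈ Do, 0 < gv x) (hgv₁ : ∀ x ∈ Do, gv x ≤ g₁)
    (hMu : ∀ s ⊆ Do, MeasurableSet s → volume (du '' s) ≤ ∫⁻ x in s, ENNReal.ofReal (A x / Γ x))
    (hMv : ∀ s ⊆ Do, MeasurableSet s → ∫⁻ x in s, ENNReal.ofReal (gv x) ≤ volume (dv '' s))
    (hstrict : ∀ x ∈ Do, ∀ y ∈ Do, u x < w x → u y < w y → du y = dw x →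
      (1 + δ) * A x ≤ Γ y * (gv x * (1 + ε * N)))
    (hL : g₁ * (N + 1) ^ n ≤ LinearMap.det L ^ 2) :
    ∀ x ∈ Do, w x ≤ u x := by
  intro x₁ hx₁
  by_contra hx₁w
  push Not at hx₁w
  have hg₁ : 0 < g₁ := (hgv _ hx₁).trans_le (hgv₁ _ hx₁)
  have hdL : LinearMap.det L ≠ 0 := by
    intro h
    rw [h] at hL
    have : 0 < g₁ * (N + 1) ^ n := mul_pos hg₁ (by positivity)
    simp at hL; linarith
  have hne : Dc.Nonempty := ⟨x₁, hDoc hx₁⟩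
  have hkey : ∀ x ∈ Dc, ∀ y ∈ Dc, ε * ‖L (x - y)‖ ^ 2 ≤ ⟪dw x - dw y, x - y⟫ := by
    intro x hx y hy
    have h1 : dw x - dw y = (1 - ε) • (dv x - dv y) + ε • LinearMap.adjoint L (L (x - y)) := by
      rw [hdw x hx, hdw y hy, map_sub, map_sub]; module
    rw [h1, inner_add_left, inner_smul_left, inner_smul_left, LinearMap.adjoint_inner_left,
      real_inner_self_eq_norm_sq]
    have := mul_nonneg (by linarith : 0 ≤ 1 - ε) (hdvm x hx y hy)
    simp only [conj_trivial]
    linarith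
  obtain ⟨c, hc, hcL⟩ : ∃ c : ℝ, 0 < c ∧ ∀ x, c * ‖x‖ ≤ ‖L x‖ := by
    set e := LinearEquiv.ofIsUnitDet (f := L) (v := (EuclideanSpace.basisFun (Fin n) ℝ).toBasis)
      (v' := (EuclideanSpace.basisFun (Fin n) ℝ).toBasis)
      (by rw [LinearMap.det_toMatrix]; exact hdL.isUnit)
    set e' := e.toContinuousLinearEquiv
    refine ⟨(‖(e'.symm : En n →L[ℝ] En n)‖ + 1)⁻¹, by positivity, fun x => ?_⟩
    rw [inv_mul_le_iff₀ (by positivity)]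
    have h1 : e'.symm (L x) = x := e'.symm_apply_apply x
    have h2 := (e'.symm : En n →L[ℝ] En n).le_opNorm (L x)
    rw [ContinuousLinearEquiv.coe_coe, h1] at h2
    nlinarith [norm_nonneg (L x)]
  obtain ⟨Ψ, K, hΨL, hΨD, hΨi, hΨr, hΨm, hΨs⟩ := exists_inverse_gradient hDc hne hDconv hw
    (c := ε * c ^ 2) (by positivity) (fun x hx y hy => by
      refine le_trans ?_ (hkey x hx y hy)
      rw [mul_assoc, ← mul_pow]
      have := hcL (x - y)
      gcongr)
  set O := {x ∈ Do | u x < w x} with hOdef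
  have hODo : O ⊆ Do := fun x hx => hx.1
  have hOo : IsOpen O := by
    rw [isOpen_iff_mem_nhds]
    rintro x ⟨hx, hxw⟩
    filter_upwards [hDo.mem_nhds hx, (hu x (hDoc hx)).continuousAt.eventually_lt
      (hw x (hDoc hx)).continuousAt hxw] with y hy hyw using ⟨hy, hyw⟩
  have hDoi : Do ⊆ interior Dc := interior_maximal hDoc hDo
  set W := Ψ ⁻¹' O with hWdef
  have hWo : IsOpen W := hOo.preimage hΨL.continuous
  have hWdw : ∀ p ∈ W, dw (Ψ p) = p := fun p hp => hΨi p (hDoi (hODo hp))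
  have hΨinj : InjOn Ψ W := fun p hp q hq h => by rw [← hWdw p hp, ← hWdw q hq, h]
  have hΨW : Ψ '' W = O := by
    ext x
    constructor
    · rintro ⟨p, hp, rfl⟩; exact hp
    · intro hx
      have := hΨr x (hDoc (hODo hx))
      exact ⟨dw x, by rw [hWdef, mem_preimage, this]; exact hx, this⟩
  have hWu : W ⊆ du '' O := by
    intro p hp
    obtain ⟨y, hy, hyw, hyp⟩ := mem_image_gradient_of_touching hDc hDo hDoc hu hwc hbdry
      (hODo hp) hp.2
    exact ⟨y, ⟨hy, hyw⟩, by rw [hyp, hWdw p hp]⟩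
  set X := Function.invFunOn du O with hX
  set φ : En n → ℝ≥0∞ := fun p => ENNReal.ofReal (Γ (X p)) with hφ
  have hXu : ∀ x ∈ O, X (du x) = x := fun x hx => by
    have hm : du x ∈ du '' O := ⟨x, hx, rfl⟩
    exact hdui (hDoc (hODo (Function.invFunOn_mem hm))) (hDoc (hODo hx))
      (Function.invFunOn_eq hm)
  set I : ℝ≥0∞ := ∫⁻ x in O, ENNReal.ofReal (A x) with hI
  have hDovol : volume O < ∞ := (measure_mono (hODo.trans hDoc)).trans_lt hDc.measure_lt_top
  have hIfin : I ≠ ∞ := by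
    refine ne_top_of_le_ne_top ?_ (setLIntegral_mono' (g := fun _ => ENNReal.ofReal a₁)
      hOo.measurableSet fun x hx => ENNReal.ofReal_le_ofReal (hA₁ x (hODo hx)))
    rw [setLIntegral_const]
    exact ENNReal.mul_ne_top ENNReal.ofReal_ne_top hDovol.ne
  have hIpos : I ≠ 0 := by
    have hO0 : volume O ≠ 0 := (hOo.measure_pos volume ⟨x₁, hx₁, hx₁w⟩).ne'
    have h1 : ENNReal.ofReal a₀ * volume O ≤ I := by
      rw [← setLIntegral_const]
      exact setLIntegral_mono' hOo.measurableSet fun x hx =>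
        ENNReal.ofReal_le_ofReal (hA₀ x (hODo hx))
    intro h0
    rw [h0] at h1
    have := mul_ne_zero (ENNReal.ofReal_pos.2 ha₀).ne' hO0
    exact this (le_antisymm h1 (zero_le))
  -- upper bound coming from the supersolution
  have hupper : ∫⁻ p in W, φ p ≤ I := by
    set O₂ := O ∩ du ⁻¹' W
    have hO₂ : IsOpen O₂ := (hduc.mono (hODo.trans hDoc)).isOpen_inter_preimage hOo hWo
    have hO₂W : du '' O₂ = W := by
      rw [image_inter_preimage, inter_eq_right.2 hWu]
    have hO₂O : O₂ ⊆ O := inter_subset_left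
    calc ∫⁻ p in W, φ p = ∫⁻ p in du '' O₂, φ p := by rw [hO₂W]
      _ ≤ ∫⁻ x in O₂, ENNReal.ofReal (A x / Γ x) * φ (du x) :=
        lintegral_image_invFunOn_le hO₂.measurableSet
          (hduc.mono (hO₂O.trans (hODo.trans hDoc))) (hdui.mono (hO₂O.trans (hODo.trans hDoc)))
          hAΓ.ennreal_ofReal (fun s hs hsm => hMu s (hs.trans (hO₂O.trans hODo)) hsm) φ
      _ = ∫⁻ x in O₂, ENNReal.ofReal (A x) := by
        refine setLIntegral_congr_fun hO₂.measurableSet fun x hx => ?_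
        have hxΓ := hΓ x (hODo (hO₂O hx))
        simp only [hφ, hXu x (hO₂O hx)]
        rw [← ENNReal.ofReal_mul' hxΓ.le, div_mul_cancel₀ _ hxΓ.ne']
      _ ≤ I := lintegral_mono_set hO₂O
  -- the change of variables `x = Ψ p`
  set W' := W ∩ {p | DifferentiableAt ℝ Ψ p} with hW'def
  have hW'm : MeasurableSet W' := hWo.measurableSet.inter (measurableSet_of_differentiableAt ℝ Ψ)
  have hW'W : W' ⊆ W := inter_subset_left
  set P := fderiv ℝ Ψ with hP
  have hPd : ∀ p ∈ W', HasFDerivAt Ψ (P p) p := fun p hp => DifferentiableAt.hasFDerivAt hp.2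
  have hchange : I = ∫⁻ p in W', ENNReal.ofReal |(P p).det| * ENNReal.ofReal (A (Ψ p)) := by
    rw [← lintegral_image_eq_lintegral_abs_det_fderiv_mul volume hW'm
      (fun p hp => (hPd p hp).hasFDerivWithinAt) (hΨinj.mono hW'W) fun x => ENNReal.ofReal (A x)]
    refine setLIntegral_congr ?_
    have hnull : volume (Ψ '' (W \ W')) = 0 := by
      refine hΨL.volume_image_null (measure_mono_null ?_ (ae_iff.1 hΨL.ae_differentiableAt))
      rintro p ⟨hp, hp'⟩ hd
      exact hp' ⟨hp, hd⟩
    have hunion : O = Ψ '' W' ∪ Ψ '' (W \ W') := by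
      rw [← image_union, union_sdiff_cancel hW'W, hΨW]
    rw [hunion]
    exact union_ae_eq_left_of_ae_eq_empty (ae_eq_empty.2 hnull)
  -- lower bound coming from the subsolution
  set R' : En n → En n →L[ℝ] En n := fun p => (1 - ε)⁻¹ • (ContinuousLinearMap.id ℝ (En n) -
    ε • ((LinearMap.toContinuousLinearMap (LinearMap.adjoint L ∘ₗ L)).comp (P p))) with hR'
  have hε1' : 1 - ε ≠ 0 := by linarith
  have hR : ∀ p ∈ W', HasFDerivWithinAt (dv ∘ Ψ) (R' p) W' p := by
    intro p hp
    have h1 : HasFDerivAt (fun q => (1 - ε)⁻¹ • (q - ε • (b +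
        (LinearMap.toContinuousLinearMap (LinearMap.adjoint L ∘ₗ L)) (Ψ q)))) (R' p) p :=
      HasFDerivAt.const_smul (c := (1 - ε)⁻¹) ((hasFDerivAt_id p).sub ((((LinearMap.toContinuousLinearMap
        (LinearMap.adjoint L ∘ₗ L)).hasFDerivAt.comp p (hPd p hp)).const_add b).const_smul
          ε))
    have heq : ∀ q ∈ W', (dv ∘ Ψ) q = (1 - ε)⁻¹ • (q - ε • (b +
        (LinearMap.toContinuousLinearMap (LinearMap.adjoint L ∘ₗ L)) (Ψ q))) := by
      intro q hq
      have h2 := hdw (Ψ q) (hΨD q)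
      rw [hWdw q (hW'W hq)] at h2
      rw [eq_inv_smul_iff₀ hε1']
      nth_rewrite 2 [h2]
      simp
    exact h1.hasFDerivWithinAt.congr heq (heq p hp)
  have hdvΨ : InjOn (dv ∘ Ψ) W' :=
    hdvi.comp (hΨinj.mono hW'W) fun p _ => hΨD p
  have hPm : Measurable fun p => ENNReal.ofReal |(P p).det| :=
    (ContinuousLinearMap.continuous_det.measurable.comp (measurable_fderiv ℝ Ψ)).abs.ennreal_ofReal
  have hae : ∀ᵐ p ∂(volume.restrict W'),
      ENNReal.ofReal |(P p).det| * ENNReal.ofReal (gv (Ψ p)) ≤ ENNReal.ofReal |(R' p).det| := by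
    refine ae_le_of_forall_setLIntegral_le_of_sigmaFinite
      (hPm.mul (hgvm.comp hΨL.continuous.measurable).ennreal_ofReal) ?_
    intro s hs _
    rw [Measure.restrict_restrict hs]
    have hsm := hs.inter hW'm
    have hsW : s ∩ W' ⊆ W' := inter_subset_right
    rw [← lintegral_image_eq_lintegral_abs_det_fderiv_mul volume hsm
      (fun p hp => (hPd p (hsW hp)).hasFDerivWithinAt) (hΨinj.mono (hsW.trans hW'W))
      fun x => ENNReal.ofReal (gv x),
      lintegral_abs_det_fderiv_eq_addHaar_image volume hsm
      (fun p hp => (hR p (hsW hp)).mono hsW) (hdvΨ.mono hsW), image_comp]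
    refine hMv _ ?_ (hsm.image_of_continuousOn_injOn hΨL.continuous.continuousOn
      (hΨinj.mono (hsW.trans hW'W)))
    rintro _ ⟨p, hp, rfl⟩
    exact hODo (hW'W (hsW hp))
  have hfinal : ENNReal.ofReal (1 + δ) * I ≤ I := by
    calc ENNReal.ofReal (1 + δ) * I
        = ∫⁻ p in W', ENNReal.ofReal (1 + δ) *
            (ENNReal.ofReal |(P p).det| * ENNReal.ofReal (A (Ψ p))) := by
          rw [lintegral_const_mul' _ _ ENNReal.ofReal_ne_top, ← hchange]
      _ ≤ ∫⁻ p in W', φ p := by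
          refine lintegral_mono_ae ?_
          filter_upwards [hae, ae_restrict_mem hW'm] with p hp hpW'
          have hpO : Ψ p ∈ O := hW'W hpW'
          have hΨDo := hODo hpO
          have hgp := hgv _ hΨDo
          have hb := det_concavity_bound hn (hΨs p (P p) (hPd p hpW')) (L := L) (g₁ := g₁)
            hε hε1 hgp (hgv₁ _ hΨDo) hN
            ((hPd p hpW').mul_norm_sq_le_inner fun q =>
              (hkey _ (hΨD q) _ (hΨD p)).trans (hΨm q p)) hL
            (by
              rw [← ENNReal.ofReal_mul (abs_nonneg _), ENNReal.ofReal_le_ofReal_iff (abs_nonneg _)]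
                at hp
              rw [mul_comm]
              exact hp)
          obtain ⟨y, hy, hyp⟩ := hWu (hW'W hpW')
          have hXp : X p = y := by rw [← hyp, hXu y hy]
          have hs := hstrict _ hΨDo y (hODo hy) hpO.2 hy.2 (by rw [hWdw p (hW'W hpW'), hyp])
          simp only [hφ, hXp]
          rw [← ENNReal.ofReal_mul (abs_nonneg _), ← ENNReal.ofReal_mul (by linarith)]
          refine ENNReal.ofReal_le_ofReal ?_
          have hΓy := hΓ y (hODo hy)
          calc (1 + δ) * (|(P p).det| * A (Ψ p)) = |(P p).det| * ((1 + δ) * A (Ψ p)) := by ring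
            _ ≤ |(P p).det| * (Γ y * (gv (Ψ p) * (1 + ε * N))) := by gcongr
            _ = Γ y * (|(P p).det| * gv (Ψ p) * (1 + ε * N)) := by ring
            _ ≤ Γ y * 1 := mul_le_mul_of_nonneg_left hb hΓy.le
            _ = Γ y := mul_one _
      _ ≤ ∫⁻ p in W, φ p := lintegral_mono_set hW'W
      _ ≤ I := hupper
  have h1 : ENNReal.ofReal (1 + δ) * I ≤ 1 * I := by rwa [one_mul]
  rw [ENNReal.mul_le_mul_iff_left hIpos hIfin] at h1
  have h2 : (1 : ℝ≥0∞) < ENNReal.ofReal (1 + δ) := by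
    rw [← ENNReal.ofReal_one]
    exact (ENNReal.ofReal_lt_ofReal_iff (by linarith)).2 (by linarith)
  exact absurd h1 (not_le.2 h2)

theorem exists_frame_of_isCompact {n : ℕ} {D : Set (En n)} (hD : IsCompact D) {x₀ : En n} {r : ℝ}
    (hr : 0 < r) (hball : Metric.ball x₀ r ⊆ D) :
    ∃ X : En n ≃ₗ[ℝ] En n, (∀ i, x₀ + X (EuclideanSpace.single i 1) ∈ D) ∧
      ∀ x ∈ D, ∀ i, |X.symm (x - x₀) i| ≤ 1 := by
  set M : (Fin n → En n) → Matrix (Fin n) (Fin n) ℝ :=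
    fun p => Matrix.of fun j i => p i j - x₀ j with hM
  have hMc : Continuous fun p => |(M p).det| := by
    refine (Continuous.matrix_det ?_).abs
    refine continuous_matrix fun j i => ?_
    simp only [hM, Matrix.of_apply]
    fun_prop
  have hx₀ : x₀ ∈ D := hball (Metric.mem_ball_self hr)
  obtain ⟨p, hp, hmax⟩ := (isCompact_univ_pi fun _ : Fin n => hD).exists_isMaxOn
    ⟨fun _ => x₀, fun _ _ => hx₀⟩ hMc.continuousOn
  have hpD : ∀ i, p i ∈ D := fun i => hp i (mem_univ i)
  have hdet : 0 < |(M p).det| := by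
    have hq : (fun i => x₀ + (r / 2) • EuclideanSpace.single i (1 : ℝ)) ∈
        univ.pi fun _ : Fin n => D := by
      intro i _
      refine hball ?_
      simp [norm_smul, abs_of_pos hr, hr]
    have h1 := hmax hq
    simp only [mem_ofPred_eq] at h1
    refine lt_of_lt_of_le ?_ h1
    have h2 : M (fun i => x₀ + (r / 2) • EuclideanSpace.single i (1 : ℝ)) =
        (r / 2) • (1 : Matrix (Fin n) (Fin n) ℝ) := by
      ext j i
      simp [hM, Matrix.one_apply]
    rw [h2, Matrix.det_smul, Matrix.det_one]
    positivity
  have hdet0 : (M p).det ≠ 0 := abs_pos.1 hdet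
  have hdetX : LinearMap.det (Matrix.toLpLin 2 2 (M p)) ≠ 0 := by
    rwa [LinearMap.det_toLpLin]
  refine ⟨LinearMap.equivOfDetNeZero _ hdetX, fun i => ?_, fun x hx i => ?_⟩
  · have : x₀ + (LinearMap.equivOfDetNeZero _ hdetX) (EuclideanSpace.single i 1) = p i := by
      ext j
      simp [LinearMap.equivOfDetNeZero, hM, Matrix.toLpLin_apply]
    rw [this]; exact hpD i
  · set c : En n := WithLp.toLp 2 ((M p).det⁻¹ • (M p).cramer (fun j => x j - x₀ j)) with hc
    have hXc : (LinearMap.equivOfDetNeZero _ hdetX) c = x - x₀ := by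
      ext j
      simp only [LinearMap.equivOfDetNeZero, LinearEquiv.ofIsUnitDet_apply, hc,
        Matrix.toLpLin_apply, Matrix.mulVec_smul, Matrix.mulVec_cramer, smul_smul,
        inv_mul_cancel₀ hdet0]
      simp
    rw [← hXc, LinearEquiv.symm_apply_apply]
    simp only [hc, Pi.smul_apply, smul_eq_mul, Matrix.cramer_apply, abs_mul, abs_inv]
    rw [inv_mul_le_iff₀ hdet, mul_one]
    have h3 : (M p).updateCol i (fun j => x j - x₀ j) = M (Function.update p i x) := by
      ext j k
      by_cases hk : k = i
      · subst hk; simp [hM]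
      · simp [hM, hk]
    rw [h3]
    refine hmax (a := Function.update p i x) fun k _ => ?_
    by_cases hk : k = i
    · subst hk; simpa using hx
    · simpa [hk] using hpD k

theorem Convex.add_map_mem_of_sum_le_one {n : ℕ} {D : Set (En n)} (hD : Convex ℝ D) {x₀ : En n}
    (hx₀ : x₀ ∈ D) {X : En n →ₗ[ℝ] En n} (hX : ∀ i, x₀ + X (EuclideanSpace.single i 1) ∈ D)
    {c : En n} (hc : ∀ i, 0 ≤ c i) (hc1 : ∑ i, c i ≤ 1) : x₀ + X c ∈ D := by
  have h1 := hD.sum_mem (t := Finset.univ)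
    (w := fun o : Option (Fin n) => o.elim (1 - ∑ i, c i) c)
    (z := fun o => o.elim x₀ fun i => x₀ + X (EuclideanSpace.single i 1))
    (by rintro (_ | i) _
        · simpa using hc1
        · exact hc i)
    (by simp [Fintype.sum_option])
    (by rintro (_ | i) _
        · exact hx₀
        · exact hX i)
  convert h1 using 1
  have h2 : c = ∑ i, c i • EuclideanSpace.single i (1 : ℝ) := by
    ext j
    simp [Pi.single_apply]
  simp only [Fintype.sum_option, Option.elim_none, Option.elim_some, smul_add,
    Finset.sum_add_distrib, ← Finset.sum_smul]
  conv_lhs => rw [h2, map_sum]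
  simp only [map_smul]
  module

theorem mul_det_sq_le_of_section {n : ℕ} (hn : 0 < n) {D : Set (En n)} (hD : Convex ℝ D)
    {x₀ : En n} (hx₀ : x₀ ∈ D) {X : En n ≃ₗ[ℝ] En n}
    (hX : ∀ i, x₀ + X (EuclideanSpace.single i 1) ∈ D)
    {V : En n → ℝ} {dv : En n → En n} {p₀ : En n} {t g₀ : ℝ} (ht : 0 < t) (hg₀ : 0 < g₀)
    (hV : ∀ x ∈ D, ∀ y ∈ D, V x + ⟪dv x - p₀, y - x⟫ ≤ V y)
    (hV0 : ∀ x ∈ D, 0 ≤ V x) (hVt : ∀ x ∈ D, V x ≤ t)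
    (hvol : ∀ s ⊆ D, MeasurableSet s → ENNReal.ofReal g₀ * volume s ≤ volume (dv '' s)) :
    g₀ * LinearMap.det (X : En n →ₗ[ℝ] En n) ^ 2 ≤ (32 * (n : ℝ) ^ 3 * t) ^ n := by
  have hn' : (0 : ℝ) < n := by exact_mod_cast hn
  have hn1 : (1 : ℝ) ≤ n := by exact_mod_cast hn
  have : Nonempty (Fin n) := ⟨⟨0, hn⟩⟩
  set Xl : En n →ₗ[ℝ] En n := (X : En n →ₗ[ℝ] En n) with hXl
  have hdet : LinearMap.det Xl ≠ 0 := (LinearEquiv.isUnit_det' X).ne_zero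
  have hdets : LinearMap.det (X.symm : En n →ₗ[ℝ] En n) = (LinearMap.det Xl)⁻¹ :=
    eq_inv_of_mul_eq_one_left (LinearEquiv.det_symm_mul_det X)
  set d := |LinearMap.det Xl| with hd
  have hd0 : 0 < d := abs_pos.2 hdet
  set c₀ : En n := WithLp.toLp 2 fun _ => 3 / (8 * (n : ℝ)) with hc₀
  set T : Set (En n) := (fun x => x + -x₀) ⁻¹'
    ((X.symm : En n →ₗ[ℝ] En n) ⁻¹' Metric.ball c₀ (1 / (8 * n))) with hT
  have hTm : MeasurableSet T := by
    refine (IsOpen.preimage (by fun_prop) (IsOpen.preimage ?_ Metric.isOpen_ball)).measurableSet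
    exact LinearMap.continuous_of_finiteDimensional _
  have hTc : ∀ x ∈ T, ∃ c : En n, x = x₀ + X c ∧ ∀ i, 1 / (4 * (n : ℝ)) ≤ c i ∧
      c i ≤ 1 / (2 * n) := by
    intro x hx
    refine ⟨X.symm (x + -x₀), by rw [LinearEquiv.apply_symm_apply]; abel, fun i => ?_⟩
    have h1 : ‖X.symm (x + -x₀) - c₀‖ < 1 / (8 * n) := by
      rw [← dist_eq_norm]; exact hx
    have h2 := (PiLp.norm_apply_le (X.symm (x + -x₀) - c₀) i).trans h1.le
    rw [Real.norm_eq_abs, abs_le] at h2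
    simp only [PiLp.sub_apply, hc₀] at h2
    have e1 : 1 / (4 * (n : ℝ)) = 3 / (8 * n) - 1 / (8 * n) := by field_simp; norm_num
    have e2 : 1 / (2 * (n : ℝ)) = 3 / (8 * n) + 1 / (8 * n) := by field_simp; norm_num
    rw [e1, e2]
    constructor <;> linarith
  have hTD : T ⊆ D := by
    intro x hx
    obtain ⟨c, rfl, hc⟩ := hTc x hx
    refine hD.add_map_mem_of_sum_le_one hx₀ (X := Xl) hX
      (fun i => le_trans (by positivity) (hc i).1) ?_
    calc ∑ i, c i ≤ ∑ _i : Fin n, 1 / (2 * (n : ℝ)) := Finset.sum_le_sum fun i _ => (hc i).2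
      _ = 1 / 2 := by simp; field_simp
      _ ≤ 1 := by norm_num
  set R : ℝ := 4 * n ^ 2 * t with hR
  set Xa := LinearMap.adjoint Xl with hXa
  have hdXa : LinearMap.det Xa = LinearMap.det Xl := det_adjoint_real Xl
  have himage : dv '' T ⊆ (fun p => p + -p₀) ⁻¹' (Xa ⁻¹' Metric.closedBall 0 R) := by
    rintro _ ⟨x, hx, rfl⟩
    have hxD := hTD hx
    obtain ⟨c, hxc, hc⟩ := hTc x hx
    simp only [mem_preimage, mem_closedBall_zero_iff]
    set p := dv x + -p₀ with hp
    have hcoord : ∀ i, |(Xa p) i| ≤ 4 * n * t := by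
      intro i
      have hXi : (Xa p) i = ⟪p, X (EuclideanSpace.single i 1)⟫ := by
        have := LinearMap.adjoint_inner_left Xl (EuclideanSpace.single i (1 : ℝ)) p
        rw [← hXa] at this
        rw [EuclideanSpace.inner_single_right] at this
        simpa [hXl] using this
      have hstep : ∀ τ : ℝ, |τ| = 1 / (4 * n) →
          τ * ⟪p, X (EuclideanSpace.single i 1)⟫ ≤ t := by
        intro τ hτ
        have hτ' := abs_le.1 hτ.le
        have hmem : x + τ • X (EuclideanSpace.single i 1) ∈ D := by
          have := hD.add_map_mem_of_sum_le_one hx₀ (X := Xl) hX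
            (c := c + τ • EuclideanSpace.single i (1 : ℝ)) (fun j => by
              have := (hc j).1
              by_cases hj : j = i
              · subst hj; simp; linarith
              · simp [hj]; exact le_trans (by positivity) this) (by
              have h1 : ∑ j, c j ≤ 1 / 2 := by
                calc ∑ i, c i ≤ ∑ _i : Fin n, 1 / (2 * (n : ℝ)) :=
                      Finset.sum_le_sum fun i _ => (hc i).2
                  _ = 1 / 2 := by simp; field_simp
              have h2 : 1 / (4 * (n : ℝ)) ≤ 1 / 4 := by
                apply one_div_le_one_div_of_le <;> linarith
              simp [Finset.sum_add_distrib]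
              linarith [hτ'.2])
          rw [map_add, map_smul, ← add_assoc] at this
          rw [hxc]; exact this
        have h1 := hV x hxD _ hmem
        rw [add_sub_cancel_left, inner_smul_right] at h1
        have h2 := hV0 x hxD
        have h3 := hVt _ hmem
        rw [hp, ← sub_eq_add_neg]
        linarith
      have hpos : (0 : ℝ) < 1 / (4 * n) := by positivity
      have h1 := hstep (1 / (4 * n)) (_root_.abs_of_pos hpos)
      have h2 := hstep (-(1 / (4 * n))) (by rw [abs_neg, _root_.abs_of_pos hpos])
      have e : t = 1 / (4 * n) * (4 * n * t) := by field_simp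
      rw [hXi, abs_le]
      rw [e, neg_mul, ← mul_neg] at h2
      rw [e] at h1
      have h1' := le_of_mul_le_mul_left h1 hpos
      have h2' := le_of_mul_le_mul_left h2 hpos
      constructor <;> linarith
    rw [EuclideanSpace.norm_eq]
    refine Real.sqrt_le_iff.2 ⟨by positivity, ?_⟩
    calc ∑ i, ‖(Xa p) i‖ ^ 2 ≤ ∑ _i : Fin n, (4 * n * t) ^ 2 := Finset.sum_le_sum fun i _ => by
          rw [Real.norm_eq_abs]
          have := hcoord i
          gcongr
      _ = n * (4 * n * t) ^ 2 := by simp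
      _ ≤ R ^ 2 := by
        rw [hR]
        have : (4 * (n : ℝ) ^ 2 * t) ^ 2 = n * (n * (4 * n * t) ^ 2) := by ring
        rw [this]
        have h0 : (0 : ℝ) ≤ n * (4 * n * t) ^ 2 := by positivity
        nlinarith
  set ω := volume (Metric.ball (0 : En n) 1) with hω
  have hω0 : ω ≠ 0 := (Metric.measure_ball_pos volume _ one_pos).ne'
  have hωt : ω ≠ ∞ := measure_ball_lt_top.ne
  have hTv : volume T = ENNReal.ofReal d * (ENNReal.ofReal ((1 / (8 * n)) ^ n) * ω) := by
    rw [hT, measure_preimage_add_right, Measure.addHaar_preimage_linearMap _ (by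
      rw [hdets]; exact inv_ne_zero hdet), hdets, inv_inv,
      Measure.addHaar_ball _ _ (by positivity), finrank_euclideanSpace_fin]
  have hIv : volume (dv '' T) ≤ ENNReal.ofReal d⁻¹ * (ENNReal.ofReal (R ^ n) * ω) := by
    refine (measure_mono himage).trans_eq ?_
    rw [measure_preimage_add_right, Measure.addHaar_preimage_linearMap _ (by rwa [hdXa]), hdXa,
      abs_inv, Measure.addHaar_closedBall _ _ (by positivity), finrank_euclideanSpace_fin]
  have hmain := (hvol T hTD hTm).trans hIv
  rw [hTv, ← mul_assoc, ← mul_assoc, ← mul_assoc, ENNReal.mul_le_mul_iff_left hω0 hωt,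
    ← ENNReal.ofReal_mul hg₀.le, ← ENNReal.ofReal_mul (by positivity),
    ← ENNReal.ofReal_mul (by positivity), ENNReal.ofReal_le_ofReal_iff (by positivity)] at hmain
  have hpos : (0 : ℝ) < d * (8 * n) ^ n := by positivity
  have h := mul_le_mul_of_nonneg_right hmain hpos.le
  calc g₀ * LinearMap.det Xl ^ 2 = g₀ * d ^ 2 := by rw [hd, sq_abs]
    _ = g₀ * d * (1 / (8 * n)) ^ n * (d * (8 * n) ^ n) := by
      rw [one_div, inv_pow]; field_simp
    _ ≤ d⁻¹ * R ^ n * (d * (8 * n) ^ n) := h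
    _ = (R * (8 * n)) ^ n := by
      have e : d⁻¹ * d = 1 := inv_mul_cancel₀ hd0.ne'
      rw [mul_pow R]
      linear_combination (R ^ n * (8 * (n : ℝ)) ^ n) * e
    _ = (32 * (n : ℝ) ^ 3 * t) ^ n := by
      have e : R * (8 * n) = 32 * (n : ℝ) ^ 3 * t := by rw [hR]; ring
      rw [e]

theorem exists_linearMap_norm_sq_eq {n : ℕ} (X : En n ≃ₗ[ℝ] En n) {p : En n} {s α k : ℝ}
    (hs : 0 < s) (hα : 0 ≤ α)
    (hsp : ‖LinearMap.adjoint (X : En n →ₗ[ℝ] En n) p‖ = s) :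
    ∃ L : En n →ₗ[ℝ] En n,
      (∀ z, ‖L z‖ ^ 2 = α * (‖X.symm z‖ ^ 2 + (k ^ 2 - 1) * (⟪p, z⟫ / s) ^ 2)) ∧
      (∀ z y, ⟪L z, L y⟫ =
        α * (⟪X.symm z, X.symm y⟫ + (k ^ 2 - 1) * (⟪p, z⟫ / s) * (⟪p, y⟫ / s))) ∧
      LinearMap.det L ^ 2 * LinearMap.det (X : En n →ₗ[ℝ] En n) ^ 2 = α ^ n * k ^ 2 := by
  set e : En n := s⁻¹ • LinearMap.adjoint (X : En n →ₗ[ℝ] En n) p with he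
  have hee : ⟪e, e⟫ = (1 : ℝ) := by
    rw [real_inner_self_eq_norm_sq, he, norm_smul, hsp, norm_inv, Real.norm_eq_abs,
      _root_.abs_of_pos hs, inv_mul_cancel₀ hs.ne', one_pow]
  have hez : ∀ z, ⟪e, X.symm z⟫ = ⟪p, z⟫ / s := by
    intro z
    rw [he, inner_smul_left, LinearMap.adjoint_inner_left]
    simp only [conj_trivial, LinearEquiv.coe_coe, LinearEquiv.apply_symm_apply]
    rw [div_eq_inv_mul]
  set E : En n →ₗ[ℝ] En n :=
    LinearMap.transvection ((innerSL ℝ e : En n →L[ℝ] ℝ) : En n →ₗ[ℝ] ℝ) ((k - 1) • e) with hE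
  have hEz : ∀ z, E z = z + ⟪e, z⟫ • (k - 1) • e := fun z => by
    simp [hE, LinearMap.transvection.apply]
  have hin : ∀ z y, ⟪(√α • (E ∘ₗ (X.symm : En n →ₗ[ℝ] En n))) z,
      (√α • (E ∘ₗ (X.symm : En n →ₗ[ℝ] En n))) y⟫ =
        α * (⟪X.symm z, X.symm y⟫ + (k ^ 2 - 1) * (⟪p, z⟫ / s) * (⟪p, y⟫ / s)) := by
    intro z y
    simp only [LinearMap.smul_apply, LinearMap.comp_apply, LinearEquiv.coe_coe, hEz,
      inner_smul_left, inner_smul_right, inner_add_left, inner_add_right, conj_trivial, hee]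
    rw [real_inner_comm e (X.symm z), hez, hez]
    have := Real.mul_self_sqrt hα
    linear_combination (⟪X.symm z, X.symm y⟫ + (k ^ 2 - 1) * (⟪p, z⟫ / s) * (⟪p, y⟫ / s)) * this
  refine ⟨√α • (E ∘ₗ (X.symm : En n →ₗ[ℝ] En n)), fun z => ?_, hin, ?_⟩
  · rw [← real_inner_self_eq_norm_sq, hin, real_inner_self_eq_norm_sq]; ring
  · have h1 : LinearMap.det E = k := by
      rw [hE, LinearMap.transvection.det]
      simp only [ContinuousLinearMap.coe_coe, innerSL_apply_apply, inner_smul_right, hee]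
      ring
    have h2 := LinearEquiv.det_symm_mul_det X
    rw [LinearMap.det_smul, LinearMap.det_comp, h1, finrank_euclideanSpace_fin]
    have h3 : (√α ^ n) ^ 2 = α ^ n := by rw [← pow_mul, mul_comm, pow_mul, Real.sq_sqrt hα]
    set d := LinearMap.det (X : En n →ₗ[ℝ] En n)
    set d' := LinearMap.det (X.symm : En n →ₗ[ℝ] En n)
    calc (√α ^ n * (k * d')) ^ 2 * d ^ 2 = (√α ^ n) ^ 2 * k ^ 2 * (d' * d) ^ 2 := by ring
      _ = α ^ n * k ^ 2 := by rw [h2, h3]; ring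

theorem exists_section_barrier {n : ℕ} (hn : 0 < n) {D : Set (En n)} (hDc : IsCompact D)
    (hD : Convex ℝ D) {x₀ : En n} {V : En n → ℝ} {dv : En n → En n} {p₀ p : En n}
    {t g₀ M H : ℝ} (ht : 0 < t) (hg₀ : 0 < g₀) (hM : 0 < M) (hH : 1 ≤ H)
    (hball : Metric.ball x₀ (t / M) ⊆ D)
    (hV : ∀ x ∈ D, ∀ y ∈ D, V x + ⟪dv x - p₀, y - x⟫ ≤ V y)
    (hV0 : ∀ x ∈ D, 0 ≤ V x) (hVt : ∀ x ∈ D, V x ≤ t)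
    (hvol : ∀ s ⊆ D, MeasurableSet s → ENNReal.ofReal g₀ * volume s ≤ volume (dv '' s))
    (hz : ∃ z ∈ D, H * t ≤ ⟪p, z - x₀⟫) :
    ∃ (L : En n →ₗ[ℝ] En n) (a : ℝ), t ≤ a ∧
      (∀ x ∈ D, |⟪p, x - x₀⟫| ≤ a) ∧
      (∀ x ∈ D, ‖L (x - x₀)‖ ^ 2 ≤ t / 4 + ⟪p, x - x₀⟫ ^ 2 / (2 * a)) ∧
      (∀ x ∈ D, ‖LinearMap.adjoint L (L (x - x₀))‖ ≤ M / 2 + ‖p‖ / 2) ∧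
      g₀ * H / (128 * (n : ℝ) ^ 4) ^ n ≤ LinearMap.det L ^ 2 := by
  have hn' : (0 : ℝ) < n := by exact_mod_cast hn
  have hr : 0 < t / M := by positivity
  have hx₀ : x₀ ∈ D := hball (Metric.mem_ball_self hr)
  obtain ⟨X, hXD, hX⟩ := exists_frame_of_isCompact hDc hr hball
  have hdet := mul_det_sq_le_of_section hn hD hx₀ hXD ht hg₀ hV hV0 hVt hvol
  have hYn : ∀ x ∈ D, ‖X.symm (x - x₀)‖ ≤ √n := by
    intro x hx
    rw [EuclideanSpace.norm_eq]
    refine Real.sqrt_le_sqrt ?_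
    calc ∑ i, ‖(X.symm (x - x₀)) i‖ ^ 2 ≤ ∑ _i : Fin n, (1 : ℝ) := Finset.sum_le_sum fun i _ => by
          rw [Real.norm_eq_abs]
          exact pow_le_one₀ (abs_nonneg _) (hX x hx i)
      _ = n := by simp
  have hsn : 0 < √(n : ℝ) := Real.sqrt_pos.2 hn'
  have hsn2 : √(n : ℝ) * √n = n := Real.mul_self_sqrt hn'.le
  set s := ‖LinearMap.adjoint (X : En n →ₗ[ℝ] En n) p‖ with hs
  set a := s * √n with ha
  have hρ : ∀ x ∈ D, |⟪p, x - x₀⟫| ≤ a := by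
    intro x hx
    have h1 : ⟪p, x - x₀⟫ = ⟪LinearMap.adjoint (X : En n →ₗ[ℝ] En n) p, X.symm (x - x₀)⟫ := by
      rw [LinearMap.adjoint_inner_left, LinearEquiv.coe_coe, LinearEquiv.apply_symm_apply]
    rw [h1]
    exact (abs_real_inner_le_norm _ _).trans
      (mul_le_mul_of_nonneg_left (hYn x hx) (norm_nonneg _))
  have hHa : H * t ≤ a := by
    obtain ⟨z, hzD, hz⟩ := hz
    exact hz.trans ((le_abs_self _).trans (hρ z hzD))
  have hta : t ≤ a := le_trans (by nlinarith) hHa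
  have ha0 : 0 < a := ht.trans_le hta
  have hs0 : 0 < s := pos_of_mul_pos_left ha0 hsn.le
  set k := √(1 + 2 * a / t) with hk
  have hk2 : k ^ 2 = 1 + 2 * a / t := Real.sq_sqrt (by positivity)
  obtain ⟨L, hL1, hL2, hL3⟩ := exists_linearMap_norm_sq_eq X (k := k) (α := t / (4 * n)) hs0
    (by positivity) hs.symm
  have hcoef : t / (4 * n) * (2 * a / t) / s ^ 2 = 1 / (2 * a) := by
    rw [ha, ← hsn2]
    field_simp
    norm_num
  refine ⟨L, a, hta, hρ, fun x hx => ?_, fun x hx => ?_, ?_⟩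
  · rw [hL1, hk2, add_sub_cancel_left, mul_add]
    have h1 : t / (4 * n) * ‖X.symm (x - x₀)‖ ^ 2 ≤ t / 4 := by
      calc t / (4 * n) * ‖X.symm (x - x₀)‖ ^ 2 ≤ t / (4 * n) * √n ^ 2 := by
            have := hYn x hx
            gcongr
        _ = t / 4 := by rw [Real.sq_sqrt hn'.le]; field_simp
    have h2 : t / (4 * n) * (2 * a / t * (⟪p, x - x₀⟫ / s) ^ 2) = ⟪p, x - x₀⟫ ^ 2 / (2 * a) := by
      linear_combination ⟪p, x - x₀⟫ ^ 2 * hcoef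
    linarith
  · set z := x - x₀ with hz
    have hbound : ∀ y, ⟪L z, L y⟫ ≤ (M / 2 + ‖p‖ / 2) * ‖y‖ := by
      intro y
      have hY : ‖X.symm y‖ ≤ √n * (2 * M * ‖y‖ / t) := by
        rcases (norm_nonneg y).eq_or_lt with h0 | h0
        · rw [norm_eq_zero.1 h0.symm]; simp
        · set τ := t / (2 * M * ‖y‖) with hτ
          have hτ0 : 0 < τ := by positivity
          have hmem : x₀ + τ • y ∈ D := by
            refine hball ?_
            rw [Metric.mem_ball, dist_eq_norm, add_sub_cancel_left, norm_smul, Real.norm_eq_abs,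
              _root_.abs_of_pos hτ0]
            have : τ * ‖y‖ = t / M / 2 := by rw [hτ]; field_simp
            rw [this]; linarith
          have h1 := hYn _ hmem
          rw [add_sub_cancel_left, map_smul, norm_smul, Real.norm_eq_abs,
            _root_.abs_of_pos hτ0] at h1
          have h2 : 2 * M * ‖y‖ / t = τ⁻¹ := by rw [hτ, inv_div]
          rw [h2, ← div_eq_mul_inv, le_div_iff₀ hτ0, mul_comm]
          exact h1
      rw [hL2, hk2, add_sub_cancel_left, mul_add]
      have h1 : t / (4 * n) * ⟪X.symm z, X.symm y⟫ ≤ M / 2 * ‖y‖ := by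
        calc t / (4 * n) * ⟪X.symm z, X.symm y⟫
            ≤ t / (4 * n) * (√n * (√n * (2 * M * ‖y‖ / t))) := by
              refine mul_le_mul_of_nonneg_left ((real_inner_le_norm _ _).trans ?_) (by positivity)
              exact mul_le_mul (hYn x hx) hY (norm_nonneg _) hsn.le
          _ = M / 2 * ‖y‖ := by
              rw [← mul_assoc √(n : ℝ), hsn2]; field_simp; norm_num
      have h2 : t / (4 * n) * (2 * a / t * (⟪p, z⟫ / s) * (⟪p, y⟫ / s)) ≤ ‖p‖ / 2 * ‖y‖ := by
        have e : t / (4 * n) * (2 * a / t * (⟪p, z⟫ / s) * (⟪p, y⟫ / s)) =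
            (⟪p, z⟫ * ⟪p, y⟫) * (1 / (2 * a)) := by
          linear_combination (⟪p, z⟫ * ⟪p, y⟫) * hcoef
        rw [e]
        calc (⟪p, z⟫ * ⟪p, y⟫) * (1 / (2 * a)) ≤ (a * (‖p‖ * ‖y‖)) * (1 / (2 * a)) := by
              refine mul_le_mul_of_nonneg_right ((le_abs_self _).trans ?_) (by positivity)
              rw [abs_mul]
              exact mul_le_mul (hρ x hx) (abs_real_inner_le_norm _ _) (abs_nonneg _) ha0.le
          _ = ‖p‖ / 2 * ‖y‖ := by field_simp
      linarith
    set y := LinearMap.adjoint L (L z) with hy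
    have h1 := hbound y
    rw [← LinearMap.adjoint_inner_left, ← hy, real_inner_self_eq_norm_sq] at h1
    rcases (norm_nonneg y).eq_or_lt with h0 | h0
    · rw [← h0]; positivity
    · nlinarith
  · have hkH : H ≤ k ^ 2 := by
      rw [hk2]
      have : H ≤ a / t := (le_div_iff₀ ht).2 hHa
      have h2 : 2 * a / t = 2 * (a / t) := by ring
      rw [h2]
      have : 0 < a / t := by positivity
      linarith
    have hd0 : 0 < LinearMap.det (X : En n →ₗ[ℝ] En n) ^ 2 :=
      sq_pos_of_ne_zero (LinearEquiv.isUnit_det' X).ne_zero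
    set d := LinearMap.det (X : En n →ₗ[ℝ] En n)
    have h32 : 0 < (32 * (n : ℝ) ^ 3 * t) ^ n := by positivity
    have e1 : (t / (4 * n)) ^ n * (128 * (n : ℝ) ^ 4) ^ n = (32 * (n : ℝ) ^ 3 * t) ^ n := by
      rw [← mul_pow]
      congr 1
      field_simp
      norm_num
    rw [div_le_iff₀ (by positivity)]
    refine le_of_mul_le_mul_right ?_ hd0
    calc g₀ * H * d ^ 2 = (g₀ * d ^ 2) * H := by ring
      _ ≤ (32 * (n : ℝ) ^ 3 * t) ^ n * k ^ 2 := by gcongr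
      _ = ((t / (4 * n)) ^ n * k ^ 2) * (128 * (n : ℝ) ^ 4) ^ n := by rw [← e1]; ring
      _ = LinearMap.det L ^ 2 * (128 * (n : ℝ) ^ 4) ^ n * d ^ 2 := by rw [← hL3]; ring

theorem injOn_gradient_of_strict {n : ℕ} {S : Set (En n)} {v : En n → ℝ} {dv : En n → En n}
    (hv : ∀ x ∈ S, ∀ y ∈ S, y ≠ x → v x + ⟪dv x, y - x⟫ < v y) : InjOn dv S := by
  intro x hx y hy h
  by_contra hne
  have h1 := hv x hx y hy (Ne.symm hne)
  have h2 := hv y hy x hx hne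
  rw [h] at h1
  rw [inner_sub_right] at h1 h2
  linarith

theorem exists_contact_point {n : ℕ} {Ω : Set (En n)} (hΩo : IsOpen Ω) (hΩc : IsPreconnected Ω)
    {u v : En n → ℝ} {dv : En n → En n} (hu : ContinuousOn u Ω) (hv : ContinuousOn v Ω)
    (hdv : ContinuousOn dv Ω)
    (hvs : ∀ x ∈ Ω, ∀ y ∈ Ω, y ≠ x → v x + ⟪dv x, y - x⟫ < v y)
    {z₀ z₁ : En n} (hz₀ : z₀ ∈ Ω) (hz₀K : u z₀ = v z₀) (hz₁ : z₁ ∈ Ω) (hz₁K : u z₁ ≠ v z₁) :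
    ∃ (x₀ : En n) (r : ℝ) (p : En n), u x₀ = v x₀ ∧ 0 < r ∧ Metric.closedBall x₀ r ⊆ Ω ∧ p ≠ 0 ∧
      ∀ x ∈ Metric.closedBall x₀ r, u x = v x →
        ⟪p, x - x₀⟫ ≤ v x - v x₀ - ⟪dv x₀, x - x₀⟫ := by
  set K := {x ∈ Ω | u x = v x} with hK
  obtain ⟨z, hz, hznhds⟩ : ∃ z ∈ K, K ∉ nhds z := by
    by_contra! hcon
    have hKo : IsOpen K := isOpen_iff_mem_nhds.2 hcon
    have hKo' : IsOpen (Ω ∩ {x | u x ≠ v x}) := by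
      have h1 := (hu.sub hv).isOpen_inter_preimage hΩo (isOpen_compl_singleton (x := (0 : ℝ)))
      convert h1 using 1
      ext x
      simp [sub_eq_zero]
    obtain ⟨x, _, hx1, hx2⟩ := hΩc K (Ω ∩ {x | u x ≠ v x}) hKo hKo'
      (fun x hx => by
        by_cases h : u x = v x
        · exact Or.inl ⟨hx, h⟩
        · exact Or.inr ⟨hx, h⟩) ⟨z₀, hz₀, hz₀, hz₀K⟩ ⟨z₁, hz₁, hz₁, hz₁K⟩
    exact hx2.2 hx1.2
  have hzΩ := hz.1
  obtain ⟨r, hr, hrΩ⟩ := Metric.nhds_basis_closedBall.mem_iff.1 (hΩo.mem_nhds hzΩ)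
  obtain ⟨m, hm, hmS⟩ : ∃ m : ℝ, 0 < m ∧ ∀ x ∈ Metric.sphere z r,
      m ≤ v x - v z - ⟪dv z, x - z⟫ := by
    rcases (Metric.sphere z r).eq_empty_or_nonempty with h0 | h0
    · exact ⟨1, one_pos, by simp [h0]⟩
    · have hc : ContinuousOn (fun x => v x - v z - ⟪dv z, x - z⟫) (Metric.sphere z r) :=
        ((hv.mono (Metric.sphere_subset_closedBall.trans hrΩ)).sub continuousOn_const).sub
          (by fun_prop)
      obtain ⟨x₁, hx₁, hmin⟩ := (isCompact_sphere z r).exists_isMinOn h0 hc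
      refine ⟨_, ?_, fun x hx => hmin hx⟩
      have := hvs z hzΩ x₁ (hrΩ (Metric.sphere_subset_closedBall hx₁))
        (Metric.ne_of_mem_sphere hx₁ hr.ne')
      linarith
  set φ : En n → ℝ := fun y => |v y - v z| + ‖dv y - dv z‖ * (‖z‖ + r) +
    |⟪dv y, y⟫ - ⟪dv z, z⟫| with hφ
  have hφc : ContinuousAt φ z := by
    have h1 := hv.continuousAt (hΩo.mem_nhds hzΩ)
    have h2 := hdv.continuousAt (hΩo.mem_nhds hzΩ)
    exact ((h1.sub continuousAt_const).abs.add ((h2.sub continuousAt_const).norm.mul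
      continuousAt_const)).add ((h2.inner (𝕜 := ℝ) continuousAt_id).sub continuousAt_const).abs
  have hφ0 : φ z = 0 := by simp [hφ]
  have hev : ∀ᶠ y in nhds z, φ y < m / 2 ∧ y ∈ Ω :=
    (hφc.eventually_lt_const (by rw [hφ0]; linarith)).and (hΩo.mem_nhds hzΩ)
  obtain ⟨y, hyK, hyφ, hyΩ⟩ : ∃ y, y ∉ K ∧ φ y < m / 2 ∧ y ∈ Ω := by
    by_contra! hcon
    refine hznhds ?_
    filter_upwards [hev] with y hy
    by_contra h
    exact hcon y h hy.1 hy.2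
  have hclose : ∀ x ∈ Metric.closedBall z r,
      |(v x - v y - ⟪dv y, x - y⟫) - (v x - v z - ⟪dv z, x - z⟫)| ≤ φ y := by
    intro x hx
    have hxn : ‖x‖ ≤ ‖z‖ + r := by
      have h1 : ‖x - z‖ ≤ r := by rw [← dist_eq_norm]; exact hx
      have h2 := norm_add_le z (x - z)
      rw [add_sub_cancel] at h2
      linarith
    have e : (v x - v y - ⟪dv y, x - y⟫) - (v x - v z - ⟪dv z, x - z⟫) =
        -(v y - v z) + -⟪dv y - dv z, x⟫ + (⟪dv y, y⟫ - ⟪dv z, z⟫) := by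
      simp only [inner_sub_right, inner_sub_left]; ring
    rw [e]
    refine (abs_add_three _ _ _).trans ?_
    rw [abs_neg, abs_neg]
    have := (abs_real_inner_le_norm (dv y - dv z) x).trans
      (mul_le_mul_of_nonneg_left hxn (norm_nonneg _))
    simp only [hφ]
    linarith
  have hKc : IsCompact (Metric.closedBall z r ∩ {x | u x = v x}) := by
    have h1 := ((hu.mono hrΩ).sub (hv.mono hrΩ)).preimage_isClosed_of_isClosed
      Metric.isClosed_closedBall (isClosed_singleton (x := (0 : ℝ)))
    have h2 : Metric.closedBall z r ∩ {x | u x = v x} =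
        Metric.closedBall z r ∩ (u - v) ⁻¹' {0} := by
      ext x; simp [sub_eq_zero]
    rw [h2]
    exact (isCompact_closedBall z r).of_isClosed_subset h1 inter_subset_left
  have hzmem : z ∈ Metric.closedBall z r ∩ {x | u x = v x} :=
    ⟨Metric.mem_closedBall_self hr.le, hz.2⟩
  have hcont : ContinuousOn (fun x => v x - ⟪dv y, x⟫)
      (Metric.closedBall z r ∩ {x | u x = v x}) :=
    (hv.mono (inter_subset_left.trans hrΩ)).sub (by fun_prop)
  obtain ⟨x₀, hx₀, hmin⟩ := hKc.exists_isMinOn ⟨z, hzmem⟩ hcont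
  have hx₀b : x₀ ∈ Metric.ball z r := by
    by_contra hcon
    have hs : x₀ ∈ Metric.sphere z r := by
      have h1 := hx₀.1
      rw [Metric.mem_closedBall] at h1
      rw [Metric.mem_ball, not_lt] at hcon
      exact le_antisymm h1 hcon
    have h1 := hmS x₀ hs
    have h2 := abs_le.1 (hclose x₀ hx₀.1)
    have h3 := abs_le.1 (hclose z hzmem.1)
    have h4 := hmin hzmem
    simp only [mem_ofPred_eq] at h4
    simp only [inner_sub_right] at h1 h2 h3
    linarith [h2.1, h3.2]
  obtain ⟨r', hr', hr'b⟩ := Metric.nhds_basis_closedBall.mem_iff.1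
    (Metric.isOpen_ball.mem_nhds hx₀b)
  have hr'z : Metric.closedBall x₀ r' ⊆ Metric.closedBall z r :=
    hr'b.trans Metric.ball_subset_closedBall
  refine ⟨x₀, r', dv y - dv x₀, hx₀.2, hr', hr'z.trans hrΩ, ?_, fun x hx hxK => ?_⟩
  · intro h
    have := injOn_gradient_of_strict hvs hyΩ (hrΩ hx₀.1) (sub_eq_zero.1 h)
    exact hyK ⟨hyΩ, by rw [this]; exact hx₀.2⟩
  · have h1 := hmin (⟨hr'z hx, hxK⟩ : x ∈ Metric.closedBall z r ∩ {x | u x = v x})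
    simp only [mem_ofPred_eq] at h1
    rw [inner_sub_left, inner_sub_right]
    linarith

theorem strict_ratio_bound {lam f Fu Fv Gx Gy ε κ : ℝ} (hlam : 0 < lam) (hf : 0 < f)
    (hFv : lam ≤ Fv) (hGx : lam ≤ Gx) (hκ : 0 ≤ κ) (hε : 0 < ε) (hεκ : ε * (4 * κ + 2) ≤ 1)
    (hFu : Fu ≤ Fv + ε * κ * lam) (hGy : Gx - ε * κ * lam ≤ Gy) :
    (1 + ε) * (f * Fu) ≤ Gy * (f * Fv / Gx * (1 + ε * (4 * κ + 2))) := by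
  set b := ε * κ with hb
  have hb0 : 0 ≤ b := by positivity
  have hab : 4 * b + 2 * ε ≤ 1 := by rw [hb]; linarith
  have hFv0 : 0 < Fv := hlam.trans_le hFv
  have hGx0 : 0 < Gx := hlam.trans_le hGx
  have h1 : Fu ≤ Fv * (1 + b) := by nlinarith
  have h2 : Gx * (1 - b) ≤ Gy := by nlinarith
  have h3 : (1 + ε) * (1 + b) ≤ (1 - b) * (1 + (4 * b + 2 * ε)) := by nlinarith
  have e : ε * (4 * κ + 2) = 4 * b + 2 * ε := by rw [hb]; ring
  rw [e]
  calc (1 + ε) * (f * Fu) ≤ (1 + ε) * (f * (Fv * (1 + b))) := by gcongr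
    _ = f * Fv * ((1 + ε) * (1 + b)) := by ring
    _ ≤ f * Fv * ((1 - b) * (1 + (4 * b + 2 * ε))) := by gcongr
    _ = Gx * (1 - b) * (f * Fv / Gx * (1 + (4 * b + 2 * ε))) := by field_simp
    _ ≤ Gy * (f * Fv / Gx * (1 + (4 * b + 2 * ε))) := by gcongr

theorem hasGradientAt_quadratic {n : ℕ} (L : En n →ₗ[ℝ] En n) (p x₀ : En n) (c : ℝ) (x : En n) :
    HasGradientAt (fun x => c + ⟪p, x - x₀⟫ / 4 + ‖L (x - x₀)‖ ^ 2 / 2)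
      ((1 / 4 : ℝ) • p + LinearMap.adjoint L (L (x - x₀))) x := by
  rw [hasGradientAt_iff_hasFDerivAt]
  have h0 : HasFDerivAt (fun x : En n => x - x₀) (ContinuousLinearMap.id ℝ (En n)) x :=
    (hasFDerivAt_id x).sub_const x₀
  have h1 : HasFDerivAt (fun x => ⟪p, x - x₀⟫) (innerSL ℝ p) x :=
    (innerSL ℝ p).hasFDerivAt.comp x h0
  have h2 : HasFDerivAt (fun x => (LinearMap.toContinuousLinearMap L) (x - x₀))
      (LinearMap.toContinuousLinearMap L) x :=
    (LinearMap.toContinuousLinearMap L).hasFDerivAt.comp x h0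
  have h3 := (h1.mul_const (1 / 4)).const_add c |>.add (h2.norm_sq.mul_const (1 / 2))
  have e : InnerProductSpace.toDual ℝ (En n)
      ((1 / 4 : ℝ) • p + LinearMap.adjoint L (L (x - x₀))) = (1 / 4 : ℝ) • innerSL ℝ p +
        (1 / 2 : ℝ) • 2 • (innerSL ℝ (LinearMap.toContinuousLinearMap L (x - x₀))).comp
          (LinearMap.toContinuousLinearMap L) := by
    ext y
    simp [LinearMap.adjoint_inner_left]
  rw [e]
  refine h3.congr_of_eventuallyEq (Filter.Eventually.of_forall fun y => ?_)
  simp [div_eq_mul_inv]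

theorem quadratic_subgradient_ineq {n : ℕ} (L : En n →ₗ[ℝ] En n) (p x₀ : En n) (c : ℝ)
    (x y : En n) :
    c + ⟪p, x - x₀⟫ / 4 + ‖L (x - x₀)‖ ^ 2 / 2 +
        ⟪(1 / 4 : ℝ) • p + LinearMap.adjoint L (L (x - x₀)), y - x⟫ ≤
      c + ⟪p, y - x₀⟫ / 4 + ‖L (y - x₀)‖ ^ 2 / 2 := by
  have e : y - x₀ = (x - x₀) + (y - x) := by abel
  rw [e, map_add, norm_add_sq_real, inner_add_left, LinearMap.adjoint_inner_left, inner_smul_left,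
    inner_add_right]
  simp only [conj_trivial]
  nlinarith [sq_nonneg ‖L (y - x)‖]

theorem convex_sublevel_of_subgradient_ineq {n : ℕ} {B : Set (En n)} (hB : Convex ℝ B)
    {V : En n → ℝ} {dV : En n → En n} (hV : ∀ x ∈ B, ∀ y ∈ B, V x + ⟪dV x, y - x⟫ ≤ V y) (t : ℝ) :
    Convex ℝ {x ∈ B | V x ≤ t} := by
  rintro x ⟨hx, hxt⟩ y ⟨hy, hyt⟩ a b ha hb hab
  have hz := hB hx hy ha hb hab
  refine ⟨hz, ?_⟩
  have h1 := mul_le_mul_of_nonneg_left (hV _ hz x hx) ha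
  have h2 := mul_le_mul_of_nonneg_left (hV _ hz y hy) hb
  set z := a • x + b • y with hzdef
  have h3 : a * ⟪dV z, x - z⟫ + b * ⟪dV z, y - z⟫ = 0 := by
    rw [← inner_smul_right, ← inner_smul_right, ← inner_add_right]
    have : a • (x - z) + b • (y - z) = 0 := by
      have e : a • (x - z) + b • (y - z) = z - (a + b) • z := by rw [hzdef]; module
      rw [e, hab, one_smul, sub_self]
    rw [this, inner_zero_right]
  have h4 := mul_le_mul_of_nonneg_left hxt ha
  have h5 := mul_le_mul_of_nonneg_left hyt hb
  have h6 : a * V z + b * V z = V z := by rw [← add_mul, hab, one_mul]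
  have h7 : a * t + b * t = t := by rw [← add_mul, hab, one_mul]
  linarith

theorem exists_lipschitz_const {n : ℕ} {F : En n × ℝ → ℝ} (hF : LocallyLipschitz F)
    {S : Set (En n × ℝ)} (hS : IsCompact S) :
    ∃ C : ℝ, 0 ≤ C ∧ ∀ a ∈ S, ∀ b ∈ S, |F a - F b| ≤ C * (‖a.1 - b.1‖ + |a.2 - b.2|) := by
  obtain ⟨C, hC⟩ := LocallyLipschitzOn.exists_lipschitzOnWith_of_compact (s := S) hS hF.locallyLipschitzOn
  refine ⟨C, C.2, fun a ha b hb => ?_⟩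
  have h1 := hC.dist_le_mul a ha b hb
  rw [Real.dist_eq] at h1
  refine h1.trans (mul_le_mul_of_nonneg_left ?_ C.2)
  rw [Prod.dist_eq, dist_eq_norm, Real.dist_eq]
  exact max_le_add_of_nonneg (norm_nonneg _) (abs_nonneg _)

theorem HasGradientAt.exists_small_step {n : ℕ} {v : En n → ℝ} {g x₀ p : En n}
    (hv : HasGradientAt v g x₀) (hp : p ≠ 0) {H b : ℝ} (hH : 0 < H) (hb : 0 < b) :
    ∃ τ : ℝ, 0 < τ ∧ τ < b ∧ v (x₀ + τ • p) - v x₀ - ⟪g, τ • p⟫ ≤ τ * ‖p‖ ^ 2 / H := by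
  have hp0 : 0 < ‖p‖ := norm_pos_iff.2 hp
  have h1 := (hasFDerivAt_iff_isLittleO.1 hv.hasFDerivAt).def (c := ‖p‖ / H) (by positivity)
  have h2 : Filter.Tendsto (fun τ : ℝ => x₀ + τ • p) (nhdsWithin 0 (Ioi 0)) (nhds x₀) := by
    have : Continuous fun τ : ℝ => x₀ + τ • p := by fun_prop
    exact (this.tendsto' 0 x₀ (by simp)).mono_left nhdsWithin_le_nhds
  obtain ⟨τ, hτ1, hτ2⟩ := ((h2.eventually h1).and (Ioo_mem_nhdsGT hb)).exists
  refine ⟨τ, hτ2.1, hτ2.2, ?_⟩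
  simp only [add_sub_cancel_left, InnerProductSpace.toDual_apply_apply, norm_smul,
    Real.norm_eq_abs, _root_.abs_of_pos hτ2.1] at hτ1
  refine (le_abs_self _).trans (hτ1.trans_eq ?_)
  ring

theorem sq_div_two_mul_le_abs_div_two {s a : ℝ} (ha : 0 < a) (h : |s| ≤ a) :
    s ^ 2 / (2 * a) ≤ |s| / 2 := by
  rw [div_le_iff₀ (by positivity), ← sq_abs]
  nlinarith [mul_le_mul_of_nonneg_left h (abs_nonneg s)]

set_option maxHeartbeats 4000000 in
theorem false_of_contact_point {n : ℕ} {x₀ p : En n} {r : ℝ} (hr : 0 < r) (hp : p ≠ 0)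
    {u v : En n → ℝ} {du dv : En n → En n}
    (hdu : ∀ x ∈ Metric.closedBall x₀ r, HasGradientAt u (du x) x)
    (hdv : ∀ x ∈ Metric.closedBall x₀ r, HasGradientAt v (dv x) x)
    (hduc : ContinuousOn du (Metric.closedBall x₀ r))
    (hdvc : ContinuousOn dv (Metric.closedBall x₀ r))
    (hus : ∀ x ∈ Metric.closedBall x₀ r, ∀ y ∈ Metric.closedBall x₀ r, y ≠ x →
      u x + ⟪du x, y - x⟫ < u y)
    (hvs : ∀ x ∈ Metric.closedBall x₀ r, ∀ y ∈ Metric.closedBall x₀ r, y ≠ x →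
      v x + ⟪dv x, y - x⟫ < v y)
    (huv : ∀ x ∈ Metric.closedBall x₀ r, v x ≤ u x) (hx₀K : u x₀ = v x₀)
    (hK : ∀ x ∈ Metric.closedBall x₀ r, u x = v x →
      ⟪p, x - x₀⟫ ≤ v x - v x₀ - ⟪dv x₀, x - x₀⟫)
    {f : En n → ℝ} {F G : En n × ℝ → ℝ} {lam Lam : ℝ} (hlam : 0 < lam)
    (hfb : ∀ x ∈ Metric.closedBall x₀ r, lam ≤ f x ∧ f x ≤ Lam)
    (hFb : ∀ q, lam ≤ F q ∧ F q ≤ Lam) (hGb : ∀ q, lam ≤ G q ∧ G q ≤ Lam)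
    (hF : LocallyLipschitz F) (hG : LocallyLipschitz G)
    {A Γ gv : En n → ℝ} (hAΓ : Measurable fun x => A x / Γ x) (hgvm : Measurable gv)
    (hA : ∀ x ∈ Metric.closedBall x₀ r, A x = f x * F (x, u x))
    (hΓ : ∀ x ∈ Metric.closedBall x₀ r, Γ x = G (du x, ⟪x, du x⟫ - u x))
    (hgv : ∀ x ∈ Metric.closedBall x₀ r,
      gv x = f x * F (x, v x) / G (dv x, ⟪x, dv x⟫ - v x))
    (hMu : ∀ s ⊆ Metric.closedBall x₀ r, MeasurableSet s →
      volume (du '' s) ≤ ∫⁻ x in s, ENNReal.ofReal (A x / Γ x))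
    (hMv : ∀ s ⊆ Metric.closedBall x₀ r, MeasurableSet s →
      ∫⁻ x in s, ENNReal.ofReal (gv x) ≤ volume (dv '' s)) : False := by
  have hn : 0 < n := by
    rcases Nat.eq_zero_or_pos n with h | h
    · subst h; exact absurd (Subsingleton.elim p 0) hp
    · exact h
  set B := Metric.closedBall x₀ r with hB
  have hBc : IsCompact B := isCompact_closedBall x₀ r
  have hBconv : Convex ℝ B := convex_closedBall x₀ r
  have hx₀B : x₀ ∈ B := Metric.mem_closedBall_self hr.le
  have hp0 : 0 < ‖p‖ := norm_pos_iff.2 hp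
  have hn' : (0 : ℝ) < n := by exact_mod_cast hn
  have hLam : 0 < Lam := hlam.trans_le ((hFb (x₀, 0)).1.trans (hFb (x₀, 0)).2)
  have huc : ContinuousOn u B := fun x hx => (hdu x hx).continuousAt.continuousWithinAt
  have hvc : ContinuousOn v B := fun x hx => (hdv x hx).continuousAt.continuousWithinAt
  have hvw : ∀ x ∈ B, ∀ y ∈ B, v x + ⟪dv x, y - x⟫ ≤ v y := by
    intro x hx y hy
    by_cases h : y = x
    · subst h; simp
    · exact (hvs x hx y hy h).le
  have huw : ∀ x ∈ B, ∀ y ∈ B, u x + ⟪du x, y - x⟫ ≤ u y := by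
    intro x hx y hy
    by_cases h : y = x
    · subst h; simp
    · exact (hus x hx y hy h).le
  -- the normalized function
  set V : En n → ℝ := fun x => v x - v x₀ - ⟪dv x₀, x - x₀⟫ with hVdef
  have hVc : ContinuousOn V B := (hvc.sub continuousOn_const).sub (by fun_prop)
  have hV : ∀ x ∈ B, ∀ y ∈ B, V x + ⟪dv x - dv x₀, y - x⟫ ≤ V y := by
    intro x hx y hy
    have := hvw x hx y hy
    simp only [hVdef, inner_sub_left, inner_sub_right] at this ⊢
    linarith
  have hV0 : ∀ x ∈ B, 0 ≤ V x := by
    intro x hx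
    have := hvw x₀ hx₀B x hx
    simp only [hVdef]; linarith
  have hVx₀ : V x₀ = 0 := by simp [hVdef]
  -- bounds on the ball
  obtain ⟨M', hM'⟩ := hBc.exists_bound_of_continuousOn (hdvc.sub (continuousOn_const (c := dv x₀)))
  set M := max M' 1 with hMdef
  have hM1 : 1 ≤ M := le_max_right _ _
  have hM : ∀ x ∈ B, ‖dv x - dv x₀‖ ≤ M := fun x hx => (hM' x hx).trans (le_max_left _ _)
  set R := ‖x₀‖ + r with hR
  have hR0 : 0 < R := by positivity
  have hxR : ∀ x ∈ B, ‖x‖ ≤ R := by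
    intro x hx
    have h1 : ‖x - x₀‖ ≤ r := by rw [← dist_eq_norm]; exact hx
    have h2 := norm_add_le x₀ (x - x₀)
    rw [add_sub_cancel] at h2
    linarith
  obtain ⟨CF, hCF0, hCF⟩ := exists_lipschitz_const hF
    ((hBc.image_of_continuousOn (f := fun x => (x, u x)) (continuousOn_id.prodMk huc)).union
      (hBc.image_of_continuousOn (f := fun x => (x, v x)) (continuousOn_id.prodMk hvc)))
  obtain ⟨CG, hCG0, hCG⟩ := exists_lipschitz_const hG
    ((hBc.image_of_continuousOn (f := fun x => (du x, ⟪x, du x⟫ - u x))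
      (hduc.prodMk ((continuousOn_id.inner (𝕜 := ℝ) hduc).sub huc))).union
      (hBc.image_of_continuousOn (f := fun x => (dv x, ⟪x, dv x⟫ - v x))
      (hdvc.prodMk ((continuousOn_id.inner (𝕜 := ℝ) hdvc).sub hvc))))
  obtain ⟨m, hm, hmS⟩ : ∃ m : ℝ, 0 < m ∧ ∀ x ∈ Metric.sphere x₀ r, m ≤ V x := by
    rcases (Metric.sphere x₀ r).eq_empty_or_nonempty with h0 | h0
    · exact ⟨1, one_pos, by simp [h0]⟩
    · obtain ⟨x₁, hx₁, hmin⟩ := (isCompact_sphere x₀ r).exists_isMinOn h0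
        (hVc.mono Metric.sphere_subset_closedBall)
      refine ⟨_, ?_, fun x hx => hmin hx⟩
      have := hvs x₀ hx₀B x₁ (Metric.sphere_subset_closedBall hx₁)
        (Metric.ne_of_mem_sphere hx₁ hr.ne')
      simp only [hVdef]
      linarith
  -- constants
  set K₁ := 1 + ‖p‖ * r with hK₁
  have hK₁0 : 0 < K₁ := by positivity
  set K₂ := ‖p‖ + 2 * M with hK₂
  have hK₂0 : 0 < K₂ := by positivity
  set κ := (CF * K₁ + CG * (K₂ + (2 * K₁ + R * K₂))) / lam with hκ
  have hκ0 : 0 ≤ κ := by positivity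
  set N := 4 * κ + 2 with hN
  have hN0 : 0 < N := by positivity
  set g₀ := lam * lam / Lam with hg₀
  have hg₀0 : 0 < g₀ := by positivity
  set g₁ := Lam * Lam / lam with hg₁
  have hgv₀ : ∀ x ∈ B, g₀ ≤ gv x := by
    intro x hx
    rw [hgv x hx]
    have h1 := (hfb x hx).1
    have h2 := (hFb (x, v x)).1
    have h3 := (hGb (dv x, ⟪x, dv x⟫ - v x))
    have h4 := hlam.trans_le h3.1
    exact div_le_div₀ (by nlinarith) (by nlinarith) h4 h3.2
  have hgv₁ : ∀ x ∈ B, gv x ≤ g₁ := by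
    intro x hx
    rw [hgv x hx]
    have h1 := (hfb x hx).2
    have h2 := (hFb (x, v x)).2
    have h3 := (hGb (dv x, ⟪x, dv x⟫ - v x)).1
    have h4 := hlam.trans_le (hFb (x, v x)).1
    exact div_le_div₀ (by positivity) (by nlinarith) hlam h3
  set H := max 1 (g₁ * (N + 1) ^ n * (128 * (n : ℝ) ^ 4) ^ n / g₀) with hH
  have hH1 : 1 ≤ H := le_max_left _ _
  have hHT : g₁ * (N + 1) ^ n ≤ g₀ * H / (128 * (n : ℝ) ^ 4) ^ n := by
    rw [le_div_iff₀ (by positivity), ← div_le_iff₀' hg₀0]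
    exact le_max_right _ _
  have hH0 : 0 < H := by linarith
  -- the section
  set b := min m (min 1 r) with hb
  have hb0 : 0 < b := lt_min hm (lt_min one_pos hr)
  obtain ⟨τ, hτ0, hτb, hτV⟩ := (hdv x₀ hx₀B).exists_small_step hp hH0
    (b := min (r / ‖p‖) (b * H / ‖p‖ ^ 2)) (lt_min (by positivity) (by positivity))
  set t := τ * ‖p‖ ^ 2 / H with ht
  have ht0 : 0 < t := by positivity
  have htb : t < b := by
    have h1 := hτb.trans_le (min_le_right _ _)
    rw [lt_div_iff₀ (by positivity)] at h1
    rw [ht, div_lt_iff₀ hH0]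
    exact h1
  have htm : t < m := htb.trans_le (min_le_left _ _)
  have ht1 : t < 1 := htb.trans_le ((min_le_right _ _).trans (min_le_left _ _))
  have htr : t < r := htb.trans_le ((min_le_right _ _).trans (min_le_right _ _))
  set D : Set (En n) := {x ∈ B | V x ≤ t} with hD
  have hDB : D ⊆ B := fun x hx => hx.1
  have hDc : IsCompact D :=
    hBc.of_isClosed_subset (hVc.preimage_isClosed_of_isClosed hBc.isClosed isClosed_Iic)
      inter_subset_left
  have hDconv : Convex ℝ D := convex_sublevel_of_subgradient_ineq hBconv hV t
  set Do : Set (En n) := Metric.ball x₀ r ∩ V ⁻¹' Iio t with hDodef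
  have hDo : IsOpen Do :=
    (hVc.mono Metric.ball_subset_closedBall).isOpen_inter_preimage Metric.isOpen_ball isOpen_Iio
  have hDoD : Do ⊆ D := fun x hx => ⟨Metric.ball_subset_closedBall hx.1, le_of_lt hx.2⟩
  have hbd : ∀ x ∈ D, x ∉ Do → V x = t := by
    intro x hx hxo
    refine le_antisymm hx.2 (not_lt.1 fun hlt => hxo ⟨?_, hlt⟩)
    by_contra hcon
    have hs : x ∈ Metric.sphere x₀ r := by
      have h1 : dist x x₀ ≤ r := hx.1
      rw [Metric.mem_ball, not_lt] at hcon
      exact le_antisymm h1 hcon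
    linarith [hmS x hs]
  have hballD : Metric.ball x₀ (t / M) ⊆ D := by
    intro x hx
    rw [Metric.mem_ball, dist_eq_norm, lt_div_iff₀ (by positivity)] at hx
    have h1 : ‖x - x₀‖ ≤ r := by nlinarith [norm_nonneg (x - x₀)]
    have hxB : x ∈ B := by rw [hB, Metric.mem_closedBall, dist_eq_norm]; exact h1
    refine ⟨hxB, ?_⟩
    have h2 := hV x hxB x₀ hx₀B
    rw [hVx₀, ← neg_sub x x₀, inner_neg_right] at h2
    have h3 := (real_inner_le_norm (dv x - dv x₀) (x - x₀)).trans
      (mul_le_mul_of_nonneg_right (hM x hxB) (norm_nonneg _))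
    linarith
  have hvol : ∀ s ⊆ D, MeasurableSet s → ENNReal.ofReal g₀ * volume s ≤ volume (dv '' s) := by
    intro s hs hsm
    refine le_trans ?_ (hMv s (hs.trans hDB) hsm)
    rw [← setLIntegral_const]
    exact setLIntegral_mono' hsm fun x hx => ENNReal.ofReal_le_ofReal (hgv₀ x (hDB (hs hx)))
  obtain ⟨L, a, hta, hρa, hLn, hLL, hLdet⟩ := exists_section_barrier (p := p) (p₀ := dv x₀)
    hn hDc hDconv ht0 hg₀0
    (by positivity : 0 < M) hH1 hballD (fun x hx y hy => hV x (hDB hx) y (hDB hy))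
    (fun x hx => hV0 x (hDB hx)) (fun x hx => hx.2) hvol (by
      refine ⟨x₀ + τ • p, ⟨?_, ?_⟩, ?_⟩
      · rw [hB, Metric.mem_closedBall, dist_eq_norm, add_sub_cancel_left, norm_smul,
          Real.norm_eq_abs, _root_.abs_of_pos hτ0, ← le_div_iff₀ hp0]
        exact (hτb.trans_le (min_le_left _ _)).le
      · simp only [hVdef, add_sub_cancel_left]; exact hτV
      · rw [add_sub_cancel_left, inner_smul_right, real_inner_self_eq_norm_sq, ht]
        exact le_of_eq (by field_simp))
  have ha0 : 0 < a := ht0.trans_le hta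
  clear_value t b H g₀ g₁ N κ K₁ K₂ R M
  -- the barrier
  set q : En n → ℝ := fun x => t / 8 + ⟪p, x - x₀⟫ / 4 + ‖L (x - x₀)‖ ^ 2 / 2 with hq
  set dq : En n → En n := fun x => (1 / 4 : ℝ) • p + LinearMap.adjoint L (L (x - x₀)) with hdq
  set h : En n → ℝ := fun x => q x - V x with hh
  have hρr : ∀ x ∈ B, |⟪p, x - x₀⟫| ≤ ‖p‖ * r := by
    intro x hx
    have h1 : ‖x - x₀‖ ≤ r := by rw [← dist_eq_norm]; exact hx
    exact (abs_real_inner_le_norm _ _).trans (mul_le_mul_of_nonneg_left h1 hp0.le)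
  have hρ2 : ∀ x ∈ D, ⟪p, x - x₀⟫ ^ 2 / (2 * a) ≤ |⟪p, x - x₀⟫| / 2 :=
    fun x hx => sq_div_two_mul_le_abs_div_two ha0 (hρa x hx)
  have hhK : ∀ x ∈ D, |h x| ≤ K₁ := by
    intro x hx
    have h1 := hLn x hx
    have h2 := hρ2 x hx
    have h3 := hρr x (hDB hx)
    have h4 := abs_le.1 h3
    have h5 := hV0 x (hDB hx)
    have h6 := hx.2
    have h7 := sq_nonneg ‖L (x - x₀)‖
    rw [abs_le]
    simp only [hh, hq, hK₁]
    constructor <;> linarith [h4.1, h4.2]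
  have hdqK : ∀ x ∈ D, ‖dq x - (dv x - dv x₀)‖ ≤ K₂ := by
    intro x hx
    have h1 := hLL x hx
    have h2 := hM x (hDB hx)
    have h3 : ‖(1 / 4 : ℝ) • p‖ = ‖p‖ / 4 := by
      rw [norm_smul]; norm_num; ring
    have h4 := norm_add_le ((1 / 4 : ℝ) • p) (LinearMap.adjoint L (L (x - x₀)))
    have h5 := norm_sub_le (dq x) (dv x - dv x₀)
    simp only [hdq] at h5 ⊢
    rw [hK₂]
    linarith
  have hneg : ∀ x ∈ D, V x = t → u x = v x → h x < 0 := by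
    intro x hx hVt hxK
    have h1 := hLn x hx
    have h2 := hρ2 x hx
    have h3 := hK x (hDB hx) hxK
    have h4 : ⟪p, x - x₀⟫ ≤ t := by rw [← hVt]; exact h3
    simp only [hh, hq, hVt]
    rcases le_total 0 ⟪p, x - x₀⟫ with h0 | h0
    · rw [abs_of_nonneg h0] at h2
      linarith
    · rw [abs_of_nonpos h0] at h2
      linarith
  have hqc : Continuous q := by
    refine continuous_iff_continuousAt.2 fun x => ?_
    exact (hasGradientAt_quadratic L p x₀ (t / 8) x).continuousAt
  have hhc : ContinuousOn h D := hqc.continuousOn.sub (hVc.mono hDB)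
  obtain ⟨c, hc, hcS⟩ : ∃ c : ℝ, 0 < c ∧ ∀ x ∈ D, x ∉ Do → 0 ≤ h x → c ≤ u x - v x := by
    have hSc : IsCompact ((D ∩ Doᶜ) ∩ h ⁻¹' Ici 0) :=
      (hDc.inter_right hDo.isClosed_compl).of_isClosed_subset
        ((hhc.mono inter_subset_left).preimage_isClosed_of_isClosed
          (hDc.inter_right hDo.isClosed_compl).isClosed isClosed_Ici) inter_subset_left
    rcases ((D ∩ Doᶜ) ∩ h ⁻¹' Ici 0).eq_empty_or_nonempty with h0 | h0
    · refine ⟨1, one_pos, fun x hx hxo hxh => ?_⟩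
      exact absurd (h0 ▸ (⟨⟨hx, hxo⟩, hxh⟩ : x ∈ (D ∩ Doᶜ) ∩ h ⁻¹' Ici 0)) (notMem_empty x)
    · obtain ⟨x₁, hx₁, hmin⟩ := hSc.exists_isMinOn h0 (f := fun x => u x - v x)
        ((huc.sub hvc).mono fun x hx => hDB hx.1.1)
      refine ⟨_, ?_, fun x hx hxo hxh => hmin ⟨⟨hx, hxo⟩, hxh⟩⟩
      refine sub_pos.2 (lt_of_le_of_ne (huv x₁ (hDB hx₁.1.1)) fun heq => ?_)
      have h1 := hneg x₁ hx₁.1.1 (hbd x₁ hx₁.1.1 hx₁.1.2) heq.symm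
      exact absurd h1 (not_lt.2 hx₁.2)
  obtain ⟨ε, hε0, hε1, hεN, hεc⟩ : ∃ ε : ℝ, 0 < ε ∧ ε < 1 ∧ ε * N ≤ 1 ∧ ε * K₁ < c := by
    refine ⟨min (1 / 2) (min (1 / N) (c / (2 * K₁))), by positivity,
      (min_le_left _ _).trans_lt (by norm_num), ?_, ?_⟩
    · rw [← le_div_iff₀ hN0]
      exact (min_le_right _ _).trans (min_le_left _ _)
    · rw [← lt_div_iff₀ hK₁0]
      refine ((min_le_right _ _).trans (min_le_right _ _)).trans_lt ?_
      exact div_lt_div_of_pos_left hc hK₁0 (by linarith)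
  set w : En n → ℝ := fun x => v x + ε * h x with hw
  set dw : En n → En n := fun x => dv x + ε • (dq x - (dv x - dv x₀)) with hdw
  have hVg : ∀ x ∈ B, HasGradientAt V (dv x - dv x₀) x := by
    intro x hx
    rw [hasGradientAt_iff_hasFDerivAt, map_sub]
    refine ((hdv x hx).hasFDerivAt.sub_const (v x₀)).sub ?_
    exact (innerSL ℝ (dv x₀)).hasFDerivAt.comp x ((hasFDerivAt_id x).sub_const x₀)
  have hwg : ∀ x ∈ D, HasGradientAt w (dw x) x := by
    intro x hx
    have h1 : HasFDerivAt q (InnerProductSpace.toDual ℝ (En n) (dq x)) x :=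
      (hasGradientAt_quadratic L p x₀ (t / 8) x).hasFDerivAt
    have h2 := (hVg x (hDB hx)).hasFDerivAt
    have h3 := (hdv x (hDB hx)).hasFDerivAt
    rw [hasGradientAt_iff_hasFDerivAt]
    rw [hdw]
    simp only [map_add _ (dv x), map_smul, map_sub]
    simp only [map_sub] at h2
    exact h3.add (HasFDerivAt.const_mul (h1.sub h2) ε)
  have hwc : ∀ x ∈ D, ∀ y ∈ D, w x + ⟪dw x, y - x⟫ ≤ w y := by
    intro x hx y hy
    have h1 := quadratic_subgradient_ineq L p x₀ (t / 8) x y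
    have h2 := hvw x (hDB hx) y (hDB hy)
    have h3 := mul_le_mul_of_nonneg_left h1 hε0.le
    have h4 := mul_le_mul_of_nonneg_left h2 (sub_nonneg.2 hε1.le)
    have e1 : ∀ z, w z = (1 - ε) * v z + ε * q z + ε * (v x₀ + ⟪dv x₀, z - x₀⟫) := fun z => by
      simp only [hw, hh, hVdef]; ring
    have e2 : ⟪dw x, y - x⟫ = (1 - ε) * ⟪dv x, y - x⟫ + ε * ⟪dq x, y - x⟫ +
        ε * (⟪dv x₀, y - x₀⟫ - ⟪dv x₀, x - x₀⟫) := by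
      rw [← inner_sub_right (dv x₀), sub_sub_sub_cancel_right]
      simp only [hdw, inner_add_left, inner_smul_left, inner_sub_left, conj_trivial]; ring
    rw [e1 x, e1 y, e2]
    simp only [hq, hdq]
    linarith
  have hbdry : ∀ x ∈ D, x ∉ Do → w x < u x := by
    intro x hx hxo
    have h1 := huv x (hDB hx)
    rcases lt_or_ge (h x) 0 with h0 | h0
    · have := mul_neg_of_pos_of_neg hε0 h0
      simp only [hw]; linarith
    · have h2 := hcS x hx hxo h0
      have h3 := mul_le_mul_of_nonneg_left (abs_le.1 (hhK x hx)).2 hε0.le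
      simp only [hw]; linarith
  have hcore := not_exists_touching_of_strict hn hDc hDconv hDo hDoD (u := u) (w := w) (du := du)
    (dv := dv) (dw := dw) (L := L) (ε := ε) (N := N) (g₁ := g₁) (δ := ε) (a₀ := lam * lam)
    (a₁ := Lam * Lam) (b := dv x₀ + (1 / 4 : ℝ) • p - LinearMap.adjoint L (L x₀))
    (A := A) (Γ := Γ) (gv := gv)
    (fun x hx => hdu x (hDB hx)) hwg (hduc.mono hDB) ((injOn_gradient_of_strict hus).mono hDB)
    ((injOn_gradient_of_strict hvs).mono hDB)
    (fun x hx y hy => by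
      have h1 := hvw x (hDB hx) y (hDB hy)
      have h2 := hvw y (hDB hy) x (hDB hx)
      simp only [inner_sub_left, inner_sub_right] at h1 h2 ⊢
      linarith) hε0 hε1 hN0.le hε0 (by positivity)
    (fun x _ => by simp only [hdw, hdq, map_sub]; module) hwc hbdry hAΓ hgvm
    (fun x hx => by rw [hΓ x (hDB (hDoD hx))]; exact hlam.trans_le (hGb _).1)
    (fun x hx => by
      rw [hA x (hDB (hDoD hx))]
      have h1 := (hfb x (hDB (hDoD hx))).1
      have h2 := (hFb (x, u x)).1
      nlinarith)
    (fun x hx => by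
      rw [hA x (hDB (hDoD hx))]
      have h1 := (hfb x (hDB (hDoD hx))).2
      have h2 := (hFb (x, u x)).2
      have h3 := hlam.trans_le (hFb (x, u x)).1
      nlinarith)
    (fun x hx => hg₀0.trans_le (hgv₀ x (hDB (hDoD hx)))) (fun x hx => hgv₁ x (hDB (hDoD hx)))
    (fun s hs hsm => hMu s (hs.trans (hDoD.trans hDB)) hsm)
    (fun s hs hsm => hMv s (hs.trans (hDoD.trans hDB)) hsm)
    (by
      intro x hx y hy hxw hyw hxy
      have hxD := hDoD hx
      have hyD := hDoD hy
      have hxB := hDB hxD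
      have hyB := hDB hyD
      have hhx := abs_le.1 (hhK x hxD)
      have hhy := abs_le.1 (hhK y hyD)
      have hhx1 := mul_le_mul_of_nonneg_left hhx.2 hε0.le
      have hhx2 := mul_le_mul_of_nonneg_left hhx.1 hε0.le
      have hhy1 := mul_le_mul_of_nonneg_left hhy.2 hε0.le
      have hux : |u x - v x| ≤ ε * K₁ := by
        have := huv x hxB
        rw [abs_of_nonneg (by linarith)]
        simp only [hw] at hxw
        linarith
      have hP : ‖du y - dv x‖ ≤ ε * K₂ := by
        rw [hxy]
        simp only [hdw, add_sub_cancel_left, norm_smul, Real.norm_eq_abs,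
          _root_.abs_of_pos hε0]
        exact mul_le_mul_of_nonneg_left (hdqK x hxD) hε0.le
      have hC : |(⟪y, du y⟫ - u y) - (⟪x, dv x⟫ - v x)| ≤ ε * (2 * K₁ + R * K₂) := by
        have h1 := huw y hyB x hxB
        have h2 := hwc x hxD y hyD
        rw [← hxy] at h2
        have h3 : |⟪x, du y - dv x⟫| ≤ R * (ε * K₂) :=
          (abs_real_inner_le_norm _ _).trans (mul_le_mul (hxR x hxB) hP (norm_nonneg _) hR0.le)
        have h4 := abs_le.1 h3
        have h5 := huv y hyB
        rw [inner_sub_right, real_inner_comm _ (du y), real_inner_comm _ (du y)] at h1 h2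
        rw [inner_sub_right] at h4
        simp only [hw] at h2 hxw
        rw [abs_le]
        constructor <;> linarith [h4.1, h4.2]
      have hFL := hCF (x, u x) (Or.inl ⟨x, hxB, rfl⟩) (x, v x) (Or.inr ⟨x, hxB, rfl⟩)
      have hGL := hCG _ (Or.inl ⟨y, hyB, rfl⟩) _ (Or.inr ⟨x, hxB, rfl⟩)
      simp only [sub_self, norm_zero, zero_add] at hFL hGL
      have hFL' := hFL.trans (mul_le_mul_of_nonneg_left hux hCF0)
      have hGL' := hGL.trans (mul_le_mul_of_nonneg_left (add_le_add hP hC) hCG0)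
      have hκl : ε * κ * lam = CF * (ε * K₁) + CG * (ε * K₂ + ε * (2 * K₁ + R * K₂)) := by
        rw [hκ]; field_simp
      have hn1 : 0 ≤ CF * (ε * K₁) := by positivity
      have hn2 : 0 ≤ CG * (ε * K₂ + ε * (2 * K₁ + R * K₂)) := by positivity
      rw [hA x hxB, hΓ y hyB, hgv x hxB, hN]
      refine strict_ratio_bound hlam (hlam.trans_le (hfb x hxB).1) (hFb _).1 (hGb _).1 hκ0 hε0
        (hN ▸ hεN)
        ?_ ?_
      · rw [hκl]; linarith [(abs_le.1 hFL').2]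
      · rw [hκl]; linarith [(abs_le.1 hGL').1])
    (hHT.trans hLdet)
  have hx₀o : x₀ ∈ Do := ⟨Metric.mem_ball_self hr, by rw [mem_preimage, hVx₀]; exact ht0⟩
  have hfin := hcore x₀ hx₀o
  have hhx₀ : h x₀ = t / 8 := by simp [hh, hq, hVx₀]
  simp only [hw, hhx₀, hx₀K] at hfin
  have := mul_pos hε0 (by positivity : 0 < t / 8)
  linarith

theorem measurable_indicator_of_continuousOn {n : ℕ} {Ω : Set (En n)} (hΩ : IsOpen Ω)
    {h : En n → ℝ} (hh : ContinuousOn h Ω) : Measurable (Ω.indicator h) := by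
  classical
  rw [← Set.piecewise_eq_indicator]
  exact hh.measurable_piecewise continuousOn_const hΩ.measurableSet

theorem ContDiffOn.hasGradientAt {n : ℕ} {Ω : Set (En n)} (hΩ : IsOpen Ω) {u : En n → ℝ}
    (hu : ContDiffOn ℝ 1 u Ω) : ∀ x ∈ Ω, HasGradientAt u (gradient u x) x := fun _ hx =>
  ((hu.differentiableOn one_ne_zero).differentiableAt (hΩ.mem_nhds hx)).hasGradientAt

theorem ContDiffOn.continuousOn_gradient {n : ℕ} {Ω : Set (En n)} (hΩ : IsOpen Ω) {u : En n → ℝ}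
    (hu : ContDiffOn ℝ 1 u Ω) : ContinuousOn (gradient u) Ω :=
  (InnerProductSpace.toDual ℝ (En n)).symm.continuous.comp_continuousOn
    (hu.continuousOn_fderiv_of_isOpen hΩ le_rfl)

/-- Theorem 1.5 (Theorem `thm:smp 3`): strong maximum principle for a `C¹` strictly convex
subsolution/supersolution pair. -/
theorem statement_3 {n : ℕ} (Ω : Set (En n)) (hΩo : IsOpen Ω) (hΩc : IsConnected Ω)
    (f : En n → ℝ) (hfm : Measurable f)
    (F G : En n × ℝ → ℝ)
    (lam Lam : ℝ) (hlam : 0 < lam) (hLam : lam ≤ Lam)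
    (hfb : ∀ x ∈ Ω, lam ≤ f x ∧ f x ≤ Lam)
    (hFb : ∀ p : En n × ℝ, lam ≤ F p ∧ F p ≤ Lam)
    (hGb : ∀ p : En n × ℝ, lam ≤ G p ∧ G p ≤ Lam)
    (hFlip : LocallyLipschitz F) (hGlip : LocallyLipschitz G)
    (u v : En n → ℝ) (hu : ConvexOn ℝ Ω u) (hv : ConvexOn ℝ Ω v)
    (huC1 : ContDiffOn ℝ 1 u Ω) (hvC1 : ContDiffOn ℝ 1 v Ω)
    (husc : ∀ x ∈ Ω, IsStrictConvexPt Ω u x) (hvsc : ∀ x ∈ Ω, IsStrictConvexPt Ω v x)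
    (huv : ∀ x ∈ Ω, v x ≤ u x)
    (hMu : ∀ s : Set (En n), s ⊆ Ω → MeasurableSet s →
      MAm Ω u s ≤ ∫⁻ x in s, ENNReal.ofReal
        (f x * F (x, u x) / G (gradient u x, legendreT Ω u (gradient u x))))
    (hMv : ∀ s : Set (En n), s ⊆ Ω → MeasurableSet s →
      ∫⁻ x in s, ENNReal.ofReal
        (f x * F (x, v x) / G (gradient v x, legendreT Ω v (gradient v x))) ≤ MAm Ω v s) :
    (∀ x ∈ Ω, v x < u x) ∨ (∀ x ∈ Ω, u x = v x) := by
  by_contra hcon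
  push Not at hcon
  obtain ⟨⟨z₀, hz₀, hz₀le⟩, z₁, hz₁, hz₁K⟩ := hcon
  have hdu := huC1.hasGradientAt hΩo
  have hdv := hvC1.hasGradientAt hΩo
  have hduc := huC1.continuousOn_gradient hΩo
  have hdvc := hvC1.continuousOn_gradient hΩo
  have hus : ∀ x ∈ Ω, ∀ y ∈ Ω, y ≠ x → u x + ⟪gradient u x, y - x⟫ < u y :=
    fun x hx y hy hxy => (husc x hx).subgradient_ineq_lt hu hx hy hxy (hdu x hx)
  have hvs : ∀ x ∈ Ω, ∀ y ∈ Ω, y ≠ x → v x + ⟪gradient v x, y - x⟫ < v y :=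
    fun x hx y hy hxy => (hvsc x hx).subgradient_ineq_lt hv hx hy hxy (hdv x hx)
  have huc := huC1.continuousOn
  have hvc := hvC1.continuousOn
  obtain ⟨x₀, r, p, hx₀K, hr, hB, hp, hK⟩ := exists_contact_point hΩo hΩc.isPreconnected huc hvc
    hdvc hvs hz₀ (le_antisymm hz₀le (huv z₀ hz₀)) hz₁ hz₁K
  have hFc : ∀ {w : En n → ℝ}, ContinuousOn w Ω → ContinuousOn (fun x => F (x, w x)) Ω :=
    fun hw => hFlip.continuous.comp_continuousOn (continuousOn_id.prodMk hw)
  have hGc : ∀ {w : En n → ℝ} {g : En n → En n}, ContinuousOn w Ω → ContinuousOn g Ω →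
      ContinuousOn (fun x => G (g x, ⟪x, g x⟫ - w x)) Ω := fun hw hg =>
    hGlip.continuous.comp_continuousOn (hg.prodMk ((continuousOn_id.inner (𝕜 := ℝ) hg).sub hw))
  refine false_of_contact_point hr hp (fun x hx => hdu x (hB hx)) (fun x hx => hdv x (hB hx))
    (hduc.mono hB) (hdvc.mono hB) (fun x hx y hy => hus x (hB hx) y (hB hy))
    (fun x hx y hy => hvs x (hB hx) y (hB hy)) (fun x hx => huv x (hB hx)) hx₀K hK hlam
    (fun x hx => hfb x (hB hx)) hFb hGb hFlip hGlip
    (A := fun x => f x * Ω.indicator (fun x => F (x, u x)) x)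
    (Γ := Ω.indicator fun x => G (gradient u x, ⟪x, gradient u x⟫ - u x))
    (gv := fun x => f x * Ω.indicator (fun x => F (x, v x)) x /
      Ω.indicator (fun x => G (gradient v x, ⟪x, gradient v x⟫ - v x)) x)
    ((hfm.mul (measurable_indicator_of_continuousOn hΩo (hFc huc))).div
      (measurable_indicator_of_continuousOn hΩo (hGc huc hduc)))
    ((hfm.mul (measurable_indicator_of_continuousOn hΩo (hFc hvc))).div
      (measurable_indicator_of_continuousOn hΩo (hGc hvc hdvc)))
    (fun x hx => by simp only [indicator_of_mem (hB hx)])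
    (fun x hx => by simp only [indicator_of_mem (hB hx)])
    (fun x hx => by simp only [indicator_of_mem (hB hx)]) ?_ ?_
  · intro s hs hsm
    rw [← hu.MAm_eq_volume_image hΩo hdu (hs.trans hB)]
    refine (hMu s (hs.trans hB) hsm).trans_eq (setLIntegral_congr_fun hsm fun x hx => ?_)
    have hxΩ := hB (hs hx)
    simp only [indicator_of_mem hxΩ, hu.legendreT_gradient hxΩ (hdu x hxΩ)]
  · intro s hs hsm
    rw [← hv.MAm_eq_volume_image hΩo hdv (hs.trans hB)]
    refine (setLIntegral_congr_fun hsm fun x hx => ?_).trans_le (hMv s (hs.trans hB) hsm)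
    have hxΩ := hB (hs hx)
    simp only [indicator_of_mem hxΩ, hv.legendreT_gradient hxΩ (hdv x hxΩ)]
end
end

section
/- Let n ≥ 1, let p, q ∈ ℝ, let f : Sⁿ → ℝ be measurable with 0 < λ ≤ f ≤ Λ for constants λ ≤ Λ, and let g : Sⁿ → ℝ be a positive Lipschitz function. Let K₁ and K₂ be convex bodies in ℝ^{n+1} with 0 in the interior of both, and suppose each K_i is an Aleksandrov solution of the L_p dual Minkowski problem with data (f, g), i.e., ∫_{α*_{K_i}(ω)} g(θ)·ρ_{K_i}(θ)^q dσ(θ) = ∫_ω f(ξ)·h_{K_i}(ξ)^p dσ(ξ) for every Borel set ω ⊆ Sⁿ. If p > q, then K₁ = K₂; if p = q, then there exists a constant c > 0 such that K₁ = c·K₂. -/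
open MeasureTheory Set
open scoped RealInnerProductSpace ENNReal Pointwise

noncomputable section

/-- The ambient Euclidean space `ℝ^{n+1}`. -/
abbrev Es (n : ℕ) := EuclideanSpace ℝ (Fin (n + 1))

/-- The unit sphere `Sⁿ ⊆ ℝ^{n+1}`. -/
def unitSphere (n : ℕ) : Set (Es n) := Metric.sphere (0 : Es n) 1

/-- The radial function `ρ_K(θ) = max {s > 0 : sθ ∈ K}` of a convex body `K`. -/
def radialFn {n : ℕ} (K : Set (Es n)) (θ : Es n) : ℝ :=
  sSup {s : ℝ | 0 < s ∧ s • θ ∈ K}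

/-- The support function `h_K(ξ) = sup_{x ∈ K} x·ξ` of a convex body `K`. -/
def supportFn {n : ℕ} (K : Set (Es n)) (ξ : Es n) : ℝ :=
  sSup ((fun x => ⟪x, ξ⟫) '' K)

/-- The normal cone `N_K(x) = {ξ ∈ Sⁿ : (y − x)·ξ ≤ 0 for all y ∈ K}`. -/
def normalCone {n : ℕ} (K : Set (Es n)) (x : Es n) : Set (Es n) :=
  {ξ | ‖ξ‖ = 1 ∧ ∀ y ∈ K, ⟪y - x, ξ⟫ ≤ 0}

/-- The Gauss image map `α_K(A) = ⋃_{θ ∈ A} N_K(ρ_K(θ)θ)`. -/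
def gaussImage {n : ℕ} (K : Set (Es n)) (A : Set (Es n)) : Set (Es n) :=
  ⋃ θ ∈ A, normalCone K ((radialFn K θ) • θ)

/-- The inverse Gauss image map `α*_K(ω) = {θ ∈ Sⁿ : α_K({θ}) ∩ ω ≠ ∅}`. -/
def gaussImageInv {n : ℕ} (K : Set (Es n)) (ω : Set (Es n)) : Set (Es n) :=
  {θ ∈ unitSphere n | (gaussImage K {θ} ∩ ω).Nonempty}

/-- The spherical Lebesgue (surface) measure on `Sⁿ`, realized as the `n`-dimensional
Hausdorff measure on `ℝ^{n+1}`. -/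
def sphMeasure (n : ℕ) : Measure (Es n) := μH[(n : ℝ)]

/-- A compact convex set with the origin in its interior. -/
structure IsBody {n : ℕ} (K : Set (Es n)) : Prop where
  isCompact : IsCompact K
  convex : Convex ℝ K
  zero_mem_interior : (0 : Es n) ∈ interior K

namespace IsBody

variable {n : ℕ} {K : Set (Es n)}

lemma mem_nhds (hK : IsBody K) : K ∈ nhds (0 : Es n) :=
  mem_interior_iff_mem_nhds.1 hK.zero_mem_interior

lemma continuous_gauge (hK : IsBody K) : Continuous (gauge K) :=
  _root_.continuous_gauge hK.convex hK.mem_nhds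

lemma gauge_pos (hK : IsBody K) {x : Es n} (hx : x ≠ 0) : 0 < gauge K x :=
  (_root_.gauge_pos (absorbent_nhds_zero hK.mem_nhds)
    ((NormedSpace.isVonNBounded_iff ℝ).2 hK.isCompact.isBounded)).2 hx

lemma gauge_le_one_iff (hK : IsBody K) {x : Es n} : gauge K x ≤ 1 ↔ x ∈ K := by
  rw [gauge_le_one_iff_mem_closure hK.convex hK.mem_nhds, hK.isCompact.isClosed.closure_eq]

lemma smul_mem_iff (hK : IsBody K) {x : Es n} (hx : x ≠ 0) {s : ℝ} (hs : 0 < s) :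
    s • x ∈ K ↔ s ≤ (gauge K x)⁻¹ := by
  rw [← hK.gauge_le_one_iff, gauge_smul_of_nonneg hs.le, smul_eq_mul,
    ← le_div_iff₀ (hK.gauge_pos hx), one_div]

lemma radialFn_eq (hK : IsBody K) {x : Es n} (hx : x ≠ 0) :
    radialFn K x = (gauge K x)⁻¹ := by
  have : {s : ℝ | 0 < s ∧ s • x ∈ K} = Ioc 0 (gauge K x)⁻¹ := by
    ext s
    exact and_congr_right fun hs => hK.smul_mem_iff hx hs
  rw [radialFn, this, csSup_Ioc (inv_pos.2 (hK.gauge_pos hx))]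

lemma radial_smul_mem (hK : IsBody K) {x : Es n} (hx : x ≠ 0) : (gauge K x)⁻¹ • x ∈ K :=
  (hK.smul_mem_iff hx (inv_pos.2 (hK.gauge_pos hx))).2 le_rfl

lemma continuous_supportFn (hK : IsBody K) : Continuous (supportFn K) :=
  hK.isCompact.continuous_sSup (f := fun ξ x => ⟪x, ξ⟫)
    (by unfold Function.HasUncurry.uncurry; fun_prop)

lemma inner_le_supportFn (hK : IsBody K) {x : Es n} (hx : x ∈ K) (ξ : Es n) :
    ⟪x, ξ⟫ ≤ supportFn K ξ :=
  le_csSup ((hK.isCompact.image (by fun_prop)).bddAbove) (mem_image_of_mem _ hx)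

lemma inner_le_gauge_mul (hK : IsBody K) (x ξ : Es n) :
    ⟪x, ξ⟫ ≤ gauge K x * supportFn K ξ := by
  rcases eq_or_ne x 0 with rfl | hx
  · simp
  have h := hK.inner_le_supportFn (hK.radial_smul_mem hx) ξ
  rw [real_inner_smul_left] at h
  rwa [inv_mul_le_iff₀ (hK.gauge_pos hx)] at h

lemma supportFn_pos (hK : IsBody K) {ξ : Es n} (hξ : ξ ≠ 0) : 0 < supportFn K ξ := by
  have h := hK.inner_le_gauge_mul ξ ξ
  exact pos_of_mul_pos_right ((real_inner_self_pos.2 hξ).trans_le h) (gauge_nonneg _)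

lemma mem_gaussImage_iff (hK : IsBody K) {θ ξ : Es n} (hθ : θ ≠ 0) :
    ξ ∈ gaussImage K {θ} ↔ ‖ξ‖ = 1 ∧ gauge K θ * supportFn K ξ = ⟪θ, ξ⟫ := by
  have hg := hK.gauge_pos hθ
  simp only [gaussImage, mem_singleton_iff, iUnion_iUnion_eq_left, normalCone, mem_ofPred_eq,
    hK.radialFn_eq hθ, inner_sub_left, sub_nonpos, real_inner_smul_left]
  refine and_congr_right fun _ => ⟨fun h => ?_, fun h y hy => ?_⟩
  · refine le_antisymm ?_ (hK.inner_le_gauge_mul θ ξ)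
    rw [← le_inv_mul_iff₀ hg]
    refine csSup_le ⟨_, mem_image_of_mem _ (hK.radial_smul_mem hθ)⟩ ?_
    rintro _ ⟨y, hy, rfl⟩
    exact h y hy
  · rw [← h, inv_mul_cancel_left₀ hg.ne']
    exact hK.inner_le_supportFn hy ξ

lemma gaussImage_nonempty (hK : IsBody K) {θ : Es n} (hθ : θ ≠ 0) :
    (gaussImage K {θ}).Nonempty := by
  set x := (gauge K θ)⁻¹ • θ with hx
  have hg := hK.gauge_pos hθ
  have hxi : x ∉ interior K := by
    rw [← gauge_lt_one_iff_mem_interior hK.convex hK.mem_nhds, hx,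
      gauge_smul_of_nonneg (inv_pos.2 hg).le, smul_eq_mul, inv_mul_cancel₀ hg.ne']
    exact lt_irrefl _
  obtain ⟨l, hl⟩ := geometric_hahn_banach_open_point hK.convex.interior isOpen_interior hxi
  set η := (InnerProductSpace.toDual ℝ (Es n)).symm l with hη
  have hηl : ∀ y, ⟪y, η⟫ = l y := fun y => by
    rw [real_inner_comm, hη, InnerProductSpace.toDual_symm_apply]
  have hη0 : η ≠ 0 := by
    intro h0
    have h1 := hl 0 hK.zero_mem_interior
    rw [← hηl, ← hηl, h0] at h1
    simp at h1
  have hle : ∀ y ∈ K, ⟪y, η⟫ ≤ ⟪x, η⟫ := by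
    intro y hy
    have hcl : y ∈ closure (interior K) := by
      rw [hK.convex.closure_interior_eq_closure_of_nonempty_interior ⟨0, hK.zero_mem_interior⟩]
      exact subset_closure hy
    rw [hηl, hηl]
    exact closure_minimal (fun z hz => (hl z hz).le)
      (isClosed_le l.continuous continuous_const) hcl
  refine ⟨‖η‖⁻¹ • η, ?_⟩
  simp only [gaussImage, mem_singleton_iff, iUnion_iUnion_eq_left, normalCone, mem_ofPred_eq,
    hK.radialFn_eq hθ]
  refine ⟨by rw [norm_smul, norm_inv, norm_norm, inv_mul_cancel₀ (norm_ne_zero_iff.2 hη0)],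
    fun y hy => ?_⟩
  rw [real_inner_smul_right, inner_sub_left]
  exact mul_nonpos_of_nonneg_of_nonpos (by positivity) (sub_nonpos.2 (hle y hy))

end IsBody

section SphericalMeasure

variable {n : ℕ}

lemma mem_unitSphere {x : Es n} : x ∈ unitSphere n ↔ ‖x‖ = 1 := by
  simp [unitSphere]

lemma ne_zero_of_mem_unitSphere {x : Es n} (hx : x ∈ unitSphere n) : x ≠ 0 := by
  rintro rfl
  simp [mem_unitSphere] at hx

lemma isCompact_unitSphere : IsCompact (unitSphere n) := isCompact_sphere _ _

lemma measurableSet_unitSphere : MeasurableSet (unitSphere n) :=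
  isCompact_unitSphere.isClosed.measurableSet

lemma isAddHaarMeasure_orthogonal {a : Es n} (ha : a ∈ unitSphere n) :
    Measure.IsAddHaarMeasure (μH[(n : ℝ)] : Measure (Submodule.span ℝ {a})ᗮ) := by
  have : Fact (Module.finrank ℝ (Es n) = n + 1) := ⟨finrank_euclideanSpace_fin⟩
  have h := isAddHaarMeasure_hausdorffMeasure (E := (Submodule.span ℝ {a})ᗮ)
  rwa [Submodule.finrank_orthogonal_span_singleton (n := n) (ne_zero_of_mem_unitSphere ha)] at h

/-- The orthogonal projection onto the complement of a unit vector, in coordinates. -/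
lemma coe_orthogonalProjectionOnto_orthogonal {a : Es n} (ha : a ∈ unitSphere n) (x : Es n) :
    (((Submodule.span ℝ {a})ᗮ.orthogonalProjectionOnto x : (Submodule.span ℝ {a})ᗮ) : Es n)
      = x - ⟪a, x⟫ • a := by
  rw [Submodule.orthogonalProjectionOnto_orthogonal]
  exact congrArg (x - ·) (Submodule.starProjection_unit_singleton ℝ (mem_unitSphere.1 ha) x)

lemma sphMeasure_pos {U : Set (Es n)} (hU : IsOpen U) (hne : (U ∩ unitSphere n).Nonempty) :
    sphMeasure n (U ∩ unitSphere n) ≠ 0 := by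
  obtain ⟨a, haU, ha⟩ := hne
  have := isAddHaarMeasure_orthogonal ha
  set V := (Submodule.span ℝ {a})ᗮ with hV
  have hinner : ∀ y : V, ⟪a, (y : Es n)⟫ = 0 := fun y =>
    Submodule.mem_orthogonal_singleton_iff_inner_right.1 y.2
  have haa : ⟪a, a⟫ = 1 := by rw [real_inner_self_eq_norm_sq, mem_unitSphere.1 ha]; norm_num
  let ψ : V → Es n := fun y => (y : Es n) + √(1 - ‖y‖ ^ 2) • a
  have hψc : Continuous ψ := by fun_prop
  have hψ0 : ψ 0 = a := by simp [ψ]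
  have hO : IsOpen (ψ ⁻¹' U ∩ Metric.ball 0 1) := (hU.preimage hψc).inter Metric.isOpen_ball
  have hO0 : (0 : V) ∈ ψ ⁻¹' U ∩ Metric.ball 0 1 :=
    ⟨by rw [mem_preimage, hψ0]; exact haU, Metric.mem_ball_self one_pos⟩
  have hpos : (μH[(n : ℝ)] : Measure V) (ψ ⁻¹' U ∩ Metric.ball 0 1) ≠ 0 :=
    (hO.measure_pos _ ⟨0, hO0⟩).ne'
  intro h0
  apply hpos
  have hsub : ψ ⁻¹' U ∩ Metric.ball 0 1 ⊆ V.orthogonalProjectionOnto '' (U ∩ unitSphere n) := by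
    rintro y ⟨hyU, hy⟩
    have hy1 : ‖y‖ < 1 := by simpa using hy
    refine ⟨ψ y, ⟨hyU, ?_⟩, ?_⟩
    · rw [mem_unitSphere, ← sq_eq_sq₀ (norm_nonneg _) zero_le_one, ← real_inner_self_eq_norm_sq]
      have h1 : √(1 - ‖y‖ ^ 2) * √(1 - ‖y‖ ^ 2) = 1 - ‖y‖ ^ 2 :=
        Real.mul_self_sqrt (by nlinarith [norm_nonneg y])
      simp only [ψ, inner_add_left, inner_add_right, real_inner_smul_left, real_inner_smul_right,
        haa, hinner, real_inner_comm a]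
      rw [real_inner_self_eq_norm_sq, Submodule.norm_coe]
      linarith
    · apply Subtype.ext
      rw [coe_orthogonalProjectionOnto_orthogonal ha]
      simp only [ψ, inner_add_right, real_inner_smul_right, haa, hinner]
      simp
  refine measure_mono_null hsub (le_antisymm ?_ bot_le)
  have hlip : LipschitzWith 1 V.orthogonalProjectionOnto :=
    V.orthogonalProjectionOnto.lipschitz.weaken (Submodule.orthogonalProjectionOnto_norm_le V)
  refine (hlip.hausdorffMeasure_image_le (Nat.cast_nonneg n) _).trans ?_
  have h0' : (μH[(n : ℝ)] : Measure (Es n)) (U ∩ unitSphere n) = 0 := h0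
  simp [h0']

lemma sphMeasure_unitSphere_lt_top : sphMeasure n (unitSphere n) < ∞ := by
  refine isCompact_unitSphere.measure_lt_top_of_nhdsWithin fun a ha => ?_
  have := isAddHaarMeasure_orthogonal ha
  set V := (Submodule.span ℝ {a})ᗮ with hV
  have haa : ⟪a, a⟫ = 1 := by rw [real_inner_self_eq_norm_sq, mem_unitSphere.1 ha]; norm_num
  have hopen : IsOpen {x : Es n | 1 / 2 < ⟪a, x⟫} :=
    isOpen_lt continuous_const (continuous_const.inner continuous_id)
  set s : Set (Es n) := unitSphere n ∩ {x | 1 / 2 < ⟪a, x⟫} with hs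
  refine ⟨s, inter_mem_nhdsWithin _ (hopen.mem_nhds ?_), ?_⟩
  · rw [mem_ofPred_eq, haa]; norm_num
  set P := V.orthogonalProjectionOnto
  have hnorm : ∀ x : Es n, ‖x‖ ^ 2 = ‖P x‖ ^ 2 + ⟪a, x⟫ ^ 2 := by
    intro x
    rw [← Submodule.norm_coe, coe_orthogonalProjectionOnto_orthogonal ha,
      ← real_inner_self_eq_norm_sq (x - _), inner_sub_left, inner_sub_right, inner_sub_right,
      real_inner_smul_left, real_inner_smul_left, real_inner_smul_right, real_inner_smul_right,
      haa, real_inner_comm a x, real_inner_self_eq_norm_sq]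
    ring
  have hdist : ∀ x ∈ s, ∀ y ∈ s, ‖x - y‖ ≤ 3 * ‖P x - P y‖ := by
    rintro x ⟨hx1, hx2⟩ y ⟨hy1, hy2⟩
    simp only [mem_ofPred_eq] at hx2 hy2
    have hx := hnorm x
    have hy := hnorm y
    have hxy := hnorm (x - y)
    rw [mem_unitSphere] at hx1 hy1
    rw [hx1] at hx
    rw [hy1] at hy
    rw [map_sub, inner_sub_right] at hxy
    have hPx : ‖P x‖ ≤ 1 := by nlinarith [norm_nonneg (P x)]
    have hPy : ‖P y‖ ≤ 1 := by nlinarith [norm_nonneg (P y)]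
    have h1 : |‖P x‖ - ‖P y‖| ≤ ‖P x - P y‖ := abs_norm_sub_norm_le _ _
    have h2 : |⟪a, x⟫ - ⟪a, y⟫| ≤ 2 * ‖P x - P y‖ := by
      have h3 : |⟪a, x⟫ - ⟪a, y⟫| * (⟪a, x⟫ + ⟪a, y⟫) =
          |‖P x‖ - ‖P y‖| * (‖P x‖ + ‖P y‖) := by
        rw [← abs_of_pos (show 0 < ⟪a, x⟫ + ⟪a, y⟫ by linarith), ← abs_mul,
          ← abs_of_nonneg (show 0 ≤ ‖P x‖ + ‖P y‖ by positivity), ← abs_mul, ← abs_neg]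
        congr 1
        linarith
      nlinarith [abs_nonneg (⟪a, x⟫ - ⟪a, y⟫), abs_nonneg (‖P x‖ - ‖P y‖)]
    refine abs_le_of_sq_le_sq' ?_ (by positivity) |>.2
    rw [hxy]
    nlinarith [sq_le_sq' (by linarith [abs_nonneg (⟪a, x⟫ - ⟪a, y⟫), norm_nonneg (P x - P y)]) h2,
      sq_abs (⟪a, x⟫ - ⟪a, y⟫)]
  let ψ := Function.invFunOn P s
  have hψs : ∀ z ∈ P '' s, ψ z ∈ s ∧ P (ψ z) = z := fun z hz => Function.invFunOn_pos hz
  have hlip : LipschitzOnWith 3 ψ (P '' s) := by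
    refine LipschitzOnWith.of_dist_le_mul fun z hz w hw => ?_
    have h := hdist _ (hψs z hz).1 _ (hψs w hw).1
    rw [(hψs z hz).2, (hψs w hw).2] at h
    rwa [dist_eq_norm, dist_eq_norm]
  have himage : s ⊆ ψ '' (P '' s) := by
    intro x hx
    refine ⟨P x, mem_image_of_mem _ hx, ?_⟩
    have h := hψs _ (mem_image_of_mem P hx)
    have h' := hdist _ h.1 _ hx
    rw [h.2, sub_self, norm_zero, mul_zero] at h'
    exact sub_eq_zero.1 (norm_le_zero_iff.1 h')
  have hPs : P '' s ⊆ Metric.closedBall 0 1 := by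
    rintro _ ⟨x, hx, rfl⟩
    have h := hnorm x
    rw [mem_unitSphere.1 hx.1] at h
    rw [mem_closedBall_zero_iff]
    nlinarith [norm_nonneg (P x)]
  calc sphMeasure n s ≤ μH[(n : ℝ)] (ψ '' (P '' s)) := measure_mono himage
    _ ≤ _ := hlip.hausdorffMeasure_image_le (Nat.cast_nonneg n)
    _ ≤ _ := mul_le_mul_right (measure_mono hPs) _
    _ < ∞ := ENNReal.mul_lt_top (by simp) (isCompact_closedBall 0 1).measure_lt_top

end SphericalMeasure

section CommonSubgradient

open Filter Topology

/-- If `φ t * m t` is a subgradient of the convex function `φ` at every `t ∈ [0, 1]`, then `m` tends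
from the right to the right logarithmic derivative of `φ`. -/
lemma tendsto_log_subgradient {φ m : ℝ → ℝ} (hφ : ConvexOn ℝ univ φ) (hc : Continuous φ)
    (hpos : ∀ t ∈ Icc (0 : ℝ) 1, 0 < φ t)
    (h : ∀ t ∈ Icc (0 : ℝ) 1, ∀ s, φ t * (1 + m t * (s - t)) ≤ φ s) {t : ℝ}
    (ht : t ∈ Ico (0 : ℝ) 1) :
    Tendsto m (𝓝[>] t) (𝓝 (derivWithin φ (Ioi t) t / φ t)) := by
  set d := derivWithin φ (Ioi t) t
  have hslope : Tendsto (slope φ t) (𝓝[>] t) (𝓝 d) :=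
    (hasDerivWithinAt_iff_tendsto_slope' (lt_irrefl t)).1
      (hφ.hasDerivWithinAt_rightDeriv_of_mem_interior (by simp))
  have hrefl : Tendsto (fun s => 2 * s - t) (𝓝[>] t) (𝓝[>] t) := by
    refine tendsto_nhdsWithin_iff.2 ⟨?_, ?_⟩
    · have : Tendsto (fun s => 2 * s - t) (𝓝 t) (𝓝 (2 * t - t)) :=
        Continuous.tendsto (by fun_prop) t
      rw [show 2 * t - t = t by ring] at this
      exact this.mono_left nhdsWithin_le_nhds
    · filter_upwards [self_mem_nhdsWithin] with s hs
      simp only [mem_Ioi] at hs ⊢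
      linarith
  have hupper : Tendsto (fun s => 2 * slope φ t (2 * s - t) - slope φ t s) (𝓝[>] t) (𝓝 d) := by
    have := ((hslope.comp hrefl).const_mul 2).sub hslope
    rwa [show 2 * d - d = d by ring] at this
  have hIoc : ∀ᶠ s in 𝓝[>] t, s ∈ Ioc t 1 := Ioc_mem_nhdsGT ht.2
  have hmul : Tendsto (fun s => φ s * m s) (𝓝[>] t) (𝓝 d) := by
    refine tendsto_of_tendsto_of_tendsto_of_le_of_le' hslope hupper ?_ ?_
    · filter_upwards [hIoc] with s hs
      have h1 := h s ⟨ht.1.trans hs.1.le, hs.2⟩ t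
      rw [slope_def_field, div_le_iff₀ (sub_pos.2 hs.1)]
      linarith
    · filter_upwards [hIoc] with s hs
      have h1 := h s ⟨ht.1.trans hs.1.le, hs.2⟩ (2 * s - t)
      have hst : 0 < s - t := sub_pos.2 hs.1
      rw [slope_def_field, slope_def_field, show 2 * s - t - t = 2 * (s - t) by ring,
        show 2 * ((φ (2 * s - t) - φ t) / (2 * (s - t))) - (φ s - φ t) / (s - t)
          = (φ (2 * s - t) - φ s) / (s - t) by field_simp; ring, le_div_iff₀ hst]
      linarith
  refine (hmul.div ((hc.tendsto t).mono_left nhdsWithin_le_nhds)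
    (hpos t ⟨ht.1, ht.2.le⟩).ne').congr' ?_
  filter_upwards [hIoc] with s hs
  have := (hpos s ⟨ht.1.trans hs.1.le, hs.2⟩).ne'
  simp only [Pi.div_apply]
  field_simp

lemma div_eq_div_of_common_log_subgradient {φ ψ m : ℝ → ℝ}
    (hφ : ConvexOn ℝ univ φ) (hφc : Continuous φ) (hφ0 : ∀ t ∈ Icc (0 : ℝ) 1, 0 < φ t)
    (hφm : ∀ t ∈ Icc (0 : ℝ) 1, ∀ s, φ t * (1 + m t * (s - t)) ≤ φ s)
    (hψ : ConvexOn ℝ univ ψ) (hψc : Continuous ψ) (hψ0 : ∀ t ∈ Icc (0 : ℝ) 1, 0 < ψ t)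
    (hψm : ∀ t ∈ Icc (0 : ℝ) 1, ∀ s, ψ t * (1 + m t * (s - t)) ≤ ψ s) :
    φ 1 / ψ 1 = φ 0 / ψ 0 := by
  refine constant_of_has_deriv_right_zero (f := fun t => φ t / ψ t) (a := 0) (b := 1)
    (hφc.continuousOn.div hψc.continuousOn fun t ht => (hψ0 t ht).ne') (fun t ht => ?_) 1 (by simp)
  have ht' : t ∈ Icc (0 : ℝ) 1 := ⟨ht.1, ht.2.le⟩
  have hd := tendsto_nhds_unique (tendsto_log_subgradient hφ hφc hφ0 hφm ht)
    (tendsto_log_subgradient hψ hψc hψ0 hψm ht)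
  rw [div_eq_div_iff (hφ0 t ht').ne' (hψ0 t ht').ne'] at hd
  have h1 := (hφ.hasDerivWithinAt_rightDeriv_of_mem_interior (x := t) (by simp)).Ici_of_Ioi
  have h2 := (hψ.hasDerivWithinAt_rightDeriv_of_mem_interior (x := t) (by simp)).Ici_of_Ioi
  have := h1.div h2 (hψ0 t ht').ne'
  rwa [show derivWithin φ (Ioi t) t * ψ t - φ t * derivWithin ψ (Ioi t) t = 0 by linarith,
    zero_div] at this

variable {n : ℕ} {K L : Set (Es n)}

lemma IsBody.convexOn_gauge_line (hK : IsBody K) (x d : Es n) :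
    ConvexOn ℝ univ fun t : ℝ => gauge K (x + t • d) := by
  refine ⟨convex_univ, fun s _ t _ a b ha hb hab => ?_⟩
  simp only [smul_eq_mul]
  have : x + (a * s + b * t) • d = a • (x + s • d) + b • (x + t • d) := by
    have hx : x = (a + b) • x := by rw [hab, one_smul]
    nth_rewrite 1 [hx]
    module
  rw [this]
  refine (gauge_add_le hK.convex (absorbent_nhds_zero hK.mem_nhds) _ _).trans_eq ?_
  rw [gauge_smul_of_nonneg ha, gauge_smul_of_nonneg hb, smul_eq_mul, smul_eq_mul]

/-- Two gauges are subdifferentiable in a common direction at every nonzero point. -/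
def HasCommonNormals (K L : Set (Es n)) : Prop :=
  ∀ x : Es n, x ≠ 0 → ∃ v : Es n, ⟪x, v⟫ = 1 ∧
    ∀ y, gauge K x * ⟪y, v⟫ ≤ gauge K y ∧ gauge L x * ⟪y, v⟫ ≤ gauge L y

lemma HasCommonNormals.gauge_div_eq_of_segment (h : HasCommonNormals K L) (hK : IsBody K)
    (hL : IsBody L) {x y : Es n} (hxy : ∀ t : ℝ, x + t • (y - x) ≠ 0) :
    gauge K y / gauge L y = gauge K x / gauge L x := by
  choose v hv1 hv using fun t : ℝ => h _ (hxy t)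
  have hline : ∀ s t : ℝ, ⟪x + s • (y - x), v t⟫ = 1 + ⟪y - x, v t⟫ * (s - t) := by
    intro s t
    rw [← hv1 t, show x + s • (y - x) = (x + t • (y - x)) + (s - t) • (y - x) by module,
      inner_add_left, real_inner_smul_left]
    ring
  have key := div_eq_div_of_common_log_subgradient (m := fun t => ⟪y - x, v t⟫)
    (hK.convexOn_gauge_line x (y - x)) (hK.continuous_gauge.comp (by fun_prop))
    (fun t _ => hK.gauge_pos (hxy t)) (fun t _ s => by rw [← hline]; exact (hv t _).1)
    (hL.convexOn_gauge_line x (y - x)) (hL.continuous_gauge.comp (by fun_prop))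
    (fun t _ => hL.gauge_pos (hxy t)) (fun t _ s => by rw [← hline]; exact (hv t _).2)
  simpa using key

lemma add_smul_sub_ne_zero {x y : Es n} (hx : x ≠ 0) (hy : y ∉ Submodule.span ℝ {x}) (t : ℝ) :
    x + t • (y - x) ≠ 0 := by
  intro h0
  rcases eq_or_ne t 0 with rfl | ht
  · simp [hx] at h0
  · apply hy
    have h1 : t • y = (t - 1) • x := by
      rw [← sub_eq_zero, ← h0]
      module
    rw [Submodule.mem_span_singleton]
    exact ⟨t⁻¹ * (t - 1), by rw [mul_smul, ← h1, inv_smul_smul₀ ht]⟩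

lemma HasCommonNormals.gauge_div_eq (h : HasCommonNormals K L) (hn : 1 ≤ n) (hK : IsBody K)
    (hL : IsBody L) {x y : Es n} (hx : x ≠ 0) (hy : y ≠ 0) :
    gauge K y / gauge L y = gauge K x / gauge L x := by
  by_cases hyx : y ∈ Submodule.span ℝ {x}
  · have hne : Submodule.span ℝ {x} ≠ (⊤ : Submodule ℝ (Es n)) := by
      intro htop
      have h1 := finrank_span_singleton (K := ℝ) hx
      rw [htop, finrank_top, finrank_euclideanSpace_fin] at h1
      omega
    obtain ⟨z, -, hz⟩ := SetLike.exists_of_lt (lt_top_iff_ne_top.2 hne)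
    have hzy : z ∉ Submodule.span ℝ {y} := fun hz' =>
      hz ((Submodule.span_singleton_le_iff_mem _ _).2 hyx hz')
    rw [← h.gauge_div_eq_of_segment hK hL (add_smul_sub_ne_zero hx hz),
      h.gauge_div_eq_of_segment hK hL (add_smul_sub_ne_zero hy hzy)]
  · exact h.gauge_div_eq_of_segment hK hL (add_smul_sub_ne_zero hx hyx)

lemma HasCommonNormals.exists_eq_smul (h : HasCommonNormals K L) (hn : 1 ≤ n) (hK : IsBody K)
    (hL : IsBody L) : ∃ c : ℝ, 0 < c ∧ K = c • L := by
  obtain ⟨e, he⟩ := exists_ne (0 : Es n)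
  have hKe := hK.gauge_pos he
  have hLe := hL.gauge_pos he
  refine ⟨gauge L e / gauge K e, by positivity, ?_⟩
  ext x
  rw [mem_smul_set_iff_inv_smul_mem₀ (by positivity), ← hK.gauge_le_one_iff,
    ← hL.gauge_le_one_iff, gauge_smul_of_nonneg (by positivity), smul_eq_mul, inv_div]
  rcases eq_or_ne x 0 with rfl | hx
  · simp
  · rw [← h.gauge_div_eq hn hK hL he hx, div_mul_cancel₀ _ (hL.gauge_pos hx).ne']

end CommonSubgradient

/-- Layer-cake comparison: an inequality between the masses of all superlevel sets of `v` and `w`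
integrates to an inequality between the integrals of `v` and `w`. -/
lemma setLIntegral_mul_ofReal_le {X : Type*} [MeasurableSpace X] {σ : Measure X} {S : Set X}
    {F G : X → ℝ≥0∞} {v w : X → ℝ} (hF : AEMeasurable F (σ.restrict S))
    (hG : AEMeasurable G (σ.restrict S)) (hv : Measurable v) (hw : Measurable w)
    (hv0 : ∀ x, 0 ≤ v x) (hw0 : ∀ x, 0 ≤ w x)
    (h : ∀ t, 0 < t →
      ∫⁻ x in {x | t < v x} ∩ S, F x ∂σ ≤ ∫⁻ x in {x | t < w x} ∩ S, G x ∂σ) :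
    ∫⁻ x in S, F x * ENNReal.ofReal (v x) ∂σ ≤ ∫⁻ x in S, G x * ENNReal.ofReal (w x) ∂σ := by
  have layer : ∀ {H : X → ℝ≥0∞} {u : X → ℝ}, AEMeasurable H (σ.restrict S) → Measurable u →
      (∀ x, 0 ≤ u x) → ∫⁻ x in S, H x * ENNReal.ofReal (u x) ∂σ
        = ∫⁻ t in Ioi 0, ∫⁻ x in {x | t < u x} ∩ S, H x ∂σ := by
    intro H u hH hu hu0
    have h1 := lintegral_withDensity_eq_lintegral_mul₀ hH (g := fun x => ENNReal.ofReal (u x))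
      hu.ennreal_ofReal.aemeasurable
    simp only [Pi.mul_apply] at h1
    rw [← h1, lintegral_eq_lintegral_meas_lt _ (ae_of_all _ hu0) hu.aemeasurable]
    refine lintegral_congr fun t => ?_
    have hm : MeasurableSet {x | t < u x} := measurableSet_lt measurable_const hu
    rw [withDensity_apply _ hm, Measure.restrict_restrict hm]
  rw [layer hF hv hv0, layer hG hw hw0]
  exact setLIntegral_mono' measurableSet_Ioi h

section Comparison

variable {n : ℕ} {p q : ℝ} {f g : Es n → ℝ} {K L : Set (Es n)}

/-- `K` is an Aleksandrov solution of the `L_p` dual Minkowski problem with data `(f, g)`. -/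
def IsAleksandrovSolution (p q : ℝ) (f g : Es n → ℝ) (K : Set (Es n)) : Prop :=
  ∀ ω : Set (Es n), ω ⊆ unitSphere n → MeasurableSet ω →
    ∫⁻ θ in gaussImageInv K ω, ENNReal.ofReal (g θ * radialFn K θ ^ q) ∂(sphMeasure n)
      = ∫⁻ ξ in ω, ENNReal.ofReal (f ξ * supportFn K ξ ^ p) ∂(sphMeasure n)

lemma mem_gaussImageInv_iff (hK : IsBody K) {ω : Set (Es n)} {θ : Es n} :
    θ ∈ gaussImageInv K ω ↔ θ ∈ unitSphere n ∧
      ∃ ξ ∈ ω, ‖ξ‖ = 1 ∧ gauge K θ * supportFn K ξ = ⟪θ, ξ⟫ := by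
  refine and_congr_right fun hθ => ⟨?_, ?_⟩
  · rintro ⟨ξ, h1, h2⟩
    exact ⟨ξ, h2, (hK.mem_gaussImage_iff (ne_zero_of_mem_unitSphere hθ)).1 h1⟩
  · rintro ⟨ξ, h2, h1⟩
    exact ⟨ξ, (hK.mem_gaussImage_iff (ne_zero_of_mem_unitSphere hθ)).2 h1, h2⟩

lemma continuousOn_radial_density (hK : IsBody K) (hg : ContinuousOn g (unitSphere n)) :
    ContinuousOn (fun θ => g θ * radialFn K θ ^ q) (unitSphere n) := by
  refine hg.mul (ContinuousOn.rpow_const ?_ fun θ hθ => Or.inl ?_)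
  · refine (hK.continuous_gauge.continuousOn.inv₀ fun θ hθ =>
      (hK.gauge_pos (ne_zero_of_mem_unitSphere hθ)).ne').congr fun θ hθ =>
        hK.radialFn_eq (ne_zero_of_mem_unitSphere hθ)
  · have hθ0 := ne_zero_of_mem_unitSphere hθ
    rw [hK.radialFn_eq hθ0]
    exact (inv_pos.2 (hK.gauge_pos hθ0)).ne'

lemma aemeasurable_radial_density (hK : IsBody K) (hg : ContinuousOn g (unitSphere n)) :
    AEMeasurable (fun θ => ENNReal.ofReal (g θ * radialFn K θ ^ q))
      ((sphMeasure n).restrict (unitSphere n)) :=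
  ((continuousOn_radial_density hK hg).aemeasurable measurableSet_unitSphere).ennreal_ofReal

lemma measurable_support_density (hK : IsBody K) (hf : Measurable f) :
    Measurable fun ξ => ENNReal.ofReal (f ξ * supportFn K ξ ^ p) :=
  (hf.mul (hK.continuous_supportFn.measurable.pow_const p)).ennreal_ofReal

/-- A function of the normal which is bounded, along the Gauss image of `K`, by a function of the
direction has a smaller integral. -/
lemma IsAleksandrovSolution.lintegral_support_le (h : IsAleksandrovSolution p q f g K)
    (hK : IsBody K) (hf : Measurable f) (hg : ContinuousOn g (unitSphere n)) {v w : Es n → ℝ}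
    (hv : Measurable v) (hw : Measurable w) (hv0 : ∀ x, 0 ≤ v x) (hw0 : ∀ x, 0 ≤ w x)
    (hvw : ∀ θ ∈ unitSphere n, ∀ ξ ∈ unitSphere n,
      gauge K θ * supportFn K ξ = ⟪θ, ξ⟫ → v ξ ≤ w θ) :
    ∫⁻ ξ in unitSphere n, ENNReal.ofReal (f ξ * supportFn K ξ ^ p) * ENNReal.ofReal (v ξ)
        ∂(sphMeasure n)
      ≤ ∫⁻ θ in unitSphere n, ENNReal.ofReal (g θ * radialFn K θ ^ q) * ENNReal.ofReal (w θ)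
        ∂(sphMeasure n) := by
  refine setLIntegral_mul_ofReal_le (measurable_support_density hK hf).aemeasurable
    (aemeasurable_radial_density hK hg) hv hw hv0 hw0 fun t _ => ?_
  rw [← h _ inter_subset_right
    ((measurableSet_lt measurable_const hv).inter measurableSet_unitSphere)]
  refine lintegral_mono_set fun θ hθ => ?_
  obtain ⟨hθS, ξ, ⟨hξt, hξS⟩, -, heq⟩ := (mem_gaussImageInv_iff hK).1 hθ
  exact ⟨lt_of_lt_of_le hξt (hvw θ hθS ξ hξS heq), hθS⟩

/-- A function of the direction which is bounded, along the Gauss image of `K`, by a function of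
the normal has a smaller integral. -/
lemma IsAleksandrovSolution.lintegral_radial_le (h : IsAleksandrovSolution p q f g K)
    (hK : IsBody K) (hf : Measurable f) (hg : ContinuousOn g (unitSphere n)) {v w : Es n → ℝ}
    (hv : Measurable v) (hw : Measurable w) (hv0 : ∀ x, 0 ≤ v x) (hw0 : ∀ x, 0 ≤ w x)
    (hwv : ∀ θ ∈ unitSphere n, ∀ ξ ∈ unitSphere n,
      gauge K θ * supportFn K ξ = ⟪θ, ξ⟫ → w θ ≤ v ξ) :
    ∫⁻ θ in unitSphere n, ENNReal.ofReal (g θ * radialFn K θ ^ q) * ENNReal.ofReal (w θ)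
        ∂(sphMeasure n)
      ≤ ∫⁻ ξ in unitSphere n, ENNReal.ofReal (f ξ * supportFn K ξ ^ p) * ENNReal.ofReal (v ξ)
        ∂(sphMeasure n) := by
  refine setLIntegral_mul_ofReal_le (aemeasurable_radial_density hK hg)
    (measurable_support_density hK hf).aemeasurable hw hv hw0 hv0 fun t _ => ?_
  rw [← h _ inter_subset_right
    ((measurableSet_lt measurable_const hv).inter measurableSet_unitSphere)]
  refine lintegral_mono_set ?_
  rintro θ ⟨hθt, hθS⟩
  have hθ0 := ne_zero_of_mem_unitSphere hθS
  obtain ⟨ξ, hξ⟩ := hK.gaussImage_nonempty hθ0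
  rw [hK.mem_gaussImage_iff hθ0] at hξ
  have hξS : ξ ∈ unitSphere n := mem_unitSphere.2 hξ.1
  exact (mem_gaussImageInv_iff hK).2
    ⟨hθS, ξ, ⟨lt_of_lt_of_le hθt (hwv θ hθS ξ hξS hξ.2), hξS⟩, hξ⟩

/-- The quotient `ρ_K / ρ_L` of the radial functions. -/
def radialRatio (K L : Set (Es n)) (θ : Es n) : ℝ := gauge L θ / gauge K θ

/-- The quotient `h_K / h_L` of the support functions. -/
def supportRatio (K L : Set (Es n)) (ξ : Es n) : ℝ := supportFn K ξ / supportFn L ξ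

lemma radialRatio_pos (hK : IsBody K) (hL : IsBody L) {θ : Es n} (hθ : θ ∈ unitSphere n) :
    0 < radialRatio K L θ :=
  div_pos (hL.gauge_pos (ne_zero_of_mem_unitSphere hθ))
    (hK.gauge_pos (ne_zero_of_mem_unitSphere hθ))

lemma radialRatio_nonneg (θ : Es n) : 0 ≤ radialRatio K L θ :=
  div_nonneg (gauge_nonneg _) (gauge_nonneg _)

lemma supportRatio_pos (hK : IsBody K) (hL : IsBody L) {ξ : Es n} (hξ : ξ ∈ unitSphere n) :
    0 < supportRatio K L ξ :=
  div_pos (hK.supportFn_pos (ne_zero_of_mem_unitSphere hξ))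
    (hL.supportFn_pos (ne_zero_of_mem_unitSphere hξ))

lemma supportRatio_nonneg (hK : IsBody K) (hL : IsBody L) (ξ : Es n) :
    0 ≤ supportRatio K L ξ := by
  rcases eq_or_ne ξ 0 with rfl | hξ
  · have : supportFn K 0 = 0 := by
      simp [supportFn, Set.Nonempty.image_const ⟨0, interior_subset hK.zero_mem_interior⟩]
    simp [supportRatio, this]
  · exact (div_pos (hK.supportFn_pos hξ) (hL.supportFn_pos hξ)).le

lemma measurable_radialRatio (hK : IsBody K) (hL : IsBody L) : Measurable (radialRatio K L) :=
  hL.continuous_gauge.measurable.div hK.continuous_gauge.measurable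

lemma measurable_supportRatio (hK : IsBody K) (hL : IsBody L) : Measurable (supportRatio K L) :=
  hK.continuous_supportFn.measurable.div hL.continuous_supportFn.measurable

lemma supportRatio_le_radialRatio (hK : IsBody K) (hL : IsBody L) {θ ξ : Es n}
    (hθ : θ ∈ unitSphere n) (hξ : ξ ∈ unitSphere n) (h : gauge K θ * supportFn K ξ = ⟪θ, ξ⟫) :
    supportRatio K L ξ ≤ radialRatio K L θ := by
  rw [supportRatio, radialRatio, div_le_div_iff₀ (hL.supportFn_pos (ne_zero_of_mem_unitSphere hξ))
    (hK.gauge_pos (ne_zero_of_mem_unitSphere hθ)), mul_comm, h]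
  exact hL.inner_le_gauge_mul θ ξ

lemma radialRatio_le_supportRatio (hK : IsBody K) (hL : IsBody L) {θ ξ : Es n}
    (hθ : θ ∈ unitSphere n) (hξ : ξ ∈ unitSphere n) (h : gauge L θ * supportFn L ξ = ⟪θ, ξ⟫) :
    radialRatio K L θ ≤ supportRatio K L ξ := by
  rw [supportRatio, radialRatio, div_le_div_iff₀ (hK.gauge_pos (ne_zero_of_mem_unitSphere hθ))
    (hL.supportFn_pos (ne_zero_of_mem_unitSphere hξ)), h, mul_comm]
  exact hK.inner_le_gauge_mul θ ξ

lemma monotoneOn_mul_rpow {B : ℝ → ℝ} (hB : Monotone B) (hB0 : ∀ x, 0 ≤ x → 0 ≤ B x) {c : ℝ}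
    (hc : 0 ≤ c) : MonotoneOn (fun x => B x * x ^ c) (Ici 0) := fun _ hx y hy hxy =>
  mul_le_mul (hB hxy) (Real.rpow_le_rpow hx hxy hc) (Real.rpow_nonneg hx _) (hB0 y hy)

/-- The integral comparison behind uniqueness, for the weight `x ↦ B x * x ^ |p|`. -/
lemma lintegral_radialRatio_le (hK : IsBody K) (hL : IsBody L)
    (hsK : IsAleksandrovSolution p q f g K) (hsL : IsAleksandrovSolution p q f g L)
    (hf : Measurable f) (hg : ContinuousOn g (unitSphere n))
    (hf0 : ∀ ξ ∈ unitSphere n, 0 < f ξ) (hg0 : ∀ θ ∈ unitSphere n, 0 < g θ)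
    {B : ℝ → ℝ} (hB : Monotone B) (hB0 : ∀ x, 0 ≤ x → 0 ≤ B x)
    {w : Es n → ℝ} (hw : Measurable w) (hw0 : ∀ x, 0 ≤ w x)
    (hBw : ∀ θ ∈ unitSphere n, ∀ ξ ∈ unitSphere n, gauge K θ * supportFn K ξ = ⟪θ, ξ⟫ →
      B (supportRatio K L ξ) * supportRatio K L ξ ^ |p| ≤ w θ) :
    ∫⁻ θ in unitSphere n, ENNReal.ofReal (g θ * radialFn K θ ^ q) *
        ENNReal.ofReal (B (radialRatio K L θ) * radialRatio K L θ ^ |p|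
          * radialRatio K L θ ^ (p - q)) ∂(sphMeasure n)
      ≤ ∫⁻ θ in unitSphere n, ENNReal.ofReal (g θ * radialFn K θ ^ q) * ENNReal.ofReal (w θ)
        ∂(sphMeasure n) := by
  have hp : 0 ≤ |p| + p := by linarith [neg_abs_le p]
  have hr := measurable_radialRatio hK hL
  have hs := measurable_supportRatio hK hL
  have h1 := hsK.lintegral_support_le hK hf hg
    (v := fun ξ => B (supportRatio K L ξ) * supportRatio K L ξ ^ |p|)
    ((hB.measurable.comp hs).mul (hs.pow_const _)) hw
    (fun ξ => mul_nonneg (hB0 _ (supportRatio_nonneg hK hL ξ))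
      (Real.rpow_nonneg (supportRatio_nonneg hK hL ξ) _)) hw0 hBw
  have h2 := hsL.lintegral_radial_le hL hf hg
    (v := fun ξ => B (supportRatio K L ξ) * supportRatio K L ξ ^ (|p| + p))
    (w := fun θ => B (radialRatio K L θ) * radialRatio K L θ ^ (|p| + p))
    ((hB.measurable.comp hs).mul (hs.pow_const _))
    ((hB.measurable.comp hr).mul (hr.pow_const _))
    (fun ξ => mul_nonneg (hB0 _ (supportRatio_nonneg hK hL ξ))
      (Real.rpow_nonneg (supportRatio_nonneg hK hL ξ) _))
    (fun θ => mul_nonneg (hB0 _ (radialRatio_nonneg θ))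
      (Real.rpow_nonneg (radialRatio_nonneg θ) _))
    (fun θ hθ ξ hξ h => monotoneOn_mul_rpow hB hB0 hp (radialRatio_nonneg θ)
      (supportRatio_nonneg hK hL ξ) (radialRatio_le_supportRatio hK hL hθ hξ h))
  refine le_trans (le_of_eq ?_) (h2.trans (le_trans (le_of_eq ?_) h1))
  · refine setLIntegral_congr_fun measurableSet_unitSphere fun θ hθ => ?_
    have hθ0 := ne_zero_of_mem_unitSphere hθ
    have hrpos := radialRatio_pos hK hL hθ
    have hKθ := inv_pos.2 (hK.gauge_pos hθ0)
    have hLθ := inv_pos.2 (hL.gauge_pos hθ0)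
    have hgθ := (hg0 θ hθ).le
    have hKL : radialFn K θ = radialRatio K L θ * (gauge L θ)⁻¹ := by
      rw [hK.radialFn_eq hθ0, radialRatio]
      field_simp [(hL.gauge_pos hθ0).ne']
    rw [← ENNReal.ofReal_mul (by rw [hK.radialFn_eq hθ0]; positivity),
      ← ENNReal.ofReal_mul (by rw [hL.radialFn_eq hθ0]; positivity), hKL, hL.radialFn_eq hθ0,
      Real.mul_rpow hrpos.le hLθ.le, Real.rpow_add hrpos, Real.rpow_sub hrpos]
    congr 1
    field_simp
  · refine setLIntegral_congr_fun measurableSet_unitSphere fun ξ hξ => ?_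
    have hξ0 := ne_zero_of_mem_unitSphere hξ
    have hrpos := supportRatio_pos hK hL hξ
    have hKξ := hK.supportFn_pos hξ0
    have hLξ := hL.supportFn_pos hξ0
    have hfξ := (hf0 ξ hξ).le
    have hKL : supportFn K ξ = supportRatio K L ξ * supportFn L ξ := by
      rw [supportRatio, div_mul_cancel₀ _ hLξ.ne']
    rw [← ENNReal.ofReal_mul (by positivity), ← ENNReal.ofReal_mul (by positivity), hKL,
      Real.mul_rpow hrpos.le hLξ.le, Real.rpow_add hrpos]
    congr 1
    ring

/-- There is no strict gap between the two sides of `lintegral_radialRatio_le`. -/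
lemma not_lt_on_open (hK : IsBody K) (hL : IsBody L)
    (hsK : IsAleksandrovSolution p q f g K) (hsL : IsAleksandrovSolution p q f g L)
    (hf : Measurable f) (hg : ContinuousOn g (unitSphere n))
    (hf0 : ∀ ξ ∈ unitSphere n, 0 < f ξ) (hg0 : ∀ θ ∈ unitSphere n, 0 < g θ)
    {B : ℝ → ℝ} (hB : Monotone B) (hB0 : ∀ x, 0 ≤ x → 0 ≤ B x)
    {w : Es n → ℝ} (hw : Measurable w) (hw0 : ∀ x, 0 ≤ w x)
    (hBw : ∀ θ ∈ unitSphere n, ∀ ξ ∈ unitSphere n, gauge K θ * supportFn K ξ = ⟪θ, ξ⟫ →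
      B (supportRatio K L ξ) * supportRatio K L ξ ^ |p| ≤ w θ)
    (hwB : ∀ θ ∈ unitSphere n, w θ ≤ B (radialRatio K L θ) * radialRatio K L θ ^ |p|)
    (hwB' : ∀ θ ∈ unitSphere n, w θ ≤ B (radialRatio K L θ) * radialRatio K L θ ^ |p|
      * radialRatio K L θ ^ (p - q))
    {U : Set (Es n)} (hU : IsOpen U) (hUne : (U ∩ unitSphere n).Nonempty)
    (hlt : ∀ θ ∈ U ∩ unitSphere n, w θ < B (radialRatio K L θ) * radialRatio K L θ ^ |p|
      * radialRatio K L θ ^ (p - q)) : False := by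
  have hr := measurable_radialRatio hK hL
  have hdens : ∀ θ ∈ unitSphere n, 0 < g θ * radialFn K θ ^ q := fun θ hθ => by
    have hθ0 := ne_zero_of_mem_unitSphere hθ
    rw [hK.radialFn_eq hθ0]
    exact mul_pos (hg0 θ hθ) (Real.rpow_pos_of_pos (inv_pos.2 (hK.gauge_pos hθ0)) _)
  refine (lintegral_radialRatio_le hK hL hsK hsL hf hg hf0 hg0 hB hB0 hw hw0 hBw).not_gt ?_
  refine lintegral_strict_mono_of_ae_le_of_ae_lt_on (s := U) ?_ ?_ ?_ ?_ ?_
  · exact (aemeasurable_radial_density hK hg).mul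
      (((hB.measurable.comp hr).mul (hr.pow_const _)).mul
        (hr.pow_const _)).ennreal_ofReal.aemeasurable
  · obtain ⟨M, hM⟩ := isCompact_unitSphere.bddAbove_image
      (continuousOn_radial_density (q := q) hK hg)
    have hrc : ContinuousOn (radialRatio K L) (unitSphere n) :=
      hL.continuous_gauge.continuousOn.div hK.continuous_gauge.continuousOn fun θ hθ =>
        (hK.gauge_pos (ne_zero_of_mem_unitSphere hθ)).ne'
    obtain ⟨R, hR⟩ := isCompact_unitSphere.bddAbove_image hrc
    refine ((setLIntegral_mono' (g := fun _ => ENNReal.ofReal M *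
      ENNReal.ofReal (B R * R ^ |p|)) measurableSet_unitSphere fun θ hθ => ?_).trans_lt ?_).ne
    · have h1 : radialRatio K L θ ≤ R := hR (mem_image_of_mem _ hθ)
      gcongr
      · exact hM (mem_image_of_mem _ hθ)
      · exact (hwB θ hθ).trans (monotoneOn_mul_rpow hB hB0 (abs_nonneg p)
          (radialRatio_nonneg θ) ((radialRatio_nonneg θ).trans h1) h1)
    · rw [setLIntegral_const]
      exact ENNReal.mul_lt_top (ENNReal.mul_lt_top ENNReal.ofReal_lt_top ENNReal.ofReal_lt_top)
        sphMeasure_unitSphere_lt_top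
  · filter_upwards [ae_restrict_mem measurableSet_unitSphere] with θ hθ
    gcongr
    exact hwB' θ hθ
  · rw [Measure.restrict_apply hU.measurableSet]
    exact sphMeasure_pos hU hUne
  · filter_upwards [ae_restrict_mem measurableSet_unitSphere] with θ hθ hθU
    rw [← ENNReal.ofReal_mul (hdens θ hθ).le, ← ENNReal.ofReal_mul (hdens θ hθ).le]
    have h1 := hlt θ ⟨hθU, hθ⟩
    exact (ENNReal.ofReal_lt_ofReal_iff (mul_pos (hdens θ hθ) ((hw0 θ).trans_lt h1))).2
      (mul_lt_mul_of_pos_left h1 (hdens θ hθ))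

/-- For `p > q`, every solution is contained in every other one. -/
lemma subset_of_isAleksandrovSolution (hpq : q < p) (hK : IsBody K) (hL : IsBody L)
    (hsK : IsAleksandrovSolution p q f g K) (hsL : IsAleksandrovSolution p q f g L)
    (hf : Measurable f) (hg : ContinuousOn g (unitSphere n))
    (hf0 : ∀ ξ ∈ unitSphere n, 0 < f ξ) (hg0 : ∀ θ ∈ unitSphere n, 0 < g θ) : K ⊆ L := by
  have hB : Monotone fun x : ℝ => max (x - 1) 0 := fun x y hxy => by
    dsimp only; gcongr
  have hr := measurable_radialRatio hK hL
  have hw0 : ∀ θ, 0 ≤ max (radialRatio K L θ - 1) 0 * radialRatio K L θ ^ |p| := fun θ =>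
    mul_nonneg (le_max_right _ _) (Real.rpow_nonneg (radialRatio_nonneg θ) _)
  have hlt : ∀ θ ∈ unitSphere n, 1 < radialRatio K L θ →
      max (radialRatio K L θ - 1) 0 * radialRatio K L θ ^ |p| <
        max (radialRatio K L θ - 1) 0 * radialRatio K L θ ^ |p|
          * radialRatio K L θ ^ (p - q) := by
    intro θ hθ h1
    refine lt_mul_of_one_lt_right (mul_pos (lt_max_of_lt_left (sub_pos.2 h1))
      (Real.rpow_pos_of_pos (one_pos.trans h1) _)) (Real.one_lt_rpow h1 (sub_pos.2 hpq))
  have key : ∀ θ ∈ unitSphere n, gauge L θ ≤ gauge K θ := by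
    intro θ hθ
    by_contra! hθlt
    refine not_lt_on_open hK hL hsK hsL hf hg hf0 hg0 hB (fun x _ => le_max_right _ _)
      (w := fun θ => max (radialRatio K L θ - 1) 0 * radialRatio K L θ ^ |p|)
      ((hB.measurable.comp hr).mul (hr.pow_const _)) hw0
      (fun θ hθ ξ hξ h => monotoneOn_mul_rpow hB (fun x _ => le_max_right _ _) (abs_nonneg p)
        (supportRatio_nonneg hK hL ξ) (radialRatio_nonneg θ)
        (supportRatio_le_radialRatio hK hL hθ hξ h))
      (fun θ _ => le_rfl) (fun θ hθ => ?_)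
      (isOpen_lt hK.continuous_gauge hL.continuous_gauge) ⟨θ, hθlt, hθ⟩ ?_
    · rcases le_or_gt (radialRatio K L θ) 1 with h1 | h1
      · simp [max_eq_right (sub_nonpos.2 h1)]
      · exact (hlt θ hθ h1).le
    · rintro η ⟨hη1, hη⟩
      exact hlt η hη ((one_lt_div (hK.gauge_pos (ne_zero_of_mem_unitSphere hη))).2 hη1)
  intro x hx
  rcases eq_or_ne x 0 with rfl | hx0
  · exact interior_subset hL.zero_mem_interior
  have h1 := key (‖x‖⁻¹ • x) (by
    rw [mem_unitSphere, norm_smul, norm_inv, norm_norm, inv_mul_cancel₀ (norm_ne_zero_iff.2 hx0)])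
  rw [gauge_smul_of_nonneg (by positivity), gauge_smul_of_nonneg (by positivity), smul_eq_mul,
    smul_eq_mul, mul_le_mul_iff_right₀ (inv_pos.2 (norm_pos_iff.2 hx0))] at h1
  exact hL.gauge_le_one_iff.1 (h1.trans (gauge_le_one_of_mem hx))

/-- The directions at which some normal of `K` satisfies `s ≤ h_K / h_L` form a compact set. -/
lemma isCompact_setOf_exists_normal (hK : IsBody K) (hL : IsBody L) (s : ℝ) :
    IsCompact {θ : Es n | θ ∈ unitSphere n ∧ ∃ ξ ∈ unitSphere n,
      gauge K θ * supportFn K ξ = ⟪θ, ξ⟫ ∧ s * supportFn L ξ ≤ supportFn K ξ} := by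
  have hKg := hK.continuous_gauge
  have hKh := hK.continuous_supportFn
  have hLh := hL.continuous_supportFn
  have h1 : IsClosed {z : Es n × Es n | gauge K z.1 * supportFn K z.2 = ⟪z.1, z.2⟫} :=
    isClosed_eq (by fun_prop) (by fun_prop)
  have h2 : IsClosed {z : Es n × Es n | s * supportFn L z.2 ≤ supportFn K z.2} :=
    isClosed_le (by fun_prop) (by fun_prop)
  have hc : IsCompact ((unitSphere n ×ˢ unitSphere n) ∩
      {z : Es n × Es n | gauge K z.1 * supportFn K z.2 = ⟪z.1, z.2⟫ ∧
        s * supportFn L z.2 ≤ supportFn K z.2}) :=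
    (isCompact_unitSphere.prod isCompact_unitSphere).inter_right (h1.inter h2)
  convert hc.image continuous_fst using 1
  ext θ
  constructor
  · rintro ⟨hθ, ξ, hξ, h⟩
    exact ⟨(θ, ξ), ⟨⟨hθ, hξ⟩, h⟩, rfl⟩
  · rintro ⟨⟨θ', ξ⟩, ⟨⟨hθ, hξ⟩, h⟩, rfl⟩
    exact ⟨hθ, ξ, hξ, h⟩

lemma exists_normal_of_lt_radialRatio (hK : IsBody K) (hL : IsBody L)
    (hsK : IsAleksandrovSolution p p f g K) (hsL : IsAleksandrovSolution p p f g L)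
    (hf : Measurable f) (hg : ContinuousOn g (unitSphere n))
    (hf0 : ∀ ξ ∈ unitSphere n, 0 < f ξ) (hg0 : ∀ θ ∈ unitSphere n, 0 < g θ)
    {θ : Es n} (hθ : θ ∈ unitSphere n) {s : ℝ} (hs0 : 0 < s) (hs : s < radialRatio K L θ) :
    ∃ ξ ∈ unitSphere n, gauge K θ * supportFn K ξ = ⟪θ, ξ⟫ ∧
      s * supportFn L ξ ≤ supportFn K ξ := by
  classical
  by_contra hno
  set C := {θ : Es n | θ ∈ unitSphere n ∧ ∃ ξ ∈ unitSphere n,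
      gauge K θ * supportFn K ξ = ⟪θ, ξ⟫ ∧ s * supportFn L ξ ≤ supportFn K ξ} with hC
  have hCc : IsClosed C := (isCompact_setOf_exists_normal hK hL s).isClosed
  set U : Set (Es n) := {θ | s * gauge K θ < gauge L θ} ∩ Cᶜ with hU
  have hUo : IsOpen U :=
    (isOpen_lt (hK.continuous_gauge.const_mul s) hL.continuous_gauge).inter hCc.isOpen_compl
  have hlt_iff : ∀ η ∈ unitSphere n, s * gauge K η < gauge L η ↔ s < radialRatio K L η :=
    fun η hη => (lt_div_iff₀ (hK.gauge_pos (ne_zero_of_mem_unitSphere hη))).symm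
  have hUr : ∀ η ∈ U ∩ unitSphere n, s < radialRatio K L η := fun η hη =>
    (hlt_iff η hη.2).1 hη.1.1
  have hθU : θ ∈ U := ⟨(hlt_iff θ hθ).2 hs, fun h => hno h.2⟩
  have hr := measurable_radialRatio hK hL
  have hmono := monotoneOn_mul_rpow monotone_id (fun _ hx => hx) (abs_nonneg p)
  have hstrict : ∀ η ∈ U ∩ unitSphere n,
      s * s ^ |p| < radialRatio K L η * radialRatio K L η ^ |p| := fun η hη =>
    mul_lt_mul (hUr η hη) (Real.rpow_le_rpow hs0.le (hUr η hη).le (abs_nonneg p))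
      (Real.rpow_pos_of_pos hs0 _) (radialRatio_nonneg η)
  have hwle : ∀ η ∈ unitSphere n, (if η ∈ U then s * s ^ |p|
      else radialRatio K L η * radialRatio K L η ^ |p|)
        ≤ radialRatio K L η * radialRatio K L η ^ |p| := by
    intro η hη
    split_ifs with hηU
    · exact (hstrict η ⟨hηU, hη⟩).le
    · exact le_rfl
  refine not_lt_on_open hK hL hsK hsL hf hg hf0 hg0 monotone_id (fun _ hx => hx)
    (w := fun η => if η ∈ U then s * s ^ |p|
      else radialRatio K L η * radialRatio K L η ^ |p|)
    (Measurable.ite hUo.measurableSet measurable_const (hr.mul (hr.pow_const _)))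
    (fun η => ?_) (fun η hη ξ hξ h => ?_) hwle (fun η hη => ?_) hUo ⟨θ, hθU, hθ⟩ (fun η hη => ?_)
  · split_ifs
    · positivity
    · exact mul_nonneg (radialRatio_nonneg η) (Real.rpow_nonneg (radialRatio_nonneg η) _)
  · split_ifs with hηU
    · refine hmono (supportRatio_nonneg hK hL ξ) hs0.le ?_
      rw [supportRatio, div_le_iff₀ (hL.supportFn_pos (ne_zero_of_mem_unitSphere hξ))]
      by_contra! hlt
      exact hηU.2 ⟨hη, ξ, hξ, h, hlt.le⟩
    · exact hmono (supportRatio_nonneg hK hL ξ) (radialRatio_nonneg η)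
        (supportRatio_le_radialRatio hK hL hη hξ h)
  · simpa using hwle η hη
  · simpa [hη.1] using hstrict η hη

lemma hasCommonNormals_of_isAleksandrovSolution (hK : IsBody K) (hL : IsBody L)
    (hsK : IsAleksandrovSolution p p f g K) (hsL : IsAleksandrovSolution p p f g L)
    (hf : Measurable f) (hg : ContinuousOn g (unitSphere n))
    (hf0 : ∀ ξ ∈ unitSphere n, 0 < f ξ) (hg0 : ∀ θ ∈ unitSphere n, 0 < g θ) :
    HasCommonNormals K L := by
  intro x hx
  have hxn := norm_pos_iff.2 hx
  have hθ : ‖x‖⁻¹ • x ∈ unitSphere n := by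
    rw [mem_unitSphere, norm_smul, norm_inv, norm_norm, inv_mul_cancel₀ hxn.ne']
  set θ := ‖x‖⁻¹ • x with hθx
  have hKg := hK.continuous_gauge
  have hKh := hK.continuous_supportFn
  have hLh := hL.continuous_supportFn
  have hcomp : IsCompact (unitSphere n ∩ {ξ | gauge K θ * supportFn K ξ = ⟪θ, ξ⟫}) :=
    isCompact_unitSphere.inter_right (isClosed_eq (by fun_prop) (by fun_prop))
  have hex := fun s hs0 hs => exists_normal_of_lt_radialRatio (s := s) hK hL hsK hsL hf hg hf0 hg0
    hθ hs0 hs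
  have hrpos := radialRatio_pos hK hL hθ
  have hcont : ContinuousOn (supportRatio K L)
      (unitSphere n ∩ {ξ | gauge K θ * supportFn K ξ = ⟪θ, ξ⟫}) :=
    hKh.continuousOn.div hLh.continuousOn fun ξ hξ =>
      (hL.supportFn_pos (ne_zero_of_mem_unitSphere hξ.1)).ne'
  obtain ⟨ξ, ⟨hξ, hKξ⟩, hmax⟩ := hcomp.exists_isMaxOn (by
    obtain ⟨ξ, hξ, h, -⟩ := hex _ (half_pos hrpos) (half_lt_self hrpos)
    exact ⟨ξ, hξ, h⟩) hcont
  have hξ0 := ne_zero_of_mem_unitSphere hξ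
  have hKpos := hK.supportFn_pos hξ0
  have hLpos := hL.supportFn_pos hξ0
  have hle : radialRatio K L θ ≤ supportRatio K L ξ := by
    refine le_of_forall_lt_imp_le_of_dense fun s hs => ?_
    rcases le_or_gt s 0 with hs0 | hs0
    · exact hs0.trans (supportRatio_nonneg hK hL ξ)
    obtain ⟨η, hη, h, hsη⟩ := hex s hs0 hs
    refine le_trans ?_ (hmax ⟨hη, h⟩)
    rwa [supportRatio, le_div_iff₀ (hL.supportFn_pos (ne_zero_of_mem_unitSphere hη))]
  have hLξ : gauge L θ * supportFn L ξ = ⟪θ, ξ⟫ := by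
    refine le_antisymm ?_ (hL.inner_le_gauge_mul θ ξ)
    rw [radialRatio, supportRatio,
      div_le_div_iff₀ (hK.gauge_pos (ne_zero_of_mem_unitSphere hθ)) hLpos] at hle
    rw [← hKξ, mul_comm (gauge K θ)]
    exact hle
  have hscale : ∀ {M : Set (Es n)}, gauge M θ * supportFn M ξ = ⟪θ, ξ⟫ →
      gauge M x * supportFn M ξ = ⟪x, ξ⟫ := by
    intro M h
    rw [hθx, gauge_smul_of_nonneg (by positivity), smul_eq_mul, real_inner_smul_left,
      mul_assoc] at h
    exact mul_left_cancel₀ (inv_pos.2 hxn).ne' h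
  have hKx := hscale hKξ
  have hLx := hscale hLξ
  have hpos : 0 < ⟪x, ξ⟫ := hKx ▸ mul_pos (hK.gauge_pos hx) hKpos
  have hsub : ∀ {M : Set (Es n)}, IsBody M → gauge M x * supportFn M ξ = ⟪x, ξ⟫ → ∀ y,
      gauge M x * ⟪y, ⟪x, ξ⟫⁻¹ • ξ⟫ ≤ gauge M y := by
    intro M hM h y
    have hMx := hM.gauge_pos hx
    rw [real_inner_smul_right, ← mul_assoc, ← div_eq_mul_inv, div_mul_eq_mul_div,
      div_le_iff₀ hpos, ← h, mul_comm (gauge M x) (supportFn M ξ), ← mul_assoc,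
      mul_comm (gauge M x)]
    exact mul_le_mul_of_nonneg_right (hM.inner_le_gauge_mul y ξ) hMx.le
  refine ⟨⟪x, ξ⟫⁻¹ • ξ, ?_, fun y => ⟨hsub hK hKx y, hsub hL hLx y⟩⟩
  rw [real_inner_smul_right, inv_mul_cancel₀ hpos.ne']

end Comparison

/-- Theorem 1.6 (Theorem `thm:Lp DMP 0`): uniqueness for the `L_p` dual Minkowski problem
when `p > q` (uniqueness up to dilation when `p = q`). -/
theorem statement_4 {n : ℕ} (hn : 1 ≤ n) (p q : ℝ)
    (f g : Es n → ℝ) (hfm : Measurable f)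
    (lam Lam : ℝ) (hlam : 0 < lam) (hLam : lam ≤ Lam)
    (hfb : ∀ ξ ∈ unitSphere n, lam ≤ f ξ ∧ f ξ ≤ Lam)
    (hgpos : ∀ θ ∈ unitSphere n, 0 < g θ)
    (Lg : NNReal) (hglip : LipschitzOnWith Lg g (unitSphere n))
    (K₁ K₂ : Set (Es n))
    (hK₁c : IsCompact K₁) (hK₁conv : Convex ℝ K₁) (hK₁0 : (0 : Es n) ∈ interior K₁)
    (hK₂c : IsCompact K₂) (hK₂conv : Convex ℝ K₂) (hK₂0 : (0 : Es n) ∈ interior K₂)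
    (hsol₁ : ∀ ω : Set (Es n), ω ⊆ unitSphere n → MeasurableSet ω →
      ∫⁻ θ in gaussImageInv K₁ ω, ENNReal.ofReal (g θ * radialFn K₁ θ ^ q) ∂(sphMeasure n)
        = ∫⁻ ξ in ω, ENNReal.ofReal (f ξ * supportFn K₁ ξ ^ p) ∂(sphMeasure n))
    (hsol₂ : ∀ ω : Set (Es n), ω ⊆ unitSphere n → MeasurableSet ω →
      ∫⁻ θ in gaussImageInv K₂ ω, ENNReal.ofReal (g θ * radialFn K₂ θ ^ q) ∂(sphMeasure n)
        = ∫⁻ ξ in ω, ENNReal.ofReal (f ξ * supportFn K₂ ξ ^ p) ∂(sphMeasure n)) :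
    (p > q → K₁ = K₂) ∧ (p = q → ∃ c : ℝ, 0 < c ∧ K₁ = c • K₂) := by
  have hf0 : ∀ ξ ∈ unitSphere n, 0 < f ξ := fun ξ hξ => hlam.trans_le (hfb ξ hξ).1
  have hK₁ : IsBody K₁ := ⟨hK₁c, hK₁conv, hK₁0⟩
  have hK₂ : IsBody K₂ := ⟨hK₂c, hK₂conv, hK₂0⟩
  have hg := hglip.continuousOn
  refine ⟨fun hpq => ?_, ?_⟩
  · exact (subset_of_isAleksandrovSolution hpq hK₁ hK₂ hsol₁ hsol₂ hfm hg hf0 hgpos).antisymm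
      (subset_of_isAleksandrovSolution hpq hK₂ hK₁ hsol₂ hsol₁ hfm hg hf0 hgpos)
  · rintro rfl
    exact (hasCommonNormals_of_isAleksandrovSolution hK₁ hK₂ hsol₁ hsol₂ hfm hg hf0
      hgpos).exists_eq_smul hn hK₁ hK₂
end
end
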